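/- arXiv:2401.00485 — 3 statements merged into one kernel-verified Lean document; each statement's English description precedes it below -/
import Mathlib

section
/- Let A be a von Neumann algebra, let B be a complex unital Banach algebra, and let T : A → B be a surjective additive map that preserves the spectrum, i.e. σ(Tx) = σ(x) for every x ∈ A. Then T is a Jordan isomorphism; that is, T is bijective, complex-linear, unital, and satisfies T(x²) = (Tx)² for all x ∈ A. -/
section

open Filter Topology Pointwise

section BanachAlgebra

variable {B : Type*} [NormedRing B] [NormedAlgebra ℂ B] [CompleteSpace B]

theorem spectrum.norm_le_of_mem_of_complete {a : B} {μ : ℂ} (h : μ ∈ spectrum ℂ a) :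
    ‖μ‖ ≤ ‖a‖ := by
  by_contra! hlt
  have hμ : μ ≠ 0 := by
    rintro rfl
    exact (norm_nonneg a).not_gt (by simpa using hlt)
  refine spectrum.mem_iff.1 h ?_
  have h1 : IsUnit (1 - μ⁻¹ • a) := by
    refine isUnit_one_sub_of_norm_lt_one ?_
    rw [norm_smul, norm_inv, inv_mul_lt_iff₀ (norm_pos_iff.2 hμ), mul_one]
    exact hlt
  have h2 : algebraMap ℂ B μ - a = algebraMap ℂ B μ * (1 - μ⁻¹ • a) := by
    rw [← Algebra.smul_def, smul_sub, smul_inv_smul₀ hμ, Algebra.algebraMap_eq_smul_one]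
  rw [h2]
  exact ((isUnit_iff_ne_zero.2 hμ).map (algebraMap ℂ B)).mul h1

theorem exists_norm_pow_two_pow_lt {a : B} {C C' : ℝ} (hC : 0 ≤ C) (hCC' : C < C')
    (h : ∀ μ ∈ spectrum ℂ a, ‖μ‖ ≤ C) : ∃ k : ℕ, ‖a ^ 2 ^ k‖ < C' ^ 2 ^ k := by
  have hr : spectralRadius ℂ a < ENNReal.ofReal C' := by
    refine lt_of_le_of_lt (b := ENNReal.ofReal C) ?_ ((ENNReal.ofReal_lt_ofReal_iff
      (hC.trans_lt hCC')).2 hCC')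
    refine iSup₂_le fun μ hμ => ?_
    rw [← ENNReal.ofReal_coe_nnreal, coe_nnnorm]
    exact ENNReal.ofReal_le_ofReal (h μ hμ)
  have hev := ((spectrum.pow_norm_pow_one_div_tendsto_nhds_spectralRadius a).comp
    (tendsto_pow_atTop_atTop_of_one_lt (one_lt_two (α := ℕ)))).eventually (gt_mem_nhds hr)
  obtain ⟨k, hk⟩ := hev.exists
  refine ⟨k, ?_⟩
  have h1 : ‖a ^ 2 ^ k‖ ^ (1 / ((2 ^ k : ℕ) : ℝ)) < C' :=
    (ENNReal.ofReal_lt_ofReal_iff (hC.trans_lt hCC')).1 hk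
  have h2 := pow_lt_pow_left₀ h1 (by positivity) (n := 2 ^ k) (by positivity)
  rwa [one_div, Real.rpow_inv_natCast_pow (norm_nonneg _) (by positivity)] at h2

theorem spectrum_norm_le_of_forall_mem_frontier {U : Set ℂ} (hU : Bornology.IsBounded U)
    {f : ℂ → B} (hf : DiffContOnCl ℂ f U) {C : ℝ} (hC : 0 ≤ C)
    (h : ∀ z ∈ frontier U, ∀ μ ∈ spectrum ℂ (f z), ‖μ‖ ≤ C) {z : ℂ} (hz : z ∈ closure U)
    {μ : ℂ} (hμ : μ ∈ spectrum ℂ (f z)) : ‖μ‖ ≤ C := by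
  refine le_of_forall_gt_imp_ge_of_dense fun C' hC' => ?_
  have hC'0 : 0 ≤ C' := hC.trans hC'.le
  let V : ℕ → Set B := fun k => {x | ‖x ^ 2 ^ k‖ < C' ^ 2 ^ k}
  have hVmono : Monotone V := by
    refine monotone_nat_of_le_succ fun k x (hx : ‖x ^ 2 ^ k‖ < _) => ?_
    change ‖x ^ 2 ^ (k + 1)‖ < C' ^ 2 ^ (k + 1)
    rw [pow_succ 2, pow_mul, pow_mul, sq, sq]
    exact (norm_mul_le _ _).trans_lt (mul_self_lt_mul_self (norm_nonneg _) hx)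
  have hcomp : IsCompact (f '' frontier U) :=
    (Metric.isCompact_of_isClosed_isBounded isClosed_frontier
      (hU.closure.subset frontier_subset_closure)).image_of_continuousOn
      (hf.continuousOn.mono frontier_subset_closure)
  obtain ⟨k, hk⟩ := hcomp.elim_directed_cover V
    (fun k => isOpen_lt (by fun_prop) continuous_const)
    (by
      rintro _ ⟨w, hw, rfl⟩
      exact Set.mem_iUnion.2 (exists_norm_pow_two_pow_lt hC hC' (h w hw)))
    hVmono.directed_le
  have hfk : DiffContOnCl ℂ (fun w => f w ^ 2 ^ k) U :=
    ⟨hf.differentiableOn.pow _, hf.continuousOn.pow _⟩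
  have hmax := Complex.norm_le_of_forall_mem_frontier_norm_le hU hfk
    (fun w hw => (show ‖f w ^ 2 ^ k‖ < C' ^ 2 ^ k from hk ⟨w, hw, rfl⟩).le) hz
  have h1 := (spectrum.norm_le_of_mem_of_complete (spectrum.pow_mem_pow (f z) (2 ^ k) hμ)).trans hmax
  rw [norm_pow] at h1
  exact (pow_le_pow_iff_left₀ (norm_nonneg _) hC'0 (by positivity)).1 h1


theorem isUnit_one_add_mul_comm {R : Type*} [Ring R] {x y : R} :
    IsUnit (1 + x * y) ↔ IsUnit (1 + y * x) := by
  have key : ∀ x y : R, IsUnit (1 + x * y) → IsUnit (1 + y * x) := by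
    rintro x y ⟨u, hu⟩
    have h1 : (↑u⁻¹ : R) + x * (y * ↑u⁻¹) = 1 := by
      have := u.mul_inv
      rwa [hu, add_mul, one_mul, mul_assoc] at this
    have h2 : (↑u⁻¹ : R) + ↑u⁻¹ * (x * y) = 1 := by
      have := u.inv_mul
      rwa [hu, mul_add, mul_one] at this
    refine ⟨⟨1 + y * x, 1 - y * ↑u⁻¹ * x, ?_, ?_⟩, rfl⟩
    · calc (1 + y * x) * (1 - y * ↑u⁻¹ * x)
          = 1 + y * x - y * (↑u⁻¹ + x * (y * ↑u⁻¹)) * x := by noncomm_ring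
        _ = 1 := by rw [h1]; noncomm_ring
    · calc (1 - y * ↑u⁻¹ * x) * (1 + y * x)
          = 1 + y * x - y * (↑u⁻¹ + ↑u⁻¹ * (x * y)) * x := by noncomm_ring
        _ = 1 := by rw [h2]; noncomm_ring
  exact ⟨key x y, key y x⟩

omit [NormedAlgebra ℂ B] in
theorem isUnit_of_tendsto_of_norm_inverse_le {ι : Type*} {l : Filter ι} [l.NeBot] {u : ι → B}
    {c : B} {C : ℝ} (hu : Tendsto u l (𝓝 c)) (hunit : ∀ᶠ n in l, IsUnit (u n))
    (hC : ∀ᶠ n in l, ‖Ring.inverse (u n)‖ ≤ C) : IsUnit c := by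
  have h0 : Tendsto (fun n => C * ‖u n - c‖) l (𝓝 0) := by
    simpa using (tendsto_iff_norm_sub_tendsto_zero.1 hu).const_mul C
  obtain ⟨n, hn1, hn2, hn3⟩ := (hunit.and (hC.and (h0.eventually (gt_mem_nhds one_pos)))).exists
  have h1 : c = u n * (1 - Ring.inverse (u n) * (u n - c)) := by
    rw [mul_sub, ← mul_assoc, Ring.mul_inverse_cancel _ hn1]
    noncomm_ring
  rw [h1]
  refine hn1.mul (isUnit_one_sub_of_norm_lt_one ((norm_mul_le _ _).trans_lt ?_))
  exact (mul_le_mul_of_nonneg_right hn2 (norm_nonneg _)).trans_lt hn3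

theorem isUnit_sub_algebraMap_of_tendsto_of_sphere {ι : Type*} {l : Filter ι} [l.NeBot]
    {u : ι → B} {c : B} {ν : ℂ} {ρ : ℝ} (hρ : 0 < ρ) (hu : Tendsto u l (𝓝 c))
    (hunit : ∀ᶠ n in l, ∀ μ ∈ Metric.closedBall ν ρ, IsUnit (u n - algebraMap ℂ B μ))
    (hc : ∀ μ ∈ Metric.sphere ν ρ, IsUnit (c - algebraMap ℂ B μ)) :
    IsUnit (c - algebraMap ℂ B ν) := by
  have hcont : ∀ x : B, ∀ μ : ℂ, IsUnit (x - algebraMap ℂ B μ) →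
      ContinuousAt (fun z : B × ℂ => Ring.inverse (z.1 - algebraMap ℂ B z.2)) (x, μ) := by
    intro x μ h
    obtain ⟨v, hv⟩ := h
    refine ContinuousAt.comp (g := Ring.inverse)
      (f := fun z : B × ℂ => z.1 - algebraMap ℂ B z.2) ?_ (by fun_prop)
    simp only [← hv]
    exact NormedRing.inverse_continuousAt v
  obtain ⟨C, hC⟩ := (isCompact_sphere ν ρ).exists_bound_of_continuousOn
    (f := fun μ => Ring.inverse (c - algebraMap ℂ B μ)) fun μ hμ =>
      (ContinuousAt.comp (f := fun μ => (c, μ)) (hcont c μ (hc μ hμ))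
        (by fun_prop)).continuousWithinAt
  have hev : ∀ᶠ x in 𝓝 c, ∀ μ ∈ Metric.sphere ν ρ,
      ‖Ring.inverse (x - algebraMap ℂ B μ)‖ < C + 1 :=
    (isCompact_sphere ν ρ).eventually_forall_of_forall_eventually fun μ hμ =>
      (hcont c μ (hc μ hμ)).norm.eventually (gt_mem_nhds ((hC μ hμ).trans_lt (lt_add_one C)))
  refine isUnit_of_tendsto_of_norm_inverse_le (C := C + 1)
    (hu.sub_const (algebraMap ℂ B ν)) (hunit.mono fun n h => h ν (by simp [hρ.le])) ?_
  filter_upwards [hunit, hu.eventually hev] with n hn1 hn2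
  have hd : DifferentiableOn ℂ (fun μ => Ring.inverse (u n - algebraMap ℂ B μ))
      (closure (Metric.ball ν ρ)) := by
    intro μ hμ
    have hμ' : μ ∈ Metric.closedBall ν ρ := Metric.closure_ball_subset_closedBall hμ
    have hl : DifferentiableAt ℂ (fun μ => u n - algebraMap ℂ B μ) μ :=
      ((Algebra.linearMap ℂ B).toContinuousLinearMap.differentiableAt).const_sub (u n)
    exact ((differentiableAt_inverse (hn1 μ hμ')).comp μ hl).differentiableWithinAt
  refine Complex.norm_le_of_forall_mem_frontier_norm_le Metric.isBounded_ball hd.diffContOnCl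
    (fun μ hμ => ?_) (subset_closure (Metric.mem_ball_self hρ))
  rw [frontier_ball ν hρ.ne'] at hμ
  exact (hn2 μ hμ).le

theorem tendsto_inv_ofReal_mul_atTop (ω : ℂ) :
    Tendsto (fun t : ℝ => ((t : ℂ) * ω)⁻¹) atTop (𝓝 0) := by
  have h := ((Complex.continuous_ofReal.tendsto 0).comp tendsto_inv_atTop_zero).mul_const ω⁻¹
  simpa [Function.comp_def, mul_inv, mul_comm] using h

omit [CompleteSpace B] in
theorem smul_one_sub_add_smul_mul {E : B} (hE : E * E = E) (c d c' d' : ℂ) :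
    (c • (1 - E) + d • E) * (c' • (1 - E) + d' • E) = (c * c') • (1 - E) + (d * d') • E := by
  have h1 : (1 - E) * (1 - E) = 1 - E := by simp [mul_sub, sub_mul, hE]
  have h2 : (1 - E) * E = 0 := by simp [sub_mul, hE]
  have h3 : E * (1 - E) = 0 := by simp [mul_sub, hE]
  simp [add_mul, mul_add, h1, h2, h3, hE, smul_smul, mul_comm]

omit [CompleteSpace B] in
theorem isUnit_smul_one_sub_add_smul {E : B} (hE : E * E = E) {c d : ℂ} (hc : c ≠ 0)
    (hd : d ≠ 0) : IsUnit (c • (1 - E) + d • E) := by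
  refine ⟨⟨c • (1 - E) + d • E, c⁻¹ • (1 - E) + d⁻¹ • E, ?_, ?_⟩, rfl⟩ <;>
    simp [smul_one_sub_add_smul_mul hE, hc, hd]

/-- The element `1 + E * (b - 1)` is invertible exactly when the compression `E * b * E` is
invertible in the corner of the idempotent `E`; this is detected by the invertibility of small
perturbations of `c • (1 - E) + b` for large `c`. -/
theorem eventually_isUnit_of_isUnit_one_add_mul {E b : B} (hE : E * E = E) {ω : ℂ} (hω : ω ≠ 0)
    (h : IsUnit (1 + E * (b - 1))) :
    ∀ᶠ z : ℝ × B in atTop ×ˢ 𝓝 0, IsUnit ((z.1 * ω : ℂ) • (1 - E) + b + z.2) := by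
  have htend : Tendsto (fun z : ℝ × B => 1 + E * (b - 1) + E * z.2
      + ((z.1 : ℂ) * ω)⁻¹ • ((1 - E) * (b + z.2))) (atTop ×ˢ 𝓝 0) (𝓝 (1 + E * (b - 1))) := by
    have h1 : Tendsto (fun z : ℝ × B => ((z.1 : ℂ) * ω)⁻¹) (atTop ×ˢ 𝓝 0) (𝓝 0) :=
      (tendsto_inv_ofReal_mul_atTop ω).comp tendsto_fst
    have h2 : Tendsto (fun z : ℝ × B => z.2) (atTop ×ˢ 𝓝 0) (𝓝 0) := tendsto_snd
    have h3 := ((h2.const_mul E).const_add (1 + E * (b - 1))).add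
      (h1.smul ((h2.const_add b).const_mul (1 - E)))
    simpa using h3
  have hpos : ∀ᶠ z : ℝ × B in atTop ×ˢ 𝓝 0, 0 < z.1 :=
    tendsto_fst.eventually (eventually_gt_atTop 0)
  filter_upwards [htend.eventually (Units.isOpen.mem_nhds h), hpos] with z hz hz0
  set c : ℂ := z.1 * ω with hc
  have hc0 : c ≠ 0 := mul_ne_zero (by exact_mod_cast hz0.ne') hω
  have hu : IsUnit (c • (1 - E) + E) := by
    simpa using isUnit_smul_one_sub_add_smul hE hc0 one_ne_zero
  convert hu.mul hz using 1
  simp only [add_mul, mul_add, smul_mul_assoc, mul_smul_comm, sub_mul, mul_sub, hE, one_mul,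
    mul_one, smul_smul, smul_sub, smul_add, inv_mul_cancel₀ hc0, ← mul_assoc, one_smul]
  abel

theorem isUnit_one_add_mul_of_eventually {E b : B} (hE : E * E = E) {ω : ℂ} (hω : ω ≠ 0)
    (h : ∀ᶠ z : ℝ × B in atTop ×ˢ 𝓝 0, IsUnit ((z.1 * ω : ℂ) • (1 - E) + b + z.2)) :
    IsUnit (1 + E * (b - 1)) := by
  have h1 := tendsto_inv_ofReal_mul_atTop ω
  have h2 : Tendsto (fun t : ℝ => (t, ((t : ℂ) * ω)⁻¹ • (E * b * (1 - E) * b))) atTop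
      (atTop ×ˢ 𝓝 0) := by
    refine tendsto_id.prodMk ?_
    simpa using h1.smul_const (E * b * (1 - E) * b)
  have h3 : Tendsto (fun t : ℝ => 1 + ((t : ℂ) * ω)⁻¹ • ((1 - E) * b)) atTop (𝓝 1) := by
    simpa using (h1.smul_const ((1 - E) * b)).const_add 1
  obtain ⟨t, ht1, ht2, ht0⟩ := ((h2.eventually h).and
    ((h3.eventually (Units.isOpen.mem_nhds isUnit_one)).and (eventually_gt_atTop 0))).exists
  set c : ℂ := t * ω with hc
  have hc0 : c ≠ 0 := mul_ne_zero (by exact_mod_cast ht0.ne') hω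
  have hu : IsUnit (c⁻¹ • (1 - E) + E) := by
    simpa using isUnit_smul_one_sub_add_smul hE (inv_ne_zero hc0) one_ne_zero
  have hprod := hu.mul ht1
  have key : (c⁻¹ • (1 - E) + E) * (c • (1 - E) + b + c⁻¹ • (E * b * (1 - E) * b))
      = (1 + E * (b - 1)) * (1 + c⁻¹ • ((1 - E) * b)) := by
    have hE' : ∀ x, E * (E * x) = E * x := fun x => by rw [← mul_assoc, hE]
    simp only [add_mul, mul_add, smul_mul_assoc, mul_smul_comm, sub_mul, mul_sub, hE, one_mul,
      mul_one, smul_smul, smul_sub, smul_add, mul_inv_cancel₀ hc0, mul_assoc, one_smul, hE']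
    abel
  rw [key] at hprod
  obtain ⟨w, hw⟩ := ht2
  rwa [← hw, Units.isUnit_mul_units] at hprod

omit [NormedAlgebra ℂ B] in
theorem exists_inverse_one_sub_norm_le {y : B} (hy : ‖y‖ ≤ 1 / 2) :
    ∃ v : B, v * (1 - y) = 1 ∧ (1 - y) * v = 1 ∧ ‖v‖ ≤ ‖(1 : B)‖ + 1 := by
  have hlt : ‖y‖ < 1 := hy.trans_lt (by norm_num)
  refine ⟨∑' n : ℕ, y ^ n, geom_series_mul_neg y hlt, mul_neg_geom_series y hlt,
    (tsum_geometric_le_of_norm_lt_one y hlt).trans ?_⟩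
  have : (1 - ‖y‖)⁻¹ ≤ 2 := inv_le_of_inv_le₀ (by norm_num) (by linarith)
  linarith

omit [CompleteSpace B] in
theorem isUnit_smul_sub_one_of_perturbation {q : B}
    (h : ∀ l : ℂ, l ≠ 0 → l ≠ 1 → IsUnit (q - l • (1 : B))) {w : ℂ} (hw : w ≠ 1) :
    IsUnit (w • q - 1) := by
  rcases eq_or_ne w 0 with rfl | hw0
  · simp
  · have h1 : w • q - 1 = algebraMap ℂ B w * (q - w⁻¹ • (1 : B)) := by
      rw [← Algebra.smul_def, smul_sub, smul_inv_smul₀ hw0]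
    rw [h1]
    exact ((isUnit_iff_ne_zero.2 hw0).map (algebraMap ℂ B)).mul
      (h _ (inv_ne_zero hw0) (by simpa using hw))

theorem isUnit_smul_sub_mul_of_perturbation {q : B} {K : ℝ}
    (h : ∀ (l : ℂ) (b : B), l ≠ 0 → l ≠ 1 → K * ‖b‖ < min ‖l‖ ‖l - 1‖ →
      IsUnit (q - l • (1 : B) + b)) (hK : 1 ≤ K) (x : B) {w μ : ℂ} (hw : w ≠ 1)
    (hw2 : 1 / 2 ≤ ‖w‖)
    (hC : 2 * (‖q‖ + 3 * ‖(1 : B)‖) * ‖x‖ + 3 * K * (‖x‖ * (‖(1 : B)‖ + 1)) < ‖μ‖ * ‖w‖) :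
    IsUnit (μ • (w • q - 1) - (q * q - q) * x) := by
  have hw0 : w ≠ 0 := by
    rintro rfl
    norm_num at hw2
  have hwpos : 0 < ‖w‖ := norm_pos_iff.2 hw0
  have hx : 0 ≤ ‖x‖ := norm_nonneg x
  have hq : 0 ≤ ‖q‖ := norm_nonneg q
  have h1 : 0 ≤ ‖(1 : B)‖ := norm_nonneg _
  have hμ0 : μ ≠ 0 := by
    rintro rfl
    have : 0 ≤ 2 * (‖q‖ + 3 * ‖(1 : B)‖) * ‖x‖ + 3 * K * (‖x‖ * (‖(1 : B)‖ + 1)) := by positivity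
    simp only [norm_zero, zero_mul] at hC
    exact this.not_gt hC
  have hμpos : 0 < ‖μ‖ := norm_pos_iff.2 hμ0
  have h1w : ‖1 - w‖ ≤ 3 * ‖w‖ := by
    have := norm_sub_le (1 : ℂ) w
    rw [norm_one] at this
    linarith
  have h1wpos : 0 < ‖1 - w‖ := norm_pos_iff.2 (sub_ne_zero.2 hw.symm)
  set y : B := (μ⁻¹ * (w⁻¹ * w⁻¹)) • ((w • q + (1 - w) • (1 : B)) * x) with hy
  have hyn : ‖y‖ ≤ 1 / 2 := by
    have e1 : ‖w • q + (1 - w) • (1 : B)‖ ≤ ‖w‖ * (‖q‖ + 3 * ‖(1 : B)‖) := by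
      refine (norm_add_le _ _).trans ?_
      rw [norm_smul, norm_smul]
      nlinarith
    have e2 : ‖y‖ ≤ ‖μ‖⁻¹ * (‖w‖⁻¹ * ‖w‖⁻¹) * (‖w‖ * (‖q‖ + 3 * ‖(1 : B)‖) * ‖x‖) := by
      rw [hy, norm_smul, norm_mul, norm_mul, norm_inv, norm_inv]
      gcongr
      exact (norm_mul_le _ _).trans (by gcongr)
    refine e2.trans ?_
    have e3 : ‖μ‖⁻¹ * (‖w‖⁻¹ * ‖w‖⁻¹) * (‖w‖ * (‖q‖ + 3 * ‖(1 : B)‖) * ‖x‖)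
        = ((‖q‖ + 3 * ‖(1 : B)‖) * ‖x‖) / (‖μ‖ * ‖w‖) := by field_simp
    rw [e3, div_le_iff₀ (by positivity)]
    have : 0 ≤ 3 * K * (‖x‖ * (‖(1 : B)‖ + 1)) := by positivity
    linarith
  obtain ⟨v, hv1, hv2, hvn⟩ := exists_inverse_one_sub_norm_le hyn
  set b : B := -((w⁻¹ ^ 3 * (1 - w) * μ⁻¹) • (x * v)) with hb
  have hbn : ‖b‖ ≤ ‖w‖⁻¹ ^ 3 * ‖1 - w‖ * ‖μ‖⁻¹ * (‖x‖ * (‖(1 : B)‖ + 1)) := by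
    rw [hb, norm_neg, norm_smul, norm_mul, norm_mul, norm_pow, norm_inv, norm_inv]
    gcongr
    exact (norm_mul_le _ _).trans (by gcongr)
  have hKb : K * ‖b‖ < min ‖w⁻¹‖ ‖w⁻¹ - 1‖ := by
    have e0 : K * ‖b‖ ≤ K * (‖x‖ * (‖(1 : B)‖ + 1)) * ‖1 - w‖ / (‖w‖ ^ 3 * ‖μ‖) := by
      refine (mul_le_mul_of_nonneg_left hbn (by positivity)).trans_eq ?_
      field_simp
    have e1 : ‖w⁻¹ - 1‖ = ‖1 - w‖ / ‖w‖ := by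
      rw [← norm_div, sub_div, div_self hw0, one_div]
    have hZ : 0 ≤ 2 * (‖q‖ + 3 * ‖(1 : B)‖) * ‖x‖ := by positivity
    have hZ' : 0 ≤ K * (‖x‖ * (‖(1 : B)‖ + 1)) := by positivity
    set Z := K * (‖x‖ * (‖(1 : B)‖ + 1)) with hZdef
    have hC' : 3 * Z < ‖μ‖ * ‖w‖ := by rw [hZdef]; linarith
    refine e0.trans_lt (lt_min ?_ ?_)
    · rw [norm_inv, div_lt_iff₀ (by positivity)]
      have : ‖w‖⁻¹ * (‖w‖ ^ 3 * ‖μ‖) = (‖μ‖ * ‖w‖) * ‖w‖ := by field_simp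
      rw [this]
      nlinarith
    · rw [e1, div_lt_iff₀ (by positivity)]
      have : ‖1 - w‖ / ‖w‖ * (‖w‖ ^ 3 * ‖μ‖) = ‖1 - w‖ * ((‖μ‖ * ‖w‖) * ‖w‖) := by field_simp
      rw [this, mul_comm]
      refine mul_lt_mul_of_pos_left ?_ h1wpos
      nlinarith
  have hunit := h w⁻¹ b (inv_ne_zero hw0) (by simpa using hw) hKb
  have hfac : μ • (w • q - 1) - (q * q - q) * x
      = (algebraMap ℂ B w * (q - w⁻¹ • (1 : B) + b)) * (algebraMap ℂ B μ * (1 - y)) := by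
    have hvy : x * v * (1 - y) = x := by rw [mul_assoc, hv1, mul_one]
    have e1 : (q - w⁻¹ • (1 : B) + b) * (1 - y)
        = (q - w⁻¹ • (1 : B)) * (1 - y) - (w⁻¹ ^ 3 * (1 - w) * μ⁻¹) • x := by
      rw [hb, add_mul, neg_mul, smul_mul_assoc, hvy, ← sub_eq_add_neg]
    rw [← Algebra.smul_def, ← Algebra.smul_def, smul_mul_smul_comm, e1, hy]
    simp only [sub_mul, mul_sub, add_mul, mul_add, smul_mul_assoc, mul_smul_comm, one_mul, mul_one,
      smul_sub, smul_add, smul_smul, mul_assoc]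
    match_scalars <;> field_simp <;> ring
  rw [hfac]
  exact (((isUnit_iff_ne_zero.2 hw0).map (algebraMap ℂ B)).mul hunit).mul
    (((isUnit_iff_ne_zero.2 hμ0).map (algebraMap ℂ B)).mul ⟨⟨1 - y, v, hv2, hv1⟩, rfl⟩)

theorem isUnit_one_add_mul_of_perturbation {q : B} {K : ℝ} (hK : 1 ≤ K)
    (h : ∀ (l : ℂ) (b : B), l ≠ 0 → l ≠ 1 → K * ‖b‖ < min ‖l‖ ‖l - 1‖ →
      IsUnit (q - l • (1 : B) + b)) (x : B) : IsUnit (1 + (q * q - q) * x) := by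
  set C : ℝ := 2 * (‖q‖ + 3 * ‖(1 : B)‖) * ‖x‖ + 3 * K * (‖x‖ * (‖(1 : B)‖ + 1)) with hCdef
  have hC : 0 ≤ C := by positivity
  have hres : ∀ w : ℂ, w ≠ 1 → IsUnit (w • q - 1) := fun w hw =>
    isUnit_smul_sub_one_of_perturbation (fun l hl0 hl1 => by
      simpa using h l 0 hl0 hl1 (by simp [hl0, sub_ne_zero.2 hl1])) hw
  let k : ℂ → B := fun w => Ring.inverse (w • q - 1) * ((q * q - q) * x)
  let f : ℂ → B := fun w => (w - 1) • (k w) ^ 2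
  have hk : ∀ w : ℂ, w ≠ 1 → 1 / 2 ≤ ‖w‖ → ∀ μ ∈ spectrum ℂ (k w), ‖μ‖ ≤ C / ‖w‖ := by
    intro w hw hw2 μ hμ
    rw [le_div_iff₀ (by linarith)]
    by_contra! hlt
    refine spectrum.mem_iff.1 hμ ?_
    have h1 := isUnit_smul_sub_mul_of_perturbation h hK x hw hw2 hlt
    have h2 : algebraMap ℂ B μ - k w
        = Ring.inverse (w • q - 1) * (μ • (w • q - 1) - (q * q - q) * x) := by
      rw [mul_sub, mul_smul_comm, Ring.inverse_mul_cancel _ (hres w hw),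
        Algebra.algebraMap_eq_smul_one]
    rw [h2]
    exact (hres w hw).ringInverse.mul h1
  have hf : ∀ w : ℂ, w ≠ 1 → 1 / 2 ≤ ‖w‖ → ∀ ν ∈ spectrum ℂ (f w),
      ‖ν‖ ≤ ‖w - 1‖ * (C / ‖w‖) ^ 2 := by
    intro w hw hw2 ν hν
    have hw1 : w - 1 ≠ 0 := sub_ne_zero.2 hw
    have h1 : spectrum ℂ (f w) = (Units.mk0 (w - 1) hw1) • spectrum ℂ (k w ^ 2) :=
      spectrum.unit_smul_eq_smul (k w ^ 2) (Units.mk0 (w - 1) hw1)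
    rw [h1, spectrum.map_pow_of_pos _ (by norm_num)] at hν
    obtain ⟨_, ⟨μ, hμ, rfl⟩, rfl⟩ := hν
    have h2 : ‖Units.mk0 (w - 1) hw1 • μ ^ 2‖ = ‖w - 1‖ * ‖μ‖ ^ 2 := by
      simp [Units.smul_def]
    refine h2.trans_le ?_
    have := hk w hw hw2 μ hμ
    gcongr
  have hdiff : ∀ w : ℂ, w ≠ 1 → DifferentiableAt ℂ f w := by
    intro w hw
    have hl : DifferentiableAt ℂ (fun w : ℂ => w • q - 1) w := by fun_prop
    have hinv : DifferentiableAt ℂ (fun w : ℂ => Ring.inverse (w • q - 1)) w :=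
      DifferentiableAt.comp (g := Ring.inverse) w (differentiableAt_inverse (hres w hw)) hl
    exact (differentiableAt_id.sub_const 1).smul ((hinv.mul_const _).pow 2)
  set ε : ℝ := 1 / (8 * C ^ 2 + 2) with hε
  set R : ℝ := 8 * C ^ 2 + 2 with hR
  have hR2 : 2 ≤ R := by nlinarith
  have hε0 : 0 < ε := by positivity
  have hε2 : ε ≤ 1 / 2 := one_div_le_one_div_of_le (by norm_num) hR2
  set U : Set ℂ := (fun w => ‖w - 1‖) ⁻¹' Set.Ioo ε R with hU
  have hcont : Continuous fun w : ℂ => ‖w - 1‖ := by fun_prop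
  have hUb : Bornology.IsBounded U :=
    (Metric.isBounded_ball (x := (1 : ℂ)) (r := R)).subset fun w hw => by
      simpa [dist_eq_norm] using hw.2
  have hcl : closure U ⊆ (fun w => ‖w - 1‖) ⁻¹' Set.Icc ε R := by
    refine (hcont.closure_preimage_subset _).trans (Set.preimage_mono ?_)
    rw [closure_Ioo (by linarith)]
  have hfr : frontier U ⊆ (fun w => ‖w - 1‖) ⁻¹' {ε, R} := by
    refine (hcont.frontier_preimage_subset _).trans (Set.preimage_mono ?_)
    rw [frontier_Ioo (by linarith)]
  have hfU : DiffContOnCl ℂ f U := by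
    refine DifferentiableOn.diffContOnCl fun w hw => (hdiff w ?_).differentiableWithinAt
    rintro rfl
    have := (hcl hw).1
    simp at this
    linarith
  have hfrb : ∀ w ∈ frontier U, ∀ ν ∈ spectrum ℂ (f w), ‖ν‖ ≤ 1 / 2 := by
    intro w hw ν hν
    have hn : ‖w - 1‖ = ε ∨ ‖w - 1‖ = R := hfr hw
    have hw1 : w ≠ 1 := by
      rintro rfl
      rw [sub_self, norm_zero] at hn
      rcases hn with hn | hn <;> linarith
    have htri1 : 1 - ‖w - 1‖ ≤ ‖w‖ := by
      have := norm_sub_le w (w - 1)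
      rw [sub_sub_cancel, norm_one] at this
      linarith
    have htri2 : ‖w - 1‖ - 1 ≤ ‖w‖ := by
      have := norm_sub_le w 1
      rw [norm_one] at this
      linarith
    have hw2 : 1 / 2 ≤ ‖w‖ := by rcases hn with hn | hn <;> linarith
    have hwpos : 0 < ‖w‖ := by linarith
    refine (hf w hw1 hw2 ν hν).trans ?_
    rcases hn with hn | hn
    · rw [hn]
      have : C / ‖w‖ ≤ 2 * C := by
        rw [div_le_iff₀ hwpos]
        nlinarith
      calc ε * (C / ‖w‖) ^ 2 ≤ ε * (2 * C) ^ 2 := by gcongr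
        _ = (2 * C) ^ 2 / R := by rw [hε]; ring
        _ ≤ 1 / 2 := by
          rw [div_le_iff₀ (by linarith)]
          nlinarith
    · have hwR : R / 2 ≤ ‖w‖ := by linarith
      rw [hn]
      calc R * (C / ‖w‖) ^ 2 ≤ R * (C / (R / 2)) ^ 2 := by gcongr
        _ = 4 * C ^ 2 / R := by
          have : R ≠ 0 := by positivity
          field_simp
          ring
        _ ≤ 1 / 2 := by
          rw [div_le_iff₀ (by linarith)]
          nlinarith
  have h0U : (0 : ℂ) ∈ closure U := subset_closure (by
    simp only [hU, Set.mem_preimage, zero_sub, norm_neg, norm_one]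
    constructor <;> linarith)
  by_contra hnu
  have hm1 : (-1 : ℂ) ∈ spectrum ℂ ((q * q - q) * x) := by
    rw [spectrum.mem_iff]
    intro h'
    refine hnu ?_
    convert h'.neg using 1
    simp [add_comm]
  have hf0 : f 0 = -((q * q - q) * x) ^ 2 := by
    have : Ring.inverse (-1 : B) = -1 := by simpa using Ring.inverse_unit (-1 : Bˣ)
    simp [f, k, this]
  have hm2 : (-1 : ℂ) ∈ spectrum ℂ (f 0) := by
    rw [hf0, ← spectrum.neg_eq, Set.mem_neg, neg_neg]
    have := spectrum.pow_mem_pow ((q * q - q) * x) 2 hm1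
    simpa using this
  have := spectrum_norm_le_of_forall_mem_frontier hUb hfU (by norm_num) hfrb h0U hm2
  norm_num at this

end BanachAlgebra

section CStar

variable {A : Type*} [CStarAlgebra A]

/-- Every self-adjoint element has a spectral projection for the positive half-line: a projection
in its bicommutant which supports the positive part and annihilates the negative part. -/
def HasPositiveProjections (A : Type*) [CStarAlgebra A] : Prop :=
  ∀ g : A, IsSelfAdjoint g → ∃ p : A, IsStarProjection p ∧ (∀ y, Commute y g → Commute y p) ∧
    g⁺ * p = g⁺ ∧ g⁻ * p = 0

theorem eq_zero_of_spectrum_add_subset {a : A}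
    (h : ∀ y : A, spectrum ℂ (a + y) ⊆ spectrum ℂ y) : a = 0 := by
  have hI : (starRingEnd ℂ) (Complex.I / 2) = -(Complex.I / 2) := by
    rw [map_div₀, Complex.conj_I, map_ofNat, neg_div]
  have h2 : (starRingEnd ℂ) (1 / 2 : ℂ) = 1 / 2 := by
    apply Complex.ext <;> simp
  set g : A := (Complex.I / 2) • (a - star a) with hg
  have hgs : IsSelfAdjoint g := by
    rw [IsSelfAdjoint, hg, star_smul, star_sub, star_star, RCLike.star_def, hI, neg_smul, ← smul_neg,
      neg_sub]
  set r : A := (1 / 2 : ℂ) • (a + star a) with hr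
  have hrs : IsSelfAdjoint r := by
    rw [IsSelfAdjoint, hr, star_smul, star_add, star_star, RCLike.star_def, h2, add_comm]
  have hag : a + Complex.I • g = r := by
    have hII : Complex.I * (Complex.I / 2) = -(1 / 2) := by
      rw [← mul_div_assoc, Complex.I_mul_I]; ring
    rw [hg, hr, smul_smul, hII]
    match_scalars <;> ring
  have hr0 : r = 0 := by
    refine CFC.eq_zero_of_spectrum_subset_zero (R := ℂ) (a := r) (fun μ hμ => ?_) hrs.isStarNormal
    have hμre : μ = μ.re := hrs.mem_spectrum_eq_re hμ
    have h3 := h (Complex.I • g) (hag ▸ hμ)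
    rw [show Complex.I • g = (Units.mk0 Complex.I Complex.I_ne_zero) • g from rfl,
      spectrum.unit_smul_eq_smul] at h3
    obtain ⟨ν, hν, hνμ⟩ := h3
    have hνre : ν = ν.re := hgs.mem_spectrum_eq_re hν
    have h4 : Complex.I * ν = μ := hνμ
    have h5 := congrArg Complex.re h4
    rw [hνre] at h5
    simp only [Complex.mul_re, Complex.I_re, Complex.I_im, Complex.ofReal_re, Complex.ofReal_im] at h5
    rw [Set.mem_singleton_iff, hμre, ← h5]
    simp
  have hsa : star a = -a := by
    have : (2 : ℂ) • r = 0 := by rw [hr0, smul_zero]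
    rw [hr, smul_smul] at this
    norm_num at this
    exact eq_neg_of_add_eq_zero_right this
  refine CFC.eq_zero_of_spectrum_subset_zero (R := ℂ) (a := a) (fun μ hμ => ?_)
    ⟨by rw [hsa]; exact (Commute.refl a).neg_left⟩
  have h6 := h 0 (by rwa [add_zero])
  simpa using spectrum.norm_le_of_mem_of_complete h6

variable [PartialOrder A] [StarOrderedRing A]

theorem isUnit_of_le_add_star {x : A} {δ : ℝ} (hδ : 0 < δ)
    (h : algebraMap ℝ A δ ≤ x + star x) : IsUnit x := by
  set t : ℝ := δ / (2 * (‖x‖ ^ 2 + 1)) with ht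
  have ht0 : 0 < t := by positivity
  have htx : t * ‖x‖ ^ 2 < δ := by
    rw [ht, div_mul_eq_mul_div, div_lt_iff₀ (by positivity)]
    nlinarith [sq_nonneg ‖x‖]
  have hsq : star (1 - t • x) * (1 - t • x) = 1 - t • (x + star x) + t ^ 2 • (star x * x) := by
    simp only [star_sub, star_one, star_smul, star_trivial, sub_mul, mul_sub, one_mul, mul_one,
      smul_mul_assoc, mul_smul_comm, sq]
    module
  have hle : star (1 - t • x) * (1 - t • x) ≤ algebraMap ℝ A (1 - t * δ + t ^ 2 * ‖x‖ ^ 2) := by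
    rw [hsq, map_add, map_sub, map_mul, map_mul, map_one, ← Algebra.smul_def, ← Algebra.smul_def]
    exact add_le_add (sub_le_sub_left (smul_le_smul_of_nonneg_left h ht0.le) 1)
      (smul_le_smul_of_nonneg_left CStarAlgebra.star_mul_le_algebraMap_norm_sq (sq_nonneg t))
  have hlt : ‖1 - t • x‖ < 1 := by
    have h1 : 1 - t * δ + t ^ 2 * ‖x‖ ^ 2 < 1 := by nlinarith
    have h0 := (CStarAlgebra.norm_le_iff_le_algebraMap _ (le_max_right _ 0)
      (star_mul_self_nonneg _)).2 (hle.trans (algebraMap_mono A (le_max_left _ 0)))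
    rw [CStarRing.norm_star_mul_self] at h0
    nlinarith [norm_nonneg (1 - t • x), max_lt h1 one_pos]
  have hu := isUnit_one_sub_of_norm_lt_one hlt
  rw [sub_sub_cancel, Algebra.smul_def] at hu
  have hut : IsUnit (algebraMap ℝ A t) := (isUnit_iff_ne_zero.2 ht0.ne').map _
  obtain ⟨v, hv⟩ := hut
  rwa [← hv, Units.isUnit_units_mul] at hu

theorem le_zero_of_not_isUnit_compression (hA : HasPositiveProjections A) {x : A}
    (h : ∀ p : A, IsStarProjection p → p ≠ 0 → ¬IsUnit (p * x * p + (1 - p))) :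
    x + star x ≤ 0 := by
  have hle : ∀ δ ∈ Set.Ioo (0 : ℝ) 1, x + star x ≤ algebraMap ℝ A δ := by
    intro δ hδ
    set g := x + star x - algebraMap ℝ A δ with hg
    have hgs : IsSelfAdjoint g :=
      (IsSelfAdjoint.add_star_self x).sub (IsSelfAdjoint.algebraMap A (.all δ))
    obtain ⟨p, hp, -, hp1, hp2⟩ := hA g hgs
    rcases eq_or_ne p 0 with rfl | hp0
    · rw [mul_zero] at hp1
      have := (CFC.posPart_eq_zero_iff g hgs).1 hp1.symm
      exact sub_nonpos.1 this
    · refine absurd (isUnit_of_le_add_star hδ.1 ?_) (h p hp hp0)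
      have hpp : p * p = p := hp.isIdempotentElem
      have hps : star p = p := hp.isSelfAdjoint
      have hgp : p * g * p = g⁺ := by
        have e1 : p * g⁺ = g⁺ := by
          have := congrArg star hp1
          rwa [star_mul, hps, (IsSelfAdjoint.of_nonneg (CFC.posPart_nonneg g)).star_eq] at this
        conv_lhs => rw [← CFC.posPart_sub_negPart g hgs]
        rw [mul_assoc, sub_mul, hp1, hp2, sub_zero, e1]
      have hsum : p * x * p + (1 - p) + star (p * x * p + (1 - p))
          = g⁺ + (δ • p + (2 : ℝ) • (1 - p)) := by
        rw [← hgp, hg, Algebra.algebraMap_eq_smul_one]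
        simp only [star_add, star_mul, star_sub, star_one, hps, mul_sub, sub_mul, mul_add, add_mul,
          mul_smul_comm, smul_mul_assoc, mul_one, hpp, mul_assoc]
        module
      have hrest : δ • p + (2 : ℝ) • (1 - p) = algebraMap ℝ A δ + (2 - δ) • (1 - p) := by
        rw [Algebra.algebraMap_eq_smul_one]
        module
      rw [hsum, hrest, add_left_comm]
      exact le_add_of_nonneg_right (add_nonneg (CFC.posPart_nonneg g)
        (smul_nonneg (by linarith [hδ.2]) hp.one_sub.nonneg))
  have hlim : Tendsto (fun δ : ℝ => algebraMap ℝ A δ) (𝓝[>] 0) (𝓝 0) := by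
    have := (continuous_algebraMap ℝ A).tendsto 0
    rw [map_zero] at this
    exact this.mono_left nhdsWithin_le_nhds
  exact ge_of_tendsto hlim (mem_of_superset (Ioo_mem_nhdsGT one_pos) hle)

theorem eq_zero_of_not_isUnit_compression (hA : HasPositiveProjections A) {a : A}
    (h : ∀ p : A, IsStarProjection p → p ≠ 0 → ¬IsUnit (p * a * p + (1 - p))) : a = 0 := by
  have hz : ∀ ζ : ℂ, ζ ≠ 0 → ζ • a + star (ζ • a) ≤ 0 := by
    intro ζ hζ
    refine le_zero_of_not_isUnit_compression hA fun p hp hp0 hu => h p hp hp0 ?_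
    have hpp : p * p = p := hp.isIdempotentElem
    obtain ⟨v, hv⟩ := isUnit_smul_one_sub_add_smul hpp one_ne_zero hζ
    rw [← v.isUnit_units_mul, hv]
    convert hu using 1
    simp only [add_mul, mul_add, smul_mul_assoc, mul_smul_comm, sub_mul, mul_sub, hpp, one_mul,
      mul_one, ← mul_assoc, one_smul]
    module
  have h1 := hz 1 one_ne_zero
  have h2 := hz (-1) (by simp)
  have h3 := hz Complex.I (by simp)
  have h4 := hz (-Complex.I) (by simp)
  simp only [star_smul, star_neg, RCLike.star_def, Complex.conj_I, neg_smul, one_smul,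
    neg_neg, ← neg_add, neg_nonpos] at h1 h2 h3 h4
  have h5 : a + star a = 0 := le_antisymm h1 h2
  have h6 : Complex.I • (a - star a) = 0 := by
    rw [smul_sub]
    refine le_antisymm (by simpa [sub_eq_add_neg] using h3) ?_
    simpa [sub_eq_add_neg, add_comm] using h4
  have h7 : a - star a = 0 := (smul_eq_zero.1 h6).resolve_left Complex.I_ne_zero
  have h8 : (2 : ℂ) • a = 0 := by
    rw [two_smul]
    calc a + a = (a + star a) + (a - star a) := by abel
      _ = 0 := by rw [h5, h7, add_zero]
  exact (smul_eq_zero.1 h8).resolve_left two_ne_zero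

/-- The projections in the bicommutant of `h`. -/
def commutingProjections (h : A) : Set A :=
  {p | IsStarProjection p ∧ ∀ y, Commute y h → Commute y p}

theorem exists_mem_span_commutingProjections_sub_le (hA : HasPositiveProjections A) {h : A} (n : ℕ)
    (c : ℝ) (k : A) (hk0 : 0 ≤ k) (hkc : k ≤ algebraMap ℝ A c)
    (hcomm : ∀ y, Commute y h → Commute y k) :
    ∃ s ∈ Submodule.span ℝ (commutingProjections h),
      0 ≤ k - s ∧ k - s ≤ algebraMap ℝ A (c / 2 ^ n) := by
  induction n generalizing c k with
  | zero => exact ⟨0, zero_mem _, by simpa using hk0, by simpa using hkc⟩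
  | succ n ih =>
    set g := k - algebraMap ℝ A (c / 2) with hg
    have hgs : IsSelfAdjoint g :=
      (IsSelfAdjoint.of_nonneg hk0).sub (IsSelfAdjoint.algebraMap A (.all (c / 2)))
    obtain ⟨p, hp, hpc, hp1, hp2⟩ := hA g hgs
    have hpp : p * p = p := hp.isIdempotentElem
    have hps : star p = p := hp.isSelfAdjoint
    have hp3 : p * g⁺ = g⁺ := by
      have := congrArg star hp1
      rwa [star_mul, hps, (IsSelfAdjoint.of_nonneg (CFC.posPart_nonneg g)).star_eq] at this
    have hp4 : p * g⁻ = 0 := by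
      have := congrArg star hp2
      rwa [star_mul, hps, (IsSelfAdjoint.of_nonneg (CFC.negPart_nonneg g)).star_eq, star_zero] at this
    have hkg : k = g⁺ - g⁻ + (c / 2) • (1 : A) := by
      rw [CFC.posPart_sub_negPart g hgs, hg, Algebra.algebraMap_eq_smul_one, sub_add_cancel]
    have hpcomm : ∀ y, Commute y h → Commute y p := fun y hy =>
      hpc y ((hcomm y hy).sub_right (Algebra.commutes _ y).symm)
    have e1 : k - (c / 2) • p = g⁺ + (1 - p) * k * (1 - p) := by
      rw [hkg]
      simp only [mul_add, add_mul, mul_sub, sub_mul, hp1, hp2, hp3, hp4, hpp, mul_smul_comm,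
        smul_mul_assoc, one_mul, mul_one, zero_mul]
      module
    have e2 : algebraMap ℝ A (c / 2) - (k - (c / 2) • p) = p * (algebraMap ℝ A c - k) * p + g⁻ := by
      rw [hkg, Algebra.algebraMap_eq_smul_one, Algebra.algebraMap_eq_smul_one]
      simp only [mul_add, add_mul, mul_sub, sub_mul, hp1, hp3, hp4, hpp, mul_smul_comm,
        smul_mul_assoc, mul_one, zero_mul]
      module
    obtain ⟨s, hs, hs0, hsc⟩ := ih (c / 2) (k - (c / 2) • p)
      (by
        rw [e1]
        exact add_nonneg (CFC.posPart_nonneg g) (hp.one_sub.isSelfAdjoint.conjugate_nonneg hk0))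
      (by
        rw [← sub_nonneg, e2]
        exact add_nonneg (hp.isSelfAdjoint.conjugate_nonneg (sub_nonneg.2 hkc))
          (CFC.negPart_nonneg g))
      (fun y hy => (hcomm y hy).sub_right ((hpcomm y hy).smul_right _))
    refine ⟨(c / 2) • p + s, add_mem (Submodule.smul_mem _ _ (Submodule.subset_span ⟨hp, hpcomm⟩)) hs,
      ?_, ?_⟩
    · rwa [← sub_sub]
    · rwa [← sub_sub, pow_succ', ← div_div]

theorem mem_closure_span_commutingProjections (hA : HasPositiveProjections A) {h : A}
    (hh : IsSelfAdjoint h) : h ∈ closure (Submodule.span ℝ (commutingProjections h) : Set A) := by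
  refine Metric.mem_closure_iff.2 fun ε hε => ?_
  obtain ⟨n, hn⟩ := exists_nat_gt (2 * ‖h‖ / ε)
  have hn2 : 2 * ‖h‖ / 2 ^ n < ε := by
    rw [div_lt_iff₀ (by positivity), mul_comm ε, ← div_lt_iff₀ hε]
    exact hn.trans (by exact_mod_cast Nat.lt_two_pow_self)
  obtain ⟨s, hs, hs0, hsc⟩ := exists_mem_span_commutingProjections_sub_le hA (h := h) n (2 * ‖h‖)
    (h + algebraMap ℝ A ‖h‖)
    (by simpa [neg_le_iff_add_nonneg] using hh.neg_algebraMap_norm_le_self)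
    (by
      rw [two_mul, map_add]
      exact add_le_add_left hh.le_algebraMap_norm_self _)
    (fun y hy => hy.add_right (Algebra.commutes _ y).symm)
  refine ⟨s - ‖h‖ • (1 : A), sub_mem hs (Submodule.smul_mem _ _ (Submodule.subset_span
    ⟨.one A, fun y _ => Commute.one_right y⟩)), ?_⟩
  rw [dist_eq_norm]
  have : h - (s - ‖h‖ • (1 : A)) = h + algebraMap ℝ A ‖h‖ - s := by
    rw [Algebra.algebraMap_eq_smul_one]
    abel
  rw [this]
  exact ((CStarAlgebra.norm_le_iff_le_algebraMap _ (by positivity) hs0).2 hsc).trans_lt hn2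

end CStar

section SpectrumPreserving

variable {A : Type*} [CStarAlgebra A] {B : Type*} [NormedRing B] [NormedAlgebra ℂ B]

theorem isUnit_iff_of_spectrum_eq {T : A →+ B} (hspec : ∀ x, spectrum ℂ (T x) = spectrum ℂ x)
    (x : A) : IsUnit (T x) ↔ IsUnit x := by
  rw [← not_iff_not, ← spectrum.zero_mem_iff ℂ, ← spectrum.zero_mem_iff ℂ, hspec]

theorem injective_of_spectrum_eq {T : A →+ B} (hspec : ∀ x, spectrum ℂ (T x) = spectrum ℂ x) :
    Function.Injective T := by
  refine (injective_iff_map_eq_zero T).2 fun a ha => eq_zero_of_spectrum_add_subset fun y => ?_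
  rw [← hspec, map_add, ha, zero_add, hspec]

theorem mem_spectrum_algebraMap_add_iff {R : Type*} [Ring R] [Algebra ℂ R] {x : R} {c ν : ℂ} :
    ν ∈ spectrum ℂ (algebraMap ℂ R c + x) ↔ ν - c ∈ spectrum ℂ x := by
  rw [spectrum.mem_iff, spectrum.mem_iff, map_sub, sub_sub]

theorem map_algebraMap_of_spectrum_eq {T : A →+ B} (hsurj : Function.Surjective T)
    (hspec : ∀ x, spectrum ℂ (T x) = spectrum ℂ x) (c : ℂ) :
    T (algebraMap ℂ A c) = algebraMap ℂ B c := by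
  obtain ⟨a, ha⟩ := hsurj (algebraMap ℂ B c)
  suffices a - algebraMap ℂ A c = 0 by rw [← sub_eq_zero.1 this, ha]
  refine eq_zero_of_spectrum_add_subset fun y ν hν => ?_
  rw [show a - algebraMap ℂ A c + y = a + (y - algebraMap ℂ A c) by abel, ← hspec, map_add, ha,
    mem_spectrum_algebraMap_add_iff, hspec, ← mem_spectrum_algebraMap_add_iff,
    add_sub_cancel] at hν
  exact hν

theorem eq_zero_of_forall_isUnit_one_add_mul {T : A →+ B} (hsurj : Function.Surjective T)
    (hspec : ∀ x, spectrum ℂ (T x) = spectrum ℂ x) {d : B} (h : ∀ x, IsUnit (1 + d * x)) :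
    d = 0 := by
  obtain ⟨a, rfl⟩ := hsurj d
  rw [show a = 0 from eq_zero_of_spectrum_add_subset fun y ν hν => ?_, map_zero]
  by_contra hν'
  obtain ⟨u, hu⟩ := (isUnit_iff_of_spectrum_eq hspec _).2 (spectrum.notMem_iff.1 hν')
  refine spectrum.mem_iff.1 hν ((isUnit_iff_of_spectrum_eq hspec _).1 ?_)
  have : T (algebraMap ℂ A ν - (a + y)) = (1 + T a * -(↑u⁻¹ : B)) * u := by
    rw [add_mul, mul_neg, neg_mul, mul_assoc, u.inv_mul, one_mul, mul_one, hu, ← map_neg, ← map_add]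
    congr 1
    abel
  rw [this]
  exact (h _).mul u.isUnit

theorem isUnit_corner_iff {p a : A} (hp : p * p = p) :
    IsUnit (p * a * p + (1 - p)) ↔ IsUnit (1 + p * (a - 1)) := by
  rw [show p * a * p + (1 - p) = 1 + p * (a - 1) * p by
    rw [mul_sub, sub_mul, mul_one, hp]; abel, isUnit_one_add_mul_comm, ← mul_assoc, hp]

variable [CompleteSpace B]

theorem not_isUnit_corner_of_tendsto {T : A →+ B} (hsurj : Function.Surjective T)
    (hspec : ∀ x, spectrum ℂ (T x) = spectrum ℂ x) {ι : Type*} {l : Filter ι} [l.NeBot]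
    {u : ι → A} {a : A} (hu : Tendsto u l (𝓝 0)) (hTu : Tendsto (fun n => T (u n)) l (𝓝 (T a)))
    {p : A} (hp : p * p = p) (hp0 : p ≠ 0) : ¬IsUnit (p * a * p + (1 - p)) := by
  rw [isUnit_corner_iff hp]
  intro h
  have hev := (eventually_isUnit_of_isUnit_one_add_mul hp one_ne_zero h).curry
  obtain ⟨N, hN, hN0⟩ := ((tendsto_natCast_atTop_atTop.eventually hev).and
    (eventually_gt_atTop 0)).exists
  obtain ⟨ε, hε, hball⟩ := Metric.eventually_nhds_iff.1 hN
  simp only [mul_one, Complex.ofReal_natCast, dist_zero_right] at hball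
  have hN0' : (0 : ℝ) < N := by exact_mod_cast hN0
  have hNc : (N : ℂ) ≠ 0 := by exact_mod_cast hN0.ne'
  set ρ : ℝ := min (N / 2) (ε / (2 * (‖(1 : A)‖ + 1))) with hρ
  have hρ0 : 0 < ρ := lt_min (by positivity) (by positivity)
  have hρ1 : ρ * ‖(1 : A)‖ < ε / 2 := by
    have h1 : ρ ≤ ε / (2 * (‖(1 : A)‖ + 1)) := min_le_right _ _
    rw [le_div_iff₀ (by positivity)] at h1
    nlinarith
  have hsub : ∀ (x : A) (μ : ℂ), T x - algebraMap ℂ B μ = T (x - algebraMap ℂ A μ) := fun x μ => by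
    rw [map_sub, map_algebraMap_of_spectrum_eq hsurj hspec]
  have hlim : Tendsto (fun n => T ((N : ℂ) • p - a + u n)) l (𝓝 (T ((N : ℂ) • p))) := by
    have := hTu.const_add (T ((N : ℂ) • p - a))
    rw [← map_add, sub_add_cancel] at this
    simpa only [map_add] using this
  have hunit := isUnit_sub_algebraMap_of_tendsto_of_sphere (ν := N) hρ0 hlim ?_ ?_
  · rw [hsub, isUnit_iff_of_spectrum_eq hspec] at hunit
    have h0 : p * ((N : ℂ) • p - algebraMap ℂ A N) = 0 := by
      rw [Algebra.algebraMap_eq_smul_one, mul_sub, mul_smul_comm, mul_smul_comm, hp, mul_one, sub_self]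
    exact hp0 (hunit.mul_left_eq_zero.1 h0)
  · filter_upwards [hu.eventually (Metric.ball_mem_nhds 0 (half_pos hε))] with n hn μ hμ
    rw [hsub, isUnit_iff_of_spectrum_eq hspec]
    have h1 := (hball (y := -u n + (μ - N) • (1 : A)) ?_).neg
    · convert h1 using 1
      rw [Algebra.algebraMap_eq_smul_one]
      module
    · rw [dist_zero_right] at hn
      rw [Metric.mem_closedBall, dist_eq_norm] at hμ
      refine (norm_add_le _ _).trans_lt ?_
      rw [norm_neg, norm_smul]
      have := mul_le_mul_of_nonneg_right hμ (norm_nonneg (1 : A))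
      linarith
  · intro μ hμ
    rw [hsub, isUnit_iff_of_spectrum_eq hspec]
    have hμd : ‖μ - N‖ = ρ := by simpa [dist_eq_norm] using hμ
    have hμ0 : μ ≠ 0 := by
      rintro rfl
      rw [zero_sub, norm_neg, Complex.norm_natCast] at hμd
      have : ρ ≤ N / 2 := min_le_left _ _
      linarith
    have hμN : (N : ℂ) - μ ≠ 0 := by
      intro h0
      rw [norm_sub_rev, h0, norm_zero] at hμd
      exact hρ0.ne hμd
    convert isUnit_smul_one_sub_add_smul hp (neg_ne_zero.2 hμ0) hμN using 1
    rw [Algebra.algebraMap_eq_smul_one]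
    module

theorem eq_zero_of_tendsto (hA : HasPositiveProjections A) {T : A →+ B}
    (hsurj : Function.Surjective T) (hspec : ∀ x, spectrum ℂ (T x) = spectrum ℂ x)
    {ι : Type*} {l : Filter ι} [l.NeBot] {u : ι → A} {b : B} (hu : Tendsto u l (𝓝 0))
    (hTu : Tendsto (fun n => T (u n)) l (𝓝 b)) : b = 0 := by
  let _ := CStarAlgebra.spectralOrder A
  have := CStarAlgebra.spectralOrderedRing A
  obtain ⟨a, rfl⟩ := hsurj b
  rw [eq_zero_of_not_isUnit_compression hA fun p hp hp0 =>
    not_isUnit_corner_of_tendsto hsurj hspec hu hTu hp.isIdempotentElem hp0, map_zero]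

theorem map_real_smul_of_spectrum_eq (hA : HasPositiveProjections A) {T : A →+ B}
    (hsurj : Function.Surjective T) (hspec : ∀ x, spectrum ℂ (T x) = spectrum ℂ x)
    (t : ℝ) (x : A) : T (t • x) = t • T x := by
  have : (comap ((↑) : ℚ → ℝ) (𝓝 t)).NeBot :=
    Rat.isDenseEmbedding_coe_real.isDenseInducing.comap_nhds_neBot t
  have hq : Tendsto ((↑) : ℚ → ℝ) (comap (↑) (𝓝 t)) (𝓝 t) := tendsto_comap
  have hu : Tendsto (fun q : ℚ => ((q : ℝ) - t) • x) (comap (↑) (𝓝 t)) (𝓝 0) := by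
    simpa using (hq.sub_const t).smul_const x
  have hTu : Tendsto (fun q : ℚ => T (((q : ℝ) - t) • x)) (comap (↑) (𝓝 t))
      (𝓝 (t • T x - T (t • x))) := by
    simp only [sub_smul, map_sub, map_ratCast_smul T ℝ ℝ]
    exact (hq.smul_const (T x)).sub_const _
  exact (sub_eq_zero.1 (eq_zero_of_tendsto hA hsurj hspec hu hTu)).symm

theorem exists_continuousLinearEquiv_of_spectrum_eq (hA : HasPositiveProjections A) {T : A →+ B}
    (hsurj : Function.Surjective T) (hspec : ∀ x, spectrum ℂ (T x) = spectrum ℂ x) :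
    ∃ e : A ≃L[ℝ] B, ∀ x, e x = T x := by
  let L : A →ₗ[ℝ] B :=
    { T with map_smul' := map_real_smul_of_spectrum_eq hA hsurj hspec }
  have hL : Continuous L := L.continuous_of_seq_closed_graph fun u x y hux huy => by
    have h1 : Tendsto (fun n => u n - x) atTop (𝓝 0) := by simpa using hux.sub_const x
    have h2 : Tendsto (fun n => T (u n - x)) atTop (𝓝 (y - T x)) := by
      simp only [map_sub]
      exact Tendsto.sub_const (f := fun n => T (u n)) huy _
    exact sub_eq_zero.1 (eq_zero_of_tendsto hA hsurj hspec h1 h2)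
  exact ⟨ContinuousLinearEquiv.ofBijective ⟨L, hL⟩
    (LinearMap.ker_eq_bot.2 (injective_of_spectrum_eq hspec)) (LinearMap.range_eq_top.2 hsurj),
    fun x => rfl⟩

end SpectrumPreserving

section Linear

theorem IsIdempotentElem.eq_of_isUnit_iff {R : Type*} [Ring R]
    (hrad : ∀ d : R, (∀ x, IsUnit (1 + d * x)) → d = 0) {E F : R} (hE : E * E = E) (hF : F * F = F)
    (h : ∀ b, IsUnit (1 + E * (b - 1)) ↔ IsUnit (1 + F * (b - 1))) : E = F := by
  have h1 : F * (1 - E) = 0 := hrad _ fun x => by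
    have := (h (1 + (1 - E) * x)).1 (by
      rw [add_sub_cancel_left, ← mul_assoc, mul_sub, mul_one, hE, sub_self, zero_mul, add_zero]
      exact isUnit_one)
    rwa [add_sub_cancel_left, ← mul_assoc] at this
  have h2 : (1 - F) * E = 0 := hrad _ fun x => by
    have := (h (1 + x * (1 - F))).2 (by
      rw [isUnit_one_add_mul_comm, add_sub_cancel_left, mul_assoc, sub_mul, one_mul, hF, sub_self,
        mul_zero, add_zero]
      exact isUnit_one)
    rw [isUnit_one_add_mul_comm, add_sub_cancel_left, mul_assoc] at this
    exact isUnit_one_add_mul_comm.1 this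
  rw [mul_sub, mul_one, sub_eq_zero] at h1
  rw [sub_mul, one_mul, sub_eq_zero] at h2
  rw [h1, ← h2]

variable {A : Type*} [CStarAlgebra A] {B : Type*} [NormedRing B] [NormedAlgebra ℂ B]
  {e : A ≃L[ℝ] B}

theorem ContinuousLinearEquiv.isUnit_iff_of_spectrum_eq
    (hspec : ∀ x, spectrum ℂ (e x) = spectrum ℂ x) (x : A) : IsUnit (e x) ↔ IsUnit x :=
  _root_.isUnit_iff_of_spectrum_eq (T := (e : A →ₗ[ℝ] B).toAddMonoidHom) hspec x

theorem ContinuousLinearEquiv.map_complex_smul_one_of_spectrum_eq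
    (hspec : ∀ x, spectrum ℂ (e x) = spectrum ℂ x) (c : ℂ) : e (c • 1) = c • 1 := by
  rw [← Algebra.algebraMap_eq_smul_one, ← Algebra.algebraMap_eq_smul_one]
  exact map_algebraMap_of_spectrum_eq (T := (e : A →ₗ[ℝ] B).toAddMonoidHom) e.surjective hspec c

theorem ContinuousLinearEquiv.eq_zero_of_forall_isUnit_one_add_mul
    (hspec : ∀ x, spectrum ℂ (e x) = spectrum ℂ x) {d : B} (h : ∀ x, IsUnit (1 + d * x)) :
    d = 0 :=
  _root_.eq_zero_of_forall_isUnit_one_add_mul (T := (e : A →ₗ[ℝ] B).toAddMonoidHom)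
    e.surjective hspec h

variable [CompleteSpace B]

/-- Real-linear spectrum preserving maps send complex multiples of idempotents to multiples of
idempotents. -/
theorem inv_smul_map_smul_mul_self (hspec : ∀ x, spectrum ℂ (e x) = spectrum ℂ x) {p : A}
    (hp : p * p = p) {ω : ℂ} (hω : ω ≠ 0) :
    (ω⁻¹ • e (ω • p)) * (ω⁻¹ • e (ω • p)) = ω⁻¹ • e (ω • p) := by
  set q := ω⁻¹ • e (ω • p) with hq
  set J := (e.symm : B →L[ℝ] A) with hJ
  set K := max 1 ((‖1 - p‖ + ‖p‖) * ‖J‖) with hK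
  refine sub_eq_zero.1 (e.eq_zero_of_forall_isUnit_one_add_mul hspec
    (isUnit_one_add_mul_of_perturbation (K := K) (le_max_left _ _) fun l b hl0 hl1 hb => ?_))
  set d : A := ω⁻¹ • e.symm (ω • b) with hd
  have hdn : ‖d‖ ≤ ‖J‖ * ‖b‖ := by
    have h1 : ‖e.symm (ω • b)‖ ≤ ‖J‖ * ‖ω • b‖ := J.le_opNorm _
    rw [hd, norm_smul, norm_inv, inv_mul_le_iff₀ (norm_pos_iff.2 hω)]
    rw [norm_smul] at h1
    linarith
  have hl1' : 1 - l ≠ 0 := sub_ne_zero.2 hl1.symm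
  have h1l : ‖1 - l‖ = ‖l - 1‖ := norm_sub_rev _ _
  set m := min ‖l‖ ‖l - 1‖ with hm
  have hm0 : 0 < m := lt_min (norm_pos_iff.2 hl0) (norm_pos_iff.2 (sub_ne_zero.2 hl1))
  set r : A := (-l)⁻¹ • (1 - p) + (1 - l)⁻¹ • p with hr
  have hrn : ‖r‖ ≤ (‖1 - p‖ + ‖p‖) / m := by
    refine (norm_add_le _ _).trans ?_
    rw [norm_smul, norm_smul, norm_inv, norm_inv, norm_neg, h1l, add_div, div_eq_inv_mul,
      div_eq_inv_mul]
    gcongr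
    · exact min_le_left _ _
    · exact min_le_right _ _
  have hrd : ‖-(r * d)‖ < 1 := by
    rw [norm_neg]
    calc ‖r * d‖ ≤ ‖r‖ * ‖d‖ := norm_mul_le _ _
      _ ≤ (‖1 - p‖ + ‖p‖) / m * (‖J‖ * ‖b‖) := by gcongr
      _ = (‖1 - p‖ + ‖p‖) * ‖J‖ * ‖b‖ / m := by ring
      _ ≤ K * ‖b‖ / m := by
        gcongr
        exact le_max_right _ _
      _ < 1 := (div_lt_one hm0).2 hb
  have hfac : p - l • (1 : A) + d = ((-l) • (1 - p) + (1 - l) • p) * (1 - -(r * d)) := by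
    have hinv : ((-l) • (1 - p) + (1 - l) • p) * r = 1 := by
      rw [hr, smul_one_sub_add_smul_mul hp, mul_inv_cancel₀ (neg_ne_zero.2 hl0),
        mul_inv_cancel₀ hl1', one_smul, one_smul, sub_add_cancel]
    rw [sub_neg_eq_add, mul_add, ← mul_assoc, hinv]
    simp only [mul_one, one_mul]
    module
  have hunit : IsUnit (ω • (p - l • (1 : A) + d)) := by
    rw [Algebra.smul_def, hfac]
    exact ((isUnit_iff_ne_zero.2 hω).map _).mul
      ((isUnit_smul_one_sub_add_smul hp (neg_ne_zero.2 hl0) hl1').mul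
        (isUnit_one_sub_of_norm_lt_one hrd))
  rw [← e.isUnit_iff_of_spectrum_eq hspec] at hunit
  have heq : q - l • (1 : B) + b = algebraMap ℂ B ω⁻¹ * e (ω • (p - l • (1 : A) + d)) := by
    rw [smul_add, smul_sub, smul_smul, hd, smul_inv_smul₀ hω, map_add, map_sub,
      e.map_complex_smul_one_of_spectrum_eq hspec, e.apply_symm_apply, ← Algebra.smul_def, hq,
      smul_add, smul_sub, smul_smul, inv_mul_cancel_left₀ hω, inv_smul_smul₀ hω]
  rw [heq]
  exact ((isUnit_iff_ne_zero.2 (inv_ne_zero hω)).map _).mul hunit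

theorem isUnit_one_add_mul_map_iff (hspec : ∀ x, spectrum ℂ (e x) = spectrum ℂ x) {p : A}
    (hp : p * p = p) {ω : ℂ} (hω : ω ≠ 0) (y : A) :
    IsUnit (1 + ω⁻¹ • e (ω • p) * (e y - 1)) ↔ IsUnit (1 + p * (y - 1)) := by
  have hF := inv_smul_map_smul_mul_self hspec hp hω
  have hkey : ∀ (t : ℝ) (x : A), IsUnit ((t * ω : ℂ) • (1 - ω⁻¹ • e (ω • p)) + e y + e x) ↔
      IsUnit ((t * ω : ℂ) • (1 - p) + y + x) := by
    intro t x
    have h1 : e ((t * ω : ℂ) • p) = t • e (ω • p) := by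
      rw [mul_smul, Complex.coe_smul, map_smul]
    have h2 : (t * ω : ℂ) • ω⁻¹ • e (ω • p) = t • e (ω • p) := by
      rw [mul_smul, smul_inv_smul₀ hω, Complex.coe_smul]
    rw [← e.isUnit_iff_of_spectrum_eq hspec, map_add, map_add, smul_sub (_ : ℂ) (1 : A), map_sub,
      e.map_complex_smul_one_of_spectrum_eq hspec, h1, smul_sub, h2]
  constructor
  · intro h
    refine isUnit_one_add_mul_of_eventually hp hω ?_
    have hlim : Tendsto (fun z : ℝ × A => (z.1, e z.2)) (atTop ×ˢ 𝓝 0) (atTop ×ˢ 𝓝 0) :=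
      tendsto_fst.prodMk ((e.continuous.tendsto' 0 0 (map_zero e)).comp tendsto_snd)
    filter_upwards [hlim.eventually (eventually_isUnit_of_isUnit_one_add_mul hF hω h)] with z hz
    exact (hkey _ _).1 hz
  · intro h
    refine isUnit_one_add_mul_of_eventually hF hω ?_
    have hlim : Tendsto (fun z : ℝ × B => (z.1, e.symm z.2)) (atTop ×ˢ 𝓝 0) (atTop ×ˢ 𝓝 0) :=
      tendsto_fst.prodMk ((e.symm.continuous.tendsto' 0 0 (map_zero e.symm)).comp tendsto_snd)
    filter_upwards [hlim.eventually (eventually_isUnit_of_isUnit_one_add_mul hp hω h)] with z hz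
    have := (hkey _ _).2 hz
    rwa [e.apply_symm_apply] at this

theorem map_idempotent_mul_self (hspec : ∀ x, spectrum ℂ (e x) = spectrum ℂ x) {p : A}
    (hp : p * p = p) : e p * e p = e p := by
  simpa using inv_smul_map_smul_mul_self hspec hp one_ne_zero

theorem map_I_smul_idempotent (hspec : ∀ x, spectrum ℂ (e x) = spectrum ℂ x) {p : A}
    (hp : p * p = p) : e (Complex.I • p) = Complex.I • e p := by
  rw [← inv_smul_eq_iff₀ Complex.I_ne_zero]
  refine IsIdempotentElem.eq_of_isUnit_iff
    (fun d => e.eq_zero_of_forall_isUnit_one_add_mul hspec)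
    (inv_smul_map_smul_mul_self hspec hp Complex.I_ne_zero) (map_idempotent_mul_self hspec hp)
    fun b => ?_
  obtain ⟨y, rfl⟩ := e.surjective b
  rw [isUnit_one_add_mul_map_iff hspec hp Complex.I_ne_zero,
    ← isUnit_one_add_mul_map_iff hspec hp one_ne_zero]
  simp

theorem map_I_smul_of_spectrum_eq (hA : HasPositiveProjections A)
    (hspec : ∀ x, spectrum ℂ (e x) = spectrum ℂ x) (x : A) :
    e (Complex.I • x) = Complex.I • e x := by
  let _ := CStarAlgebra.spectralOrder A
  have := CStarAlgebra.spectralOrderedRing A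
  have hsa : ∀ h : A, IsSelfAdjoint h → e (Complex.I • h) = Complex.I • e h := by
    intro h hh
    refine closure_minimal (s := (Submodule.span ℝ (commutingProjections h) : Set A))
      (t := {x | e (Complex.I • x) = Complex.I • e x}) (fun x hx => ?_)
      (isClosed_eq (by fun_prop) (by fun_prop)) (mem_closure_span_commutingProjections hA hh)
    induction hx using Submodule.span_induction with
    | mem x hx => exact map_I_smul_idempotent hspec hx.1.isIdempotentElem
    | zero => simp
    | add x y _ _ hx hy =>
      simp only [Set.mem_ofPred_eq] at hx hy ⊢
      rw [smul_add, map_add, map_add, smul_add, hx, hy]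
    | smul t x _ hx =>
      simp only [Set.mem_ofPred_eq] at hx ⊢
      rw [smul_comm, map_smul, hx, map_smul, smul_comm]
  have hdec := realPart_add_I_smul_imaginaryPart x
  rw [← hdec, smul_add, smul_smul, Complex.I_mul_I, neg_smul, one_smul, map_add, map_neg, map_add,
    hsa _ (realPart x).2, hsa _ (imaginaryPart x).2, smul_add, smul_smul, Complex.I_mul_I, neg_smul,
    one_smul]

theorem Complex.smul_eq_re_smul_add_im_smul {E : Type*} [AddCommGroup E] [Module ℂ E] (c : ℂ)
    (y : E) : c • y = (c.re : ℂ) • y + (c.im : ℂ) • Complex.I • y := by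
  conv_lhs => rw [← Complex.re_add_im c]
  rw [add_smul, mul_smul]

theorem map_complex_smul_of_spectrum_eq (hA : HasPositiveProjections A)
    (hspec : ∀ x, spectrum ℂ (e x) = spectrum ℂ x) (c : ℂ) (x : A) : e (c • x) = c • e x := by
  rw [c.smul_eq_re_smul_add_im_smul x, c.smul_eq_re_smul_add_im_smul (e x), map_add,
    Complex.coe_smul, Complex.coe_smul, map_smul, map_smul, map_I_smul_of_spectrum_eq hA hspec,
    Complex.coe_smul, Complex.coe_smul]

theorem map_mul_add_map_mul_eq_zero (hspec : ∀ x, spectrum ℂ (e x) = spectrum ℂ x) {p q : A}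
    (hp : p * p = p) (hq : q * q = q) (hpq : p * q = 0) (hqp : q * p = 0) :
    e p * e q + e q * e p = 0 := by
  have h := map_idempotent_mul_self hspec (p := p + q) (by
    rw [add_mul, mul_add, mul_add, hp, hq, hpq, hqp, add_zero, zero_add])
  rw [map_add, add_mul, mul_add, mul_add, map_idempotent_mul_self hspec hp,
    map_idempotent_mul_self hspec hq] at h
  have : e p * e q + e q * e p = (e p + e p * e q + (e q * e p + e q)) - (e p + e q) := by abel
  rw [this, h, sub_self]

theorem map_mul_add_mul_of_commute (hspec : ∀ x, spectrum ℂ (e x) = spectrum ℂ x) {p q : A}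
    (hp : p * p = p) (hq : q * q = q) (hpq : Commute p q) :
    e (p * q + q * p) = e p * e q + e q * e p := by
  have hqp : q * p = p * q := hpq.eq.symm
  have hqp' : ∀ x, q * (p * x) = p * (q * x) := fun x => by rw [← mul_assoc, hqp, mul_assoc]
  have hp' : ∀ x, p * (p * x) = p * x := fun x => by rw [← mul_assoc, hp]
  have hq' : ∀ x, q * (q * x) = q * x := fun x => by rw [← mul_assoc, hq]
  obtain ⟨r, hr⟩ : ∃ r, r = p * q := ⟨_, rfl⟩
  obtain ⟨s, hs⟩ : ∃ s, s = p - p * q := ⟨_, rfl⟩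
  obtain ⟨t, ht⟩ : ∃ t, t = q - p * q := ⟨_, rfl⟩
  have hrr : r * r = r := by simp only [hr, mul_assoc, hqp', hp', hq]
  have hss : s * s = s := by
    simp only [hs, mul_sub, sub_mul, mul_assoc, hqp', hp', hp, hq, hqp]; abel
  have htt : t * t = t := by
    simp only [ht, mul_sub, sub_mul, mul_assoc, hqp', hp', hq]; abel
  have hrs := map_mul_add_map_mul_eq_zero hspec hrr hss
    (by simp only [hr, hs, mul_sub, mul_assoc, hqp', hp', hq, hqp]; abel)
    (by simp only [hr, hs, sub_mul, mul_assoc, hqp', hp', hq]; abel)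
  have hrt := map_mul_add_map_mul_eq_zero hspec hrr htt
    (by simp only [hr, ht, mul_sub, mul_assoc, hqp', hp', hq]; abel)
    (by simp only [hr, ht, sub_mul, mul_assoc, hqp', hp', hq]; abel)
  have hst := map_mul_add_map_mul_eq_zero hspec hss htt
    (by simp only [hs, ht, mul_sub, sub_mul, mul_assoc, hqp', hp', hq]; abel)
    (by simp only [hs, ht, mul_sub, sub_mul, mul_assoc, hqp', hp', hq, hqp]; abel)
  have hrr' := map_idempotent_mul_self hspec hrr
  have hpe : e p = e r + e s := by rw [← map_add, hr, hs, add_sub_cancel]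
  have hqe : e q = e r + e t := by rw [← map_add, hr, ht, add_sub_cancel]
  rw [hqp, map_add, ← hr, hpe, hqe]
  calc e r + e r = e r * e r + e r * e r + (e r * e s + e s * e r) + (e r * e t + e t * e r)
        + (e s * e t + e t * e s) := by rw [hrs, hrt, hst, hrr']; abel
    _ = _ := by simp only [mul_add, add_mul]; abel

theorem map_mul_self_of_isSelfAdjoint (hA : HasPositiveProjections A)
    (hspec : ∀ x, spectrum ℂ (e x) = spectrum ℂ x) {h : A} (hh : IsSelfAdjoint h) :
    e (h * h) = e h * e h := by
  let _ := CStarAlgebra.spectralOrder A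
  have := CStarAlgebra.spectralOrderedRing A
  refine closure_minimal (s := (Submodule.span ℝ (commutingProjections h) : Set A))
    (t := {x | e (x * x) = e x * e x}) (fun x hx => ?_)
    (isClosed_eq (by fun_prop) (by fun_prop)) (mem_closure_span_commutingProjections hA hh)
  have key : ∀ x ∈ Submodule.span ℝ (commutingProjections h),
      ∀ y ∈ Submodule.span ℝ (commutingProjections h),
        e (x * y + y * x) = e x * e y + e y * e x := by
    intro x hx y hy
    induction hx, hy using Submodule.span_induction₂ with
    | mem_mem p q hp hq =>
      exact map_mul_add_mul_of_commute hspec hp.1.isIdempotentElem hq.1.isIdempotentElem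
        (hq.2 p (hp.2 h (Commute.refl h)).symm)
    | zero_left y hy => simp
    | zero_right x hx => simp
    | add_left x y z _ _ _ h1 h2 =>
      rw [add_mul, mul_add, add_add_add_comm, map_add, h1, h2, map_add, add_mul, mul_add,
        add_add_add_comm]
    | add_right x y z _ _ _ h1 h2 =>
      rw [add_mul, mul_add, add_add_add_comm, map_add, h1, h2, map_add, add_mul, mul_add,
        add_add_add_comm]
    | smul_left c x y _ _ h1 =>
      rw [smul_mul_assoc, mul_smul_comm, ← smul_add, map_smul, h1, map_smul, smul_mul_assoc,
        mul_smul_comm, smul_add]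
    | smul_right c x y _ _ h1 =>
      rw [smul_mul_assoc, mul_smul_comm, ← smul_add, map_smul, h1, map_smul, smul_mul_assoc,
        mul_smul_comm, smul_add]
  have h2 := key x hx x hx
  rw [← two_smul ℝ (x * x), ← two_smul ℝ (e x * e x), map_smul] at h2
  exact (smul_right_injective B (two_ne_zero (α := ℝ))) h2

theorem add_I_smul_mul_self {R : Type*} [Ring R] [Algebra ℂ R] (a b : R) :
    (a + Complex.I • b) * (a + Complex.I • b) = a * a - b * b + Complex.I • (a * b + b * a) := by
  simp only [mul_add, add_mul, smul_mul_assoc, mul_smul_comm, smul_smul, Complex.I_mul_I,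
    smul_add, neg_smul, one_smul]
  abel

theorem map_mul_self_of_spectrum_eq (hA : HasPositiveProjections A)
    (hspec : ∀ x, spectrum ℂ (e x) = spectrum ℂ x) (x : A) : e (x * x) = e x * e x := by
  have hsq := fun {h : A} (hh : IsSelfAdjoint h) => map_mul_self_of_isSelfAdjoint hA hspec hh
  obtain ⟨h, k, hh, hk, rfl⟩ : ∃ h k : A, IsSelfAdjoint h ∧ IsSelfAdjoint k ∧
      x = h + Complex.I • k :=
    ⟨realPart x, imaginaryPart x, (realPart x).2, (imaginaryPart x).2,
      (realPart_add_I_smul_imaginaryPart x).symm⟩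
  have hI := map_I_smul_of_spectrum_eq hA hspec
  have hpol : e (h * k + k * h) = e h * e k + e k * e h := by
    have h1 := hsq (hh.add hk)
    have h2 : (h + k) * (h + k) = h * h + k * k + (h * k + k * h) := by noncomm_ring
    rw [h2, map_add, map_add, hsq hh, hsq hk, map_add e h k] at h1
    have h3 : (e h + e k) * (e h + e k)
        = e h * e h + e k * e k + (e h * e k + e k * e h) := by noncomm_ring
    rw [h3] at h1
    exact add_left_cancel h1
  rw [add_I_smul_mul_self, map_add, map_sub, hI, hpol, hsq hh, hsq hk, map_add, hI,
    add_I_smul_mul_self]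

end Linear

end

section VonNeumann

variable {H : Type*} [NormedAddCommGroup H] [InnerProductSpace ℂ H] [CompleteSpace H]

theorem ContinuousLinearMap.mul_starProjection_ker (a : H →L[ℂ] H) :
    a * a.ker.starProjection = 0 := by
  ext x
  exact a.ker.starProjection_apply_mem x

theorem ContinuousLinearMap.starProjection_ker_mul {a b : H →L[ℂ] H} (h : a * b = 0) :
    a.ker.starProjection * b = b := by
  ext x
  exact Submodule.starProjection_eq_self_iff.2 (DFunLike.congr_fun h x)

theorem ContinuousLinearMap.commute_starProjection_ker {a y : H →L[ℂ] H} (h : Commute y a)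
    (h' : Commute (star y) a) : Commute y a.ker.starProjection := by
  set P := a.ker.starProjection with hP
  have key : ∀ z : H →L[ℂ] H, Commute z a → P * (z * P) = z * P := fun z hz =>
    starProjection_ker_mul (by rw [← mul_assoc, ← hz.eq, mul_assoc, mul_starProjection_ker, mul_zero])
  have hPs : star P = P := (isStarProjection_starProjection (U := a.ker)).isSelfAdjoint
  have h1 := congrArg star (key _ h')
  rw [star_mul, star_mul, star_star, hPs, mul_assoc, key y h] at h1
  exact h1

theorem VonNeumannAlgebra.isClosed (M : VonNeumannAlgebra H) :
    IsClosed (M.toStarSubalgebra : Set (H →L[ℂ] H)) := by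
  have h := M.centralizer_centralizer ▸ Set.isClosed_centralizer _
  exact h

theorem VonNeumannAlgebra.starProjection_ker_mem (M : VonNeumannAlgebra H) {a : H →L[ℂ] H}
    (ha : a ∈ M) : a.ker.starProjection ∈ M := by
  rw [← M.commutant_commutant, mem_commutant_iff]
  intro y hy
  exact ContinuousLinearMap.commute_starProjection_ker (mem_commutant_iff.1 hy a ha).symm
    (mem_commutant_iff.1 (star_mem hy) a ha).symm

theorem VonNeumannAlgebra.hasPositiveProjections (M : VonNeumannAlgebra H)
    [IsClosed (M.toStarSubalgebra : Set (H →L[ℂ] H))] :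
    HasPositiveProjections M.toStarSubalgebra := by
  intro g hg
  have hgc : ∀ y, Commute y g → Commute y g⁺ := fun y hy => by
    rw [CFC.posPart_def]
    exact (hy.symm.cfcₙ_real _).symm
  set a : H →L[ℂ] H := (g⁺).val with ha
  set P : M.toStarSubalgebra := ⟨a.ker.starProjection, M.starProjection_ker_mem g⁺.2⟩ with hP
  have hPp : IsStarProjection P :=
    ⟨Subtype.ext isStarProjection_starProjection.isIdempotentElem,
      Subtype.ext isStarProjection_starProjection.isSelfAdjoint⟩
  let _ := CStarAlgebra.spectralOrder M.toStarSubalgebra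
  have := CStarAlgebra.spectralOrderedRing M.toStarSubalgebra
  have hgs : star g⁻ = g⁻ := (CFC.negPart_nonneg g).isSelfAdjoint
  refine ⟨1 - P, hPp.one_sub, fun y hy => ?_, ?_, ?_⟩
  · refine (Commute.one_right y).sub_right (Subtype.ext ?_)
    refine ContinuousLinearMap.commute_starProjection_ker (congrArg Subtype.val (hgc y hy).eq) ?_
    refine congrArg Subtype.val (hgc (star y) ?_).eq
    have := hy.star_star
    rwa [hg.star_eq] at this
  · rw [mul_sub, mul_one, sub_eq_self]
    exact Subtype.ext a.mul_starProjection_ker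
  · have h1 : P * g⁻ = g⁻ := Subtype.ext (ContinuousLinearMap.starProjection_ker_mul
      (congrArg Subtype.val (CFC.posPart_mul_negPart g)))
    have h2 := congrArg star h1
    rw [star_mul, hgs, hPp.isSelfAdjoint.star_eq] at h2
    rw [mul_sub, mul_one, h2, sub_self]

end VonNeumann

/-- **Jafarian's conjecture** (Mathieu–Schulz): every surjective additive spectrum
preserving mapping from a von Neumann algebra onto a complex unital Banach algebra
is a Jordan isomorphism. -/
theorem additive_spectrum_preserving_from_vonNeumann_is_jordan_iso
    {H : Type*} [NormedAddCommGroup H] [InnerProductSpace ℂ H] [CompleteSpace H]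
    (M : VonNeumannAlgebra H)
    {B : Type*} [NormedRing B] [NormedAlgebra ℂ B] [CompleteSpace B]
    (T : M.toStarSubalgebra → B)
    (hsurj : Function.Surjective T)
    (hadd : ∀ x y : M.toStarSubalgebra, T (x + y) = T x + T y)
    (hspec : ∀ x : M.toStarSubalgebra, spectrum ℂ (T x) = spectrum ℂ x) :
    Function.Bijective T ∧
      (∀ (c : ℂ) (x : M.toStarSubalgebra), T (c • x) = c • T x) ∧
      T 1 = 1 ∧
      ∀ x : M.toStarSubalgebra, T (x * x) = T x * T x := by
  have := M.isClosed
  have hM := M.hasPositiveProjections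
  obtain ⟨e, he⟩ := exists_continuousLinearEquiv_of_spectrum_eq hM
    (T := AddMonoidHom.mk' T hadd) hsurj hspec
  obtain rfl : T = e := funext fun x => (he x).symm
  refine ⟨e.bijective, map_complex_smul_of_spectrum_eq hM hspec, ?_,
    map_mul_self_of_spectrum_eq hM hspec⟩
  simpa using e.map_complex_smul_one_of_spectrum_eq hspec 1
end

section
/- Let A be a unital C*-algebra of real rank zero, let B be a complex unital Banach algebra, and let T : A → B be a surjective additive map with σ(Tx) = σ(x) for every x ∈ A. Then T is a Jordan isomorphism; that is, T is bijective, complex-linear, unital, and satisfies T(x²) = (Tx)² for all x ∈ A. -/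
/-- An element of a complex Banach algebra is quasinilpotent if its spectrum is contained
in `{0}`. -/
def QuasiNilpotent {B : Type*} [NormedRing B] [NormedAlgebra ℂ B] (b : B) : Prop :=
  spectrum ℂ b ⊆ {0}

namespace QuasiNilpotent

open Filter Topology

variable {B : Type*} [NormedRing B] [NormedAlgebra ℂ B]

theorem isUnit_algebraMap_sub {b : B} (hb : QuasiNilpotent b) {z : ℂ} (hz : z ≠ 0) :
    IsUnit (algebraMap ℂ B z - b) := by
  by_contra h
  exact hz (hb h)

theorem isUnit_one_sub {b : B} (hb : QuasiNilpotent b) : IsUnit (1 - b) := by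
  simpa using hb.isUnit_algebraMap_sub one_ne_zero

theorem isUnit_one_add {b : B} (hb : QuasiNilpotent b) : IsUnit (1 + b) := by
  have := (hb.isUnit_algebraMap_sub (z := -1) (by simp)).neg
  simpa [add_comm] using this

variable [CompleteSpace B]

theorem eventually_norm_pow_lt {b : B} (hb : QuasiNilpotent b) {ε : ℝ} (hε : 0 < ε) :
    ∀ᶠ n : ℕ in atTop, ‖b ^ n‖ < ε ^ n := by
  have h0 : spectralRadius ℂ b = 0 := by
    simp only [spectralRadius, ENNReal.iSup_eq_zero]
    intro z hz
    have : z = 0 := hb hz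
    simp [this]
  have h := spectrum.pow_norm_pow_one_div_tendsto_nhds_spectralRadius b
  rw [h0] at h
  have h1 := h.eventually (gt_mem_nhds (ENNReal.ofReal_pos.2 hε))
  filter_upwards [h1, eventually_gt_atTop 0] with n hn hn0
  rw [ENNReal.ofReal_lt_ofReal_iff hε] at hn
  have hn' : (n : ℝ) ≠ 0 := by positivity
  calc ‖b ^ n‖ = (‖b ^ n‖ ^ (1 / n : ℝ)) ^ n := by
        rw [← Real.rpow_natCast, ← Real.rpow_mul (norm_nonneg _), one_div,
          inv_mul_cancel₀ hn', Real.rpow_one]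
    _ < ε ^ n := by gcongr

theorem exists_norm_pow_lt {b : B} (hb : QuasiNilpotent b) {ε : ℝ} (hε : 0 < ε) :
    ∃ n : ℕ, 0 < n ∧ ‖b ^ n‖ < ε ^ n := by
  obtain ⟨n, h1, h2⟩ := ((eventually_gt_atTop 0).and (hb.eventually_norm_pow_lt hε)).exists
  exact ⟨n, h1, h2⟩

theorem of_exists_norm_pow_le {b : B}
    (h : ∀ ε : ℝ, 0 < ε → ∃ n : ℕ, 0 < n ∧ ‖b ^ n‖ ≤ ε ^ n) : QuasiNilpotent b := by
  intro z hz
  set c : ℝ := max 1 ‖(1 : B)‖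
  have hc : 1 ≤ c := le_max_left _ _
  have key : ∀ ε : ℝ, 0 < ε → ‖z‖ ≤ ε := by
    intro ε hε
    obtain ⟨n, hn, hbn⟩ := h (ε / c) (by positivity)
    have h1 := spectrum.norm_le_norm_mul_of_mem (spectrum.pow_mem_pow b n hz)
    rw [norm_pow] at h1
    have h2 : ‖z‖ ^ n ≤ ε ^ n := by
      calc ‖z‖ ^ n ≤ ‖b ^ n‖ * ‖(1 : B)‖ := h1
        _ ≤ (ε / c) ^ n * c ^ n := by
          gcongr
          exact (le_max_right _ _).trans (le_self_pow₀ hc hn.ne')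
        _ = ε ^ n := by rw [← mul_pow, div_mul_cancel₀ _ (by positivity)]
    exact le_of_pow_le_pow_left₀ hn.ne' hε.le h2
  have : ‖z‖ ≤ 0 := le_of_forall_pos_le_add fun ε hε => by simpa using key ε hε
  simpa using this

theorem mul_of_commute {v d : B} (hd : QuasiNilpotent d) (h : Commute v d) :
    QuasiNilpotent (v * d) := by
  refine of_exists_norm_pow_le fun ε hε => ?_
  obtain ⟨n, hn, hdn⟩ := hd.exists_norm_pow_lt (ε := ε / (‖v‖ + 1)) (by positivity)
  refine ⟨n, hn, ?_⟩
  rw [h.mul_pow]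
  calc ‖v ^ n * d ^ n‖ ≤ ‖v‖ ^ n * ‖d ^ n‖ :=
        (norm_mul_le _ _).trans (by gcongr; exact norm_pow_le' v hn)
    _ ≤ (‖v‖ + 1) ^ n * (ε / (‖v‖ + 1)) ^ n := by gcongr; linarith
    _ = ε ^ n := by rw [← mul_pow, mul_div_cancel₀ _ (by positivity)]

theorem smul {b : B} (hb : QuasiNilpotent b) (z : ℂ) : QuasiNilpotent (z • b) := by
  rw [Algebra.smul_def]
  exact hb.mul_of_commute (Algebra.commutes z b)

/-- A form of the maximum principle for the spectral radius of an affine function. -/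
theorem of_forall_sphere {n c : B} {R : ℝ} (hR : 0 < R)
    (h : ∀ z : ℂ, ‖z‖ = R → QuasiNilpotent (z • n + c)) : QuasiNilpotent c := by
  refine of_exists_norm_pow_le fun ε hε => ?_
  have hcomp : IsCompact (Metric.sphere (0 : ℂ) R) := isCompact_sphere _ _
  choose! k hk0 hk using fun (z : ℂ) (hz : z ∈ Metric.sphere (0 : ℂ) R) =>
    (h z (by simpa using hz)).exists_norm_pow_lt hε
  have hopen : ∀ z ∈ Metric.sphere (0 : ℂ) R,
      {x : ℂ | ‖(x • n + c) ^ k z‖ < ε ^ k z} ∈ 𝓝 z := by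
    intro z hz
    have : Continuous fun x : ℂ => ‖(x • n + c) ^ k z‖ := by fun_prop
    exact (isOpen_lt this continuous_const).mem_nhds (hk z hz)
  obtain ⟨t, ht, hcover⟩ := hcomp.elim_nhds_subcover _ hopen
  refine ⟨∏ z ∈ t, k z, Finset.prod_pos fun z hz => hk0 z (ht z hz), ?_⟩
  set N := ∏ z ∈ t, k z
  have hb : ∀ x ∈ frontier (Metric.ball (0 : ℂ) R), ‖(x • n + c) ^ N‖ ≤ ε ^ N := by
    intro x hx
    rw [frontier_ball _ hR.ne'] at hx
    obtain ⟨z, hz, hxz⟩ := Set.mem_iUnion₂.1 (hcover hx)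
    obtain ⟨m, hm⟩ := Finset.dvd_prod_of_mem k hz
    have hN : 0 < N := Finset.prod_pos fun z hz => hk0 z (ht z hz)
    have hm' : N = k z * m := hm
    have hm0 : 0 < m := Nat.pos_of_ne_zero fun h0 => by simp [h0] at hm'; omega
    rw [hm', pow_mul, pow_mul]
    exact (norm_pow_le' _ hm0).trans (pow_le_pow_left₀ (norm_nonneg _) (le_of_lt hxz) _)
  have hd : DiffContOnCl ℂ (fun x : ℂ => (x • n + c) ^ N) (Metric.ball (0 : ℂ) R) := by
    apply Differentiable.diffContOnCl
    fun_prop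
  simpa using Complex.norm_le_of_forall_mem_frontier_norm_le Metric.isBounded_ball hd hb
    (subset_closure (Metric.mem_ball_self hR))

end QuasiNilpotent

section Idempotent

open Filter Topology

variable {B : Type*} [NormedRing B] [NormedAlgebra ℂ B] [CompleteSpace B]

theorem catalan_le_four_pow (n : ℕ) : catalan n ≤ 4 ^ n := by
  refine le_trans ?_ (Nat.centralBinom_le_four_pow n)
  rw [← succ_mul_catalan_eq_centralBinom]
  exact Nat.le_mul_of_pos_left _ n.succ_pos

/-- The Catalan generating function evaluated at a quasinilpotent element. -/
theorem QuasiNilpotent.exists_eq_one_add_mul_sq {w : B} (hw : QuasiNilpotent w) :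
    ∃ v : B, v = 1 + w * (v * v) ∧ ∀ b : B, Commute b w → Commute b v := by
  set f : ℕ → B := fun n => (catalan n : ℂ) • w ^ n with hf
  have hs : Summable fun n => ‖f n‖ := by
    have hg : Summable fun n : ℕ => (1 / 2 : ℝ) ^ n := summable_geometric_two
    refine summable_of_isBigO_nat hg (Asymptotics.IsBigO.of_bound 1 ?_)
    filter_upwards [hw.eventually_norm_pow_lt (ε := 1 / 8) (by norm_num)] with n hn
    have hc : (catalan n : ℝ) ≤ 4 ^ n := by exact_mod_cast catalan_le_four_pow n
    rw [norm_norm, hf, norm_smul, Complex.norm_natCast, one_mul,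
      Real.norm_of_nonneg (by positivity)]
    calc (catalan n : ℝ) * ‖w ^ n‖ ≤ 4 ^ n * (1 / 8) ^ n := by gcongr
      _ = (1 / 2) ^ n := by rw [← mul_pow]; norm_num
  have hsum : Summable f := hs.of_norm
  refine ⟨∑' n, f n, ?_, fun b hb => Commute.tsum_right _ fun n => (hb.pow_right n).smul_right _⟩
  rw [tsum_mul_tsum_eq_tsum_sum_antidiagonal_of_summable_norm hs hs, hsum.tsum_eq_zero_add,
    ← Summable.tsum_mul_left]
  · congr 1
    · simp [hf]
    · refine tsum_congr fun n => ?_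
      simp only [hf, smul_mul_smul_comm, ← pow_add]
      rw [Finset.sum_congr rfl (g := fun ij : ℕ × ℕ =>
        ((catalan ij.1 * catalan ij.2 : ℕ) : ℂ) • w ^ n) fun ij hij => by
          rw [Finset.HasAntidiagonal.mem_antidiagonal.1 hij, Nat.cast_mul]]
      rw [← Finset.sum_smul, ← Nat.cast_sum, ← catalan_succ', mul_smul_comm, ← pow_succ']
  · exact (summable_norm_sum_mul_antidiagonal_of_summable_norm hs hs).of_norm

/-- An element satisfying `a ^ 2 = a` up to a quasinilpotent is an idempotent up to a commuting
quasinilpotent. -/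
theorem exists_isIdempotentElem_quasiNilpotent_sub {a : B}
    (ha : QuasiNilpotent (a * a - a)) :
    ∃ q : B, IsIdempotentElem q ∧ Commute a q ∧ QuasiNilpotent (a - q) := by
  set d := a * a - a with hd
  have hda : Commute a d :=
    ((Commute.refl a).mul_right (Commute.refl a)).sub_right (Commute.refl a)
  obtain ⟨u, hu⟩ := (ha.smul 4).isUnit_one_add
  have hau : Commute a ↑u⁻¹ := by
    refine Commute.units_inv_right ?_
    rw [hu]
    exact (Commute.one_right a).add_right (hda.smul_right _)
  have hdu : Commute d ↑u⁻¹ := by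
    rw [hd]
    exact (hau.mul_left hau).sub_left hau
  set w : B := ↑u⁻¹ * d with hw
  have haw : Commute a w := hau.mul_right hda
  have hwq : QuasiNilpotent w := ha.mul_of_commute hdu.symm
  have huw : (1 + (4 : ℂ) • d) * w = d := by rw [hw, ← hu, Units.mul_inv_cancel_left]
  obtain ⟨v, hv, hvc⟩ := hwq.exists_eq_one_add_mul_sq
  have hav : Commute a v := hvc a haw
  have hvw : Commute v w := (hvc w (Commute.refl w)).symm
  set x := v * w with hx
  have hax : Commute a x := hav.mul_right haw
  have hxx : x = w + x * x := by
    calc x = (1 + w * (v * v)) * w := by rw [hx, ← hv]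
      _ = w + x * x := by
        rw [hx, add_mul, one_mul]
        congr 1
        rw [← mul_assoc w v v, ← hvw.eq, mul_assoc (v * w) v w]
  have hxq : QuasiNilpotent x := hwq.mul_of_commute hvw
  have h4 : (4 : ℂ) • d = 4 * d := by
    rw [Algebra.smul_def, map_ofNat]
  have hsq : (1 - 2 * a) * (1 - 2 * a) = 1 + 4 * d := by
    rw [hd]; noncomm_ring
  have hcx : Commute (1 - 2 * a) x :=
    (Commute.one_left x).sub_left (((Commute.ofNat_left 2 x)).mul_left hax)
  refine ⟨a + (1 - 2 * a) * x, ?_, ?_, ?_⟩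
  · have h1 : (a + (1 - 2 * a) * x) * (a + (1 - 2 * a) * x) - (a + (1 - 2 * a) * x) = 0 := by
      have e1 : (1 - 2 * a) * x * ((1 - 2 * a) * x) = (1 + 4 * d) * (x * x) := by
        rw [← hsq, mul_assoc, ← mul_assoc x, ← hcx.eq]; noncomm_ring
      have e2 : (1 - 2 * a) * x * a = a * ((1 - 2 * a) * x) := by
        rw [mul_assoc, ← hax.eq]; noncomm_ring
      have e3 : (a + (1 - 2 * a) * x) * (a + (1 - 2 * a) * x) - (a + (1 - 2 * a) * x) =
          d - (1 + 4 * d) * x + (1 + 4 * d) * (x * x) := by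
        rw [add_mul, mul_add, mul_add, e1, e2, hd]; noncomm_ring
      have e4 : (1 + 4 * d) * x = d + (1 + 4 * d) * (x * x) := by
        conv_lhs => rw [hxx]
        rw [mul_add, ← h4, huw]
      rw [e3, e4]; abel
    exact sub_eq_zero.1 h1
  · exact (Commute.refl a).add_right
      (((Commute.one_right a).sub_right
        ((Commute.ofNat_right a 2).mul_right (Commute.refl a))).mul_right hax)
  · have := hxq.mul_of_commute (v := 2 * a - 1)
      (((Commute.ofNat_left 2 x).mul_left hax).sub_left (Commute.one_left x))
    convert this using 1
    noncomm_ring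

end Idempotent

section Corner

open Filter Topology

theorem IsUnit.one_sub_mul_comm {R : Type*} [Ring R] {x y : R} (h : IsUnit (1 - x * y)) :
    IsUnit (1 - y * x) := by
  obtain ⟨u, hu⟩ := h
  have h1 : x * y * ↑u⁻¹ = ↑u⁻¹ - 1 := by
    have := u.mul_inv
    rw [hu, sub_mul, one_mul] at this
    rw [← this]; abel
  have h2 : ↑u⁻¹ * (x * y) = ↑u⁻¹ - 1 := by
    have := u.inv_mul
    rw [hu, mul_sub, mul_one] at this
    rw [← this]; abel
  refine isUnit_iff_exists.2 ⟨1 + y * ↑u⁻¹ * x, ?_, ?_⟩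
  · calc (1 - y * x) * (1 + y * ↑u⁻¹ * x) = 1 - y * x + y * (↑u⁻¹ - x * y * ↑u⁻¹) * x := by
          noncomm_ring
      _ = 1 := by rw [h1]; noncomm_ring
  · calc (1 + y * ↑u⁻¹ * x) * (1 - y * x) = 1 - y * x + y * (↑u⁻¹ - ↑u⁻¹ * (x * y)) * x := by
          noncomm_ring
      _ = 1 := by rw [h2]; noncomm_ring

variable {B : Type*} [NormedRing B] [NormedAlgebra ℂ B]

theorem spectrum_add_eq_of_forall_isUnit_one_sub_mul {n : B} (h : ∀ b : B, IsUnit (1 - b * n))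
    (y : B) : spectrum ℂ (n + y) = spectrum ℂ y := by
  ext z
  rw [spectrum.mem_iff, spectrum.mem_iff, not_iff_not]
  constructor
  · rintro ⟨v, hv⟩
    have h1 : algebraMap ℂ B z - y = v * (1 - -↑v⁻¹ * n) := by
      rw [neg_mul, sub_neg_eq_add, mul_add, mul_one, Units.mul_inv_cancel_left, hv]; abel
    rw [h1]
    exact v.isUnit.mul (h _)
  · rintro ⟨v, hv⟩
    have h1 : algebraMap ℂ B z - (n + y) = v * (1 - ↑v⁻¹ * n) := by
      rw [mul_sub, mul_one, Units.mul_inv_cancel_left, hv]; abel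
    rw [h1]
    exact v.isUnit.mul (h _)

theorem quasiNilpotent_of_forall_isUnit_one_sub_smul {b : B}
    (h : ∀ z : ℂ, IsUnit (1 - z • b)) : QuasiNilpotent b := by
  intro z hz
  by_contra hz0
  have hz0 : z ≠ 0 := hz0
  refine hz ?_
  change IsUnit _
  have h1 : algebraMap ℂ B z - b = algebraMap ℂ B z * (1 - z⁻¹ • b) := by
    rw [mul_sub, mul_one, ← Algebra.smul_def, smul_smul, mul_inv_cancel₀ hz0, one_smul]
  rw [h1]
  exact ((IsUnit.mk0 z hz0).map _).mul (h _)

theorem quasiNilpotent_mul_self_sub {a : B}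
    (h : ∀ z : ℂ, z ≠ 0 → z ≠ 1 → IsUnit (algebraMap ℂ B z - a)) :
    QuasiNilpotent (a * a - a) := by
  intro μ hμ
  by_contra hμ0
  have hμ0 : μ ≠ 0 := hμ0
  obtain ⟨r, hr⟩ := IsAlgClosed.exists_pow_nat_eq (1 + 4 * μ) two_pos
  set z := (1 + r) / 2 with hz
  have hzz : z * z - z = μ := by rw [hz]; linear_combination hr / 4
  have hz0 : z ≠ 0 := by rintro h0; rw [h0] at hzz; apply hμ0; rw [← hzz]; ring
  have hz1 : z ≠ 1 := by rintro h0; rw [h0] at hzz; apply hμ0; rw [← hzz]; ring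
  refine hμ ?_
  change IsUnit _
  have h1 := (h z hz0 hz1).mul (h (1 - z) (sub_ne_zero.2 hz1.symm) (by simpa using hz0)).neg
  convert h1 using 1
  rw [← hzz]
  have hc := Algebra.commutes z a
  simp only [map_sub, map_mul, map_one]
  generalize algebraMap ℂ B z = c at hc ⊢
  have : (c - a) * -(1 - c - a) = c * c - c - (a * a - a) + (c * a - a * c) := by noncomm_ring
  rw [this, hc]; abel

variable [CompleteSpace B]

/-- If the spectrum of `a + e` stays close to `{0, 1}`, linearly in the size of `e`, then
quasinilpotent parts of `a` below a spectral idempotent `q` are robust under perturbations in the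
corner defined by `q`. -/
theorem exists_forall_isUnit_one_sub_smul_sub {a q : B} {C : ℝ} (hq : IsIdempotentElem q)
    (haq : Commute a q) (hm : QuasiNilpotent (a - q))
    (h : ∀ e : B, ∀ z : ℂ, C * ‖e‖ < ‖z‖ → C * ‖e‖ < ‖z - 1‖ →
      IsUnit (algebraMap ℂ B z - (a + e))) :
    ∃ δ > 0, ∀ e : B, q * e = e → e * q = e → ‖e‖ < δ →
      ∀ z : ℂ, IsUnit (1 - z • (q * (a - q)) - e) := by
  have hqm : Commute q (a - q) := haq.symm.sub_right (Commute.refl q)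
  set n := q * (a - q) with hn
  have hnq : QuasiNilpotent n := hm.mul_of_commute hqm
  have hunit : ∀ z : ℂ, IsUnit (1 - z • n) := fun z => (hnq.smul z).isUnit_one_sub
  have hcont : ContinuousOn (fun z : ℂ => ‖Ring.inverse (1 - z • n)‖)
      (Metric.closedBall 0 2) := by
    intro z _
    obtain ⟨u, hu⟩ := hunit z
    have h1 : ContinuousAt Ring.inverse (1 - z • n) := hu ▸ NormedRing.inverse_continuousAt u
    have h2 : ContinuousAt (fun z : ℂ => 1 - z • n) z := by fun_prop
    exact (ContinuousAt.comp (f := fun z : ℂ => 1 - z • n) h1 h2).norm.continuousWithinAt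
  obtain ⟨D, hD⟩ := (isCompact_closedBall (0 : ℂ) 2).bddAbove_image hcont
  have hD : ∀ z : ℂ, ‖z‖ ≤ 2 → ‖Ring.inverse (1 - z • n)‖ ≤ D := fun z hz =>
    hD (Set.mem_image_of_mem _ (by simpa using hz))
  set K := |C| + |D| + 1 with hK
  have hCK : C < K := by have := le_abs_self C; have := abs_nonneg D; linarith
  have hDK : D < K := by have := le_abs_self D; have := abs_nonneg C; linarith
  have hK0 : 0 < K := by positivity
  refine ⟨1 / (K + 1), by positivity, fun e he1 he2 he z => ?_⟩
  have heK : K * ‖e‖ < 1 := by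
    rw [lt_div_iff₀ (by positivity)] at he
    nlinarith [norm_nonneg e]
  have heC : C * ‖e‖ < 1 := by nlinarith [norm_nonneg e]
  rcases le_or_gt ‖z‖ 2 with hz | hz
  · obtain ⟨u, hu⟩ := hunit z
    have h1 : 1 - z • n - e = u * (1 - ↑u⁻¹ * e) := by
      rw [mul_sub, mul_one, Units.mul_inv_cancel_left, hu]
    rw [h1]
    refine u.isUnit.mul (isUnit_one_sub_of_norm_lt_one ?_)
    have h2 := hD z hz
    rw [← hu, Ring.inverse_unit] at h2
    calc ‖(↑u⁻¹ : B) * e‖ ≤ ‖(↑u⁻¹ : B)‖ * ‖e‖ := norm_mul_le _ _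
      _ ≤ D * ‖e‖ := by gcongr
      _ < 1 := by nlinarith [norm_nonneg e]
  · have hz0 : z ≠ 0 := by rintro rfl; simp at hz; linarith
    have hzi : C * ‖z⁻¹ • e‖ < ‖z⁻¹‖ := by
      rw [norm_smul, mul_left_comm]
      exact mul_lt_of_lt_one_right (norm_pos_iff.2 (inv_ne_zero hz0)) heC
    have hz2 : ‖z⁻¹‖ < 1 / 2 := by
      rw [norm_inv, one_div]
      exact inv_strictAnti₀ (by norm_num) hz
    obtain ⟨v, hv⟩ := h (z⁻¹ • e) (1 + z⁻¹) (by
      have := norm_sub_le (1 + z⁻¹) z⁻¹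
      rw [add_sub_cancel_right, norm_one] at this
      linarith) (by rwa [add_sub_cancel_left])
    have hvq : Commute (v : B) q := by
      rw [hv]
      have heq : Commute e q := by rw [Commute, SemiconjBy, he1, he2]
      exact Commute.sub_left (Algebra.commutes _ _) (haq.add_left (heq.smul_left _))
    have hviq : Commute (↑v⁻¹ : B) q := hvq.units_inv_left
    have hq' : q * q = q := hq
    have hvn : v * q = z⁻¹ • (q - z • n - e) := by
      have : a * q = q * a := haq
      rw [hv, hn, sub_mul, add_mul, mul_sub, hq', smul_mul_assoc, he2, this, smul_sub, smul_sub,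
        smul_smul, inv_mul_cancel₀ hz0, map_add, map_one, add_mul, one_mul, one_smul,
        ← Algebra.smul_def]
      abel
    have hz' : 1 - z • n - e = z • (v * q) + (1 - q) := by
      rw [hvn, smul_smul, mul_inv_cancel₀ hz0, one_smul]; abel
    rw [hz']
    have hqq : q * (1 - q) = 0 := by rw [mul_sub, hq', mul_one, sub_self]
    have hqq' : (1 - q) * q = 0 := by rw [sub_mul, hq', one_mul, sub_self]
    have hqq2 : (1 - q) * (1 - q) = 1 - q := hq.one_sub
    refine isUnit_iff_exists.2 ⟨z⁻¹ • (↑v⁻¹ * q) + (1 - q), ?_, ?_⟩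
    · have e1 : (v * q) * (↑v⁻¹ * q) = q := by
        rw [mul_assoc, ← mul_assoc q, ← hviq.eq, mul_assoc, hq', Units.mul_inv_cancel_left]
      have e2 : (v * q) * (1 - q) = 0 := by rw [mul_assoc, hqq, mul_zero]
      have e3 : (1 - q) * (↑v⁻¹ * q) = 0 := by rw [hviq.eq, ← mul_assoc, hqq', zero_mul]
      rw [add_mul, mul_add, mul_add, smul_mul_smul_comm, smul_mul_assoc, mul_smul_comm, e1, e2, e3,
        hqq2, mul_inv_cancel₀ hz0]
      simp
    · have e1 : (↑v⁻¹ * q) * (v * q) = q := by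
        rw [mul_assoc, ← mul_assoc q, ← hvq.eq, mul_assoc, hq', Units.inv_mul_cancel_left]
      have e2 : (↑v⁻¹ * q) * (1 - q) = 0 := by rw [mul_assoc, hqq, mul_zero]
      have e3 : (1 - q) * (v * q) = 0 := by rw [hvq.eq, ← mul_assoc, hqq', zero_mul]
      rw [add_mul, mul_add, mul_add, smul_mul_smul_comm, smul_mul_assoc, mul_smul_comm, e1, e2, e3,
        hqq2, inv_mul_cancel₀ hz0]
      simp

theorem quasiNilpotent_corner_mul {q n : B} {δ : ℝ} (hδ : 0 < δ)
    (h : ∀ e : B, q * e = e → e * q = e → ‖e‖ < δ → ∀ z : ℂ, IsUnit (1 - z • n - e))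
    {e : B} (he1 : q * e = e) (he2 : e * q = e) : QuasiNilpotent (e * n) := by
  have hlim : Tendsto (fun g : B => 1 - Ring.inverse (1 + g)) (𝓝 0) (𝓝 0) := by
    have h1 : ContinuousAt Ring.inverse (1 + 0 : B) := by
      rw [add_zero]; exact NormedRing.inverse_continuousAt (1 : Bˣ)
    have h2 : ContinuousAt (fun g : B => 1 - Ring.inverse (1 + g)) 0 :=
      continuousAt_const.sub
        (ContinuousAt.comp (f := fun g : B => 1 + g) h1 (by fun_prop))
    simpa [ContinuousAt] using h2
  obtain ⟨ε, hε, hball⟩ := Metric.eventually_nhds_iff_ball.1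
    (hlim.eventually (Metric.ball_mem_nhds 0 hδ))
  set r := min ε 1
  have hr : 0 < r := lt_min hε one_pos
  refine QuasiNilpotent.of_forall_sphere (n := n) (R := (‖e‖ + 1) / r) (by positivity)
    fun z hz => ?_
  have hz0 : z ≠ 0 := by
    rintro rfl
    rw [norm_zero] at hz
    have : 0 < (‖e‖ + 1) / r := by positivity
    linarith
  set g := z⁻¹ • e with hg
  have hgr : ‖g‖ < r := by
    rw [hg, norm_smul, norm_inv, hz, inv_div, div_mul_eq_mul_div, div_lt_iff₀ (by positivity)]
    gcongr
    linarith
  have hgu : IsUnit (1 + g) := by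
    have : IsUnit (1 - -g) := isUnit_one_sub_of_norm_lt_one (by
      rw [norm_neg]; exact hgr.trans_le (min_le_right _ _))
    rwa [sub_neg_eq_add] at this
  obtain ⟨u, hu⟩ := hgu
  have hsmall := hball g (by simpa using hgr.trans_le (min_le_left _ _))
  rw [← hu, Ring.inverse_unit, dist_zero_right] at hsmall
  have hg1 : q * g = g := by rw [hg, mul_smul_comm, he1]
  have hg2 : g * q = g := by rw [hg, smul_mul_assoc, he2]
  have hug : 1 - ↑u⁻¹ = ↑u⁻¹ * g := by
    have := u.inv_mul
    rw [hu, mul_add, mul_one] at this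
    rw [← this]; abel
  have hgu : 1 - ↑u⁻¹ = g * ↑u⁻¹ := by
    have := u.mul_inv
    rw [hu, add_mul, one_mul] at this
    rw [← this]; abel
  have hqn : QuasiNilpotent ((1 + g) * n) := by
    refine quasiNilpotent_of_forall_isUnit_one_sub_smul fun w => ?_
    have h1 : 1 - w • ((1 + g) * n) = u * (1 - w • n - (1 - ↑u⁻¹)) := by
      rw [← hu, mul_sub, mul_sub, mul_sub, Units.mul_inv, mul_one, mul_smul_comm]; abel
    rw [h1]
    refine u.isUnit.mul (h _ ?_ ?_ hsmall w)
    · rw [hgu, ← mul_assoc, hg1]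
    · rw [hug, mul_assoc, hg2]
  convert hqn.smul z using 1
  rw [add_mul, one_mul, smul_add, hg, smul_mul_assoc, smul_smul, mul_inv_cancel₀ hz0, one_smul]

theorem isUnit_one_sub_mul_of_corner {a q : B} {C : ℝ} (hq : IsIdempotentElem q)
    (haq : Commute a q) (hm : QuasiNilpotent (a - q))
    (h : ∀ e : B, ∀ z : ℂ, C * ‖e‖ < ‖z‖ → C * ‖e‖ < ‖z - 1‖ →
      IsUnit (algebraMap ℂ B z - (a + e))) (b : B) :
    IsUnit (1 - b * (q * (a - q))) := by
  obtain ⟨δ, hδ, H⟩ := exists_forall_isUnit_one_sub_smul_sub hq haq hm h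
  have hq' : q * q = q := hq
  have hqm : (a - q) * q = q * (a - q) := haq.sub_left (Commute.refl q)
  have h1 := (quasiNilpotent_corner_mul hδ H (e := q * b * q)
    (by rw [← mul_assoc, ← mul_assoc, hq']) (by rw [mul_assoc, hq'])).isUnit_one_sub
  have h2 : q * b * q * (q * (a - q)) = q * (b * (q * (a - q))) := by
    rw [mul_assoc _ q, ← mul_assoc q q, hq', mul_assoc q b]
  rw [h2] at h1
  have h3 := h1.one_sub_mul_comm
  rwa [mul_assoc b, mul_assoc q, hqm, ← mul_assoc q, hq'] at h3

/-- In a Banach algebra without nontrivial spectrally invisible elements, an element whose spectrum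
behaves under perturbation like that of an idempotent is an idempotent. -/
theorem isIdempotentElem_of_isUnit_sub_add {a : B} {C : ℝ}
    (hss : ∀ n : B, (∀ y, spectrum ℂ (n + y) = spectrum ℂ y) → n = 0)
    (h : ∀ e : B, ∀ z : ℂ, C * ‖e‖ < ‖z‖ → C * ‖e‖ < ‖z - 1‖ →
      IsUnit (algebraMap ℂ B z - (a + e))) : IsIdempotentElem a := by
  have hd : QuasiNilpotent (a * a - a) := quasiNilpotent_mul_self_sub fun z h0 h1 => by
    simpa using h 0 z (by simpa using h0) (by simpa [sub_eq_zero] using h1)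
  obtain ⟨q, hq, haq, hm⟩ := exists_isIdempotentElem_quasiNilpotent_sub hd
  have h1 : q * (a - q) = 0 := hss _
    (spectrum_add_eq_of_forall_isUnit_one_sub_mul (isUnit_one_sub_mul_of_corner hq haq hm h))
  have hm' : QuasiNilpotent ((1 - a) - (1 - q)) := by
    convert hm.smul (-1) using 1
    rw [neg_one_smul]; abel
  have h2 : (1 - q) * ((1 - a) - (1 - q)) = 0 := by
    refine hss _ (spectrum_add_eq_of_forall_isUnit_one_sub_mul
      (isUnit_one_sub_mul_of_corner (C := C) hq.one_sub ?_ hm' fun e z hz hz1 => ?_))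
    · exact (Commute.one_left _).sub_left ((Commute.one_right a).sub_right haq)
    · have := (h (-e) (1 - z) (by rwa [norm_neg, norm_sub_rev])
        (by rwa [norm_neg, sub_sub_cancel_left, norm_neg])).neg
      convert this using 1
      rw [map_sub, map_one]; abel
  have h3 : a - q = q * (a - q) - (1 - q) * ((1 - a) - (1 - q)) := by noncomm_ring
  rw [h1, h2, sub_zero, sub_eq_zero] at h3
  rwa [h3]

end Corner

section Perturbation

variable {A B : Type*} [NormedRing A] [NormedAlgebra ℂ A] [CompleteSpace A]
  [NormedRing B] [NormedAlgebra ℂ B]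

theorem IsIdempotentElem.isUnit_algebraMap_sub_add {p e : A} (hp : IsIdempotentElem p) {z : ℂ}
    (h0 : (‖p‖ + ‖1 - p‖) * ‖e‖ < ‖z‖) (h1 : (‖p‖ + ‖1 - p‖) * ‖e‖ < ‖z - 1‖) :
    IsUnit (algebraMap ℂ A z - (p + e)) := by
  have hC : 0 ≤ (‖p‖ + ‖1 - p‖) * ‖e‖ := by positivity
  have hz0 : z ≠ 0 := norm_pos_iff.1 (hC.trans_lt h0)
  have hz1 : z - 1 ≠ 0 := norm_pos_iff.1 (hC.trans_lt h1)
  have hp' : p * p = p := hp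
  have hpp : p * (1 - p) = 0 := by rw [mul_sub, hp', mul_one, sub_self]
  have hpp' : (1 - p) * p = 0 := by rw [sub_mul, hp', one_mul, sub_self]
  have hpp2 : (1 - p) * (1 - p) = 1 - p := hp.one_sub
  set r : A := (z - 1)⁻¹ • p + z⁻¹ • (1 - p) with hr
  have hzp : algebraMap ℂ A z - p = (z - 1) • p + z • (1 - p) := by
    rw [Algebra.algebraMap_eq_smul_one, sub_smul, smul_sub, one_smul]; abel
  have e1 : (algebraMap ℂ A z - p) * r = 1 := by
    rw [hzp, hr, add_mul, mul_add, mul_add]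
    simp only [smul_mul_smul_comm, hp', hpp, hpp', hpp2, mul_inv_cancel₀ hz0, mul_inv_cancel₀ hz1]
    simp
  have e2 : r * (algebraMap ℂ A z - p) = 1 := by
    rw [hzp, hr, add_mul, mul_add, mul_add]
    simp only [smul_mul_smul_comm, hp', hpp, hpp', hpp2, inv_mul_cancel₀ hz0, inv_mul_cancel₀ hz1]
    simp
  have h2 : algebraMap ℂ A z - (p + e) = (algebraMap ℂ A z - p) * (1 - r * e) := by
    rw [mul_sub, mul_one, ← mul_assoc, e1, one_mul]; abel
  rw [h2]
  refine (isUnit_iff_exists.2 ⟨r, e1, e2⟩).mul (isUnit_one_sub_of_norm_lt_one ?_)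
  set t := min ‖z‖ ‖z - 1‖
  have ht : (‖p‖ + ‖1 - p‖) * ‖e‖ < t := lt_min h0 h1
  have ht0 : 0 < t := hC.trans_lt ht
  have hrt : ‖r‖ ≤ (‖p‖ + ‖1 - p‖) / t := by
    refine (norm_add_le _ _).trans ?_
    rw [norm_smul, norm_smul, norm_inv, norm_inv, add_div, div_eq_inv_mul, div_eq_inv_mul]
    gcongr
    · exact min_le_right _ _
    · exact min_le_left _ _
  calc ‖r * e‖ ≤ ‖r‖ * ‖e‖ := norm_mul_le _ _
    _ ≤ (‖p‖ + ‖1 - p‖) / t * ‖e‖ := by gcongr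
    _ < 1 := by rwa [div_mul_eq_mul_div, div_lt_one ht0]

theorem isIdempotentElem_map_of_spectrum_eq [CompleteSpace B] {S : A → B} {K : ℝ}
    (hadd : ∀ x y, S (x + y) = S x + S y) (hspec : ∀ x, spectrum ℂ (S x) = spectrum ℂ x)
    (hK : ∀ e, ∃ x, S x = e ∧ ‖x‖ ≤ K * ‖e‖)
    (hss : ∀ n : B, (∀ y, spectrum ℂ (n + y) = spectrum ℂ y) → n = 0)
    {p : A} (hp : IsIdempotentElem p) : IsIdempotentElem (S p) := by
  refine isIdempotentElem_of_isUnit_sub_add (C := (‖p‖ + ‖1 - p‖) * K) hss fun e z h0 h1 => ?_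
  obtain ⟨x, rfl, hx⟩ := hK e
  have hle : (‖p‖ + ‖1 - p‖) * ‖x‖ ≤ (‖p‖ + ‖1 - p‖) * K * ‖S x‖ := by
    rw [mul_assoc]; gcongr
  have := hp.isUnit_algebraMap_sub_add (hle.trans_lt h0) (hle.trans_lt h1)
  rw [← hadd]
  by_contra hc
  have hc : z ∈ spectrum ℂ (S (p + x)) := hc
  rw [hspec] at hc
  exact hc this

end Perturbation

section FiniteSpectrum

theorem spectrum_add_subset_of_mul_eq_zero {A : Type*} [Ring A] [Algebra ℂ A] {x y : A}
    (h : x * y = 0) : spectrum ℂ (x + y) ⊆ {0} ∪ (spectrum ℂ x ∪ spectrum ℂ y) := by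
  intro z hz
  by_contra hc
  simp only [Set.mem_union, not_or, Set.mem_singleton_iff] at hc
  obtain ⟨hz0, hx, hy⟩ := hc
  have hx : IsUnit (algebraMap ℂ A z - x) := not_not.1 hx
  have hy : IsUnit (algebraMap ℂ A z - y) := not_not.1 hy
  refine hz ?_
  change IsUnit _
  have h1 : (algebraMap ℂ A z - x) * (algebraMap ℂ A z - y) =
      algebraMap ℂ A z * (algebraMap ℂ A z - (x + y)) := by
    have := Algebra.commutes z x
    rw [sub_mul, mul_sub, mul_sub, h, ← this, mul_sub, mul_add]
    abel
  have h2 := hx.mul hy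
  rw [h1] at h2
  obtain ⟨u, hu⟩ : IsUnit (algebraMap ℂ A z) := (IsUnit.mk0 z hz0).map _
  rw [← hu] at h2 ⊢
  exact (u.isUnit_units_mul _).1 h2

theorem IsIdempotentElem.spectrum_smul_finite {A : Type*} [Ring A] [Algebra ℂ A] {p : A}
    (hp : IsIdempotentElem p) (t : ℂ) : (spectrum ℂ (t • p)).Finite := by
  refine (Set.toFinite {0, t}).subset fun z hz => ?_
  by_contra hc
  simp only [Set.mem_insert_iff, not_or, Set.mem_singleton_iff] at hc
  obtain ⟨hz0, hzt⟩ := hc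
  refine hz ?_
  change IsUnit _
  have hp' : p * p = p := hp
  have hw : z * (z - t) ≠ 0 := mul_ne_zero hz0 (sub_ne_zero.2 hzt)
  have e1 : (algebraMap ℂ A z - t • p) * ((z - t) • 1 + t • p) = (z * (z - t)) • 1 := by
    simp only [Algebra.algebraMap_eq_smul_one, sub_mul, mul_add, smul_mul_smul_comm, hp', one_mul,
      mul_one]
    module
  have e2 : ((z - t) • 1 + t • p) * (algebraMap ℂ A z - t • p) = (z * (z - t)) • 1 := by
    simp only [Algebra.algebraMap_eq_smul_one, mul_sub, add_mul, smul_mul_smul_comm, hp', one_mul,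
      mul_one]
    module
  refine isUnit_iff_exists.2 ⟨(z * (z - t))⁻¹ • ((z - t) • 1 + t • p), ?_, ?_⟩
  · rw [mul_smul_comm, e1, smul_smul, inv_mul_cancel₀ hw, one_smul]
  · rw [smul_mul_assoc, e2, smul_smul, inv_mul_cancel₀ hw, one_smul]

theorem spectrum_sum_smul_finite {A : Type*} [Ring A] [Algebra ℂ A] {ι : Type*} {p : ι → A}
    (hp : ∀ i, IsIdempotentElem (p i)) (hpp : ∀ i j, i ≠ j → p i * p j = 0) (t : ι → ℂ)
    (s : Finset ι) : (spectrum ℂ (∑ i ∈ s, t i • p i)).Finite := by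
  classical
  induction s using Finset.induction_on with
  | empty =>
    refine (Set.finite_singleton (0 : ℂ)).subset fun z hz => ?_
    by_contra hz0
    refine hz ?_
    change IsUnit _
    rw [Finset.sum_empty, sub_zero]
    exact (IsUnit.mk0 z hz0).map _
  | insert i s hi ih =>
    rw [Finset.sum_insert hi]
    refine ((Set.finite_singleton 0).union (((hp i).spectrum_smul_finite _).union ih)).subset
      (spectrum_add_subset_of_mul_eq_zero ?_)
    rw [Finset.mul_sum]
    refine Finset.sum_eq_zero fun j hj => ?_
    rw [smul_mul_smul_comm, hpp i j (by rintro rfl; exact hi hj), smul_zero]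

variable {A : Type*} [CStarAlgebra A]

open Topology Filter

theorem exists_isSelfAdjoint_forall_isUnit_sub
    (hrr0 : ∀ a : A, IsSelfAdjoint a → a ∈ closure {x : A | IsSelfAdjoint x ∧ IsUnit x})
    (G : Finset ℝ) {a : A} (ha : IsSelfAdjoint a) {ε : ℝ} (hε : 0 < ε) :
    ∃ b : A, IsSelfAdjoint b ∧ ‖a - b‖ < ε ∧ ∀ t ∈ G, IsUnit (b - algebraMap ℝ A t) := by
  classical
  induction G using Finset.induction_on generalizing ε with
  | empty => exact ⟨a, ha, by simpa, by simp⟩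
  | insert t G _ ih =>
    obtain ⟨b, hb, hab, hbG⟩ := ih (half_pos hε)
    have h1 : ∀ᶠ x in 𝓝 b, ∀ t ∈ G, IsUnit (x - algebraMap ℝ A t) := by
      rw [Filter.eventually_all_finset]
      intro t ht
      have hc : ContinuousAt (fun x : A => x - algebraMap ℝ A t) b := by fun_prop
      exact hc.eventually (Units.isOpen.mem_nhds (hbG t ht))
    obtain ⟨δ, hδ, hball⟩ := Metric.eventually_nhds_iff_ball.1 h1
    have hsa : IsSelfAdjoint (algebraMap ℝ A t) := IsSelfAdjoint.algebraMap A (.all t)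
    obtain ⟨c, ⟨hc, hcu⟩, hbc⟩ := Metric.mem_closure_iff.1 (hrr0 _ (hb.sub hsa)) (min δ (ε / 2))
      (lt_min hδ (half_pos hε))
    have hdist : ‖b - (c + algebraMap ℝ A t)‖ < min δ (ε / 2) := by
      rwa [dist_eq_norm, sub_sub, add_comm (algebraMap ℝ A t)] at hbc
    refine ⟨c + algebraMap ℝ A t, hc.add hsa, ?_, fun s hs => ?_⟩
    · calc ‖a - (c + algebraMap ℝ A t)‖ = ‖(a - b) + (b - (c + algebraMap ℝ A t))‖ := by
            congr 1; abel
        _ ≤ ‖a - b‖ + ‖b - (c + algebraMap ℝ A t)‖ := norm_add_le _ _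
        _ < ε / 2 + ε / 2 := add_lt_add hab (hdist.trans_le (min_le_right _ _))
        _ = ε := add_halves ε
    · rcases Finset.mem_insert.1 hs with rfl | hs
      · rwa [add_sub_cancel_right]
      · refine hball _ ?_ s hs
        rw [mem_ball_iff_norm']
        exact hdist.trans_le (min_le_left _ _)

theorem continuousOn_comp_floor_div {S : Set ℝ} {η : ℝ} (hη : 0 < η)
    (hS : ∀ k : ℤ, η * k ∉ S) (g : ℤ → ℝ) : ContinuousOn (fun x => g ⌊x / η⌋) S := by
  intro x hx
  have hlt : (⌊x / η⌋ : ℝ) < x / η := by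
    refine lt_of_le_of_ne (Int.floor_le _) fun h => hS ⌊x / η⌋ ?_
    rwa [h, mul_div_cancel₀ _ hη.ne']
  have hcont : ContinuousAt (fun y : ℝ => y / η) x := by fun_prop
  have hev : ∀ᶠ y in 𝓝 x, g ⌊x / η⌋ = g ⌊y / η⌋ := by
    filter_upwards [hcont.eventually (Ioo_mem_nhds hlt (Int.lt_floor_add_one _))] with y hy
    rw [(Int.floor_eq_iff (a := y / η)).2 ⟨hy.1.le, hy.2⟩]
  exact (continuousAt_const.congr hev).continuousWithinAt

/-- In a C*-algebra of real rank zero, every self-adjoint element is a limit of real linear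
combinations of orthogonal projections. -/
theorem exists_norm_sub_sum_smul_projection_lt [Nontrivial A]
    (hrr0 : ∀ a : A, IsSelfAdjoint a → a ∈ closure {x : A | IsSelfAdjoint x ∧ IsUnit x})
    {a : A} (ha : IsSelfAdjoint a) {ε : ℝ} (hε : 0 < ε) :
    ∃ (s : Finset ℤ) (t : ℤ → ℝ) (p : ℤ → A), (∀ k, IsSelfAdjoint (p k)) ∧
      (∀ k, IsIdempotentElem (p k)) ∧ (∀ j k, j ≠ k → p j * p k = 0) ∧
      ‖a - ∑ k ∈ s, t k • p k‖ < ε := by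
  set η := ε / 4 with hη
  have hη0 : 0 < η := by positivity
  set N : ℤ := ⌈(‖a‖ + η) / η⌉ + 1
  have hN : ∀ k : ℤ, η * |(k : ℝ)| ≤ ‖a‖ + η → k ∈ Finset.Icc (-N) N := by
    intro k hk
    have h1 : |(k : ℝ)| ≤ (‖a‖ + η) / η := by rwa [le_div_iff₀' hη0]
    have h2 : |(k : ℝ)| ≤ ⌈(‖a‖ + η) / η⌉ := h1.trans (Int.le_ceil _)
    have h3 : |k| ≤ ⌈(‖a‖ + η) / η⌉ := by exact_mod_cast h2
    rw [Finset.mem_Icc, ← abs_le]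
    omega
  obtain ⟨b, hb, hab, hbG⟩ := exists_isSelfAdjoint_forall_isUnit_sub hrr0
    ((Finset.Icc (-N) N).image fun k : ℤ => η * k) ha hη0
  have hnb : ‖b‖ ≤ ‖a‖ + η := by
    have := norm_sub_norm_le b a
    rw [norm_sub_rev] at this
    linarith
  have hgrid : ∀ k : ℤ, η * k ∉ spectrum ℝ b := by
    intro k hk
    have h1 := (spectrum.norm_le_norm_of_mem hk).trans hnb
    rw [Real.norm_eq_abs, abs_mul, abs_of_pos hη0] at h1
    have h2 := (hbG _ (Finset.mem_image_of_mem _ (hN k h1))).neg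
    rw [neg_sub] at h2
    exact hk h2
  have hcont : ∀ g : ℤ → ℝ, ContinuousOn (fun x => g ⌊x / η⌋) (spectrum ℝ b) :=
    continuousOn_comp_floor_div hη0 hgrid
  set χ : ℤ → ℤ → ℝ := fun k j => if j = k then 1 else 0 with hχ
  refine ⟨Finset.Icc (-N) N, fun k => η * k, fun k => cfc (fun x => χ k ⌊x / η⌋) b, fun k => ?_,
    fun k => ?_, fun j k hjk => ?_, ?_⟩
  · exact cfc_predicate _ _
  · rw [IsIdempotentElem, ← cfc_mul _ _ b (hcont _) (hcont _)]
    congr 1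
    ext x
    simp [hχ]
  · rw [← cfc_mul _ _ b (hcont _) (hcont _), ← cfc_zero ℝ b]
    congr 1
    ext x
    simp only [hχ, mul_ite, mul_one, mul_zero, Pi.zero_apply]
    split_ifs with h1 h2
    · exact absurd (h2.symm.trans h1) hjk
    · rfl
    · rfl
  · have hsub : b - ∑ k ∈ Finset.Icc (-N) N, (η * k) • cfc (fun x => χ k ⌊x / η⌋) b =
        cfc (fun x => x - ∑ k ∈ Finset.Icc (-N) N, (η * k) • χ k ⌊x / η⌋) b := by
      have hc : ContinuousOn (fun x => ∑ k ∈ Finset.Icc (-N) N, (η * k) • χ k ⌊x / η⌋)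
          (spectrum ℝ b) := continuousOn_finsetSum _ fun k _ => (hcont (χ k)).const_smul (η * k)
      rw [cfc_sub (fun x => x) _ b continuousOn_id hc, cfc_id' ℝ b]
      congr 1
      rw [Finset.sum_congr rfl fun (k : ℤ) _ => (cfc_smul (η * k) _ b (hcont (χ k))).symm,
        ← cfc_sum (fun (k : ℤ) x => (η * k) • χ k ⌊x / η⌋) b _
          fun (k : ℤ) _ => (hcont (χ k)).const_smul (η * k)]
      congr 1
      ext x
      rw [Finset.sum_apply]
    have hle : ‖b - ∑ k ∈ Finset.Icc (-N) N, (η * k) • cfc (fun x => χ k ⌊x / η⌋) b‖ ≤ η := by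
      rw [hsub]
      refine norm_cfc_le hη0.le fun x hx => ?_
      have hx1 := (spectrum.norm_le_norm_of_mem hx).trans hnb
      rw [Real.norm_eq_abs] at hx1
      have hfl : ⌊x / η⌋ ∈ Finset.Icc (-N) N := by
        have h1 : |x / η| ≤ (‖a‖ + η) / η := by rw [abs_div, abs_of_pos hη0]; gcongr
        have h2 := abs_le.1 (h1.trans (Int.le_ceil _))
        have h3 : -⌈(‖a‖ + η) / η⌉ ≤ ⌊x / η⌋ := Int.le_floor.2 (by push_cast; exact h2.1)
        have h4 : ⌊x / η⌋ ≤ ⌈(‖a‖ + η) / η⌉ := by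
          exact_mod_cast (Int.floor_le _).trans h2.2
        rw [Finset.mem_Icc]
        omega
      rw [Finset.sum_eq_single_of_mem _ hfl fun k _ hk => by simp [hχ, hk.symm]]
      have h1 := Int.floor_le (x / η)
      have h2 := Int.lt_floor_add_one (x / η)
      rw [le_div_iff₀' hη0] at h1
      rw [div_lt_iff₀' hη0] at h2
      simp only [hχ, if_true, smul_eq_mul, mul_one]
      rw [Real.norm_eq_abs, abs_le]
      constructor <;> linarith
    calc ‖a - ∑ k ∈ Finset.Icc (-N) N, (η * k) • cfc (fun x => χ k ⌊x / η⌋) b‖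
        ≤ ‖a - b‖ + ‖b - ∑ k ∈ Finset.Icc (-N) N, (η * k) • cfc (fun x => χ k ⌊x / η⌋) b‖ :=
          norm_sub_le_norm_sub_add_norm_sub _ _ _
      _ < ε := by linarith

end FiniteSpectrum

section Semicontinuity

open Filter Topology

variable {E : Type*} [NormedRing E] [NormedAlgebra ℂ E] [CompleteSpace E]

/-- If the resolvent of `y` is bounded by `D` on a circle around `z`, and that of a sufficiently
close `y + x` exists in the disc, then the resolvent of `y` exists at `z`. -/
theorem isUnit_algebraMap_sub_of_sphere {x y : E} {z : ℂ} {r D : ℝ} (hr : 0 < r)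
    (hD : ∀ w ∈ Metric.sphere z r, IsUnit (algebraMap ℂ E w - y) ∧
      ‖Ring.inverse (algebraMap ℂ E w - y)‖ ≤ D)
    (hx : ∀ w ∈ Metric.closedBall z r, IsUnit (algebraMap ℂ E w - (y + x)))
    (hxD : D * ‖x‖ < 1 / 2) : IsUnit (algebraMap ℂ E z - y) := by
  set f : ℂ → E := fun w => Ring.inverse (algebraMap ℂ E w - (y + x)) with hf
  have hdiff : DifferentiableOn ℂ f (Metric.closedBall z r) := by
    intro w hw
    have h1 : DifferentiableAt ℂ Ring.inverse (algebraMap ℂ E w - (y + x)) := by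
      obtain ⟨u, hu⟩ := hx w hw
      exact hu ▸ differentiableAt_inverse u.isUnit
    have h2 : DifferentiableAt ℂ (fun w : ℂ => algebraMap ℂ E w - (y + x)) w := by
      simp only [Algebra.algebraMap_eq_smul_one]
      fun_prop
    exact (h1.comp w h2).differentiableWithinAt
  have hbound : ∀ w ∈ frontier (Metric.ball z r), ‖f w‖ ≤ 2 * D := by
    intro w hw
    rw [frontier_ball _ hr.ne'] at hw
    obtain ⟨⟨u, hu⟩, huD⟩ := hD w hw
    obtain ⟨v, hv⟩ := hx w (Metric.sphere_subset_closedBall hw)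
    rw [← hu, Ring.inverse_unit] at huD
    have hfw : f w = ↑v⁻¹ := by rw [hf]; simp only [← hv, Ring.inverse_unit]
    have huv : (u : E) = v + x := by rw [hu, hv]; abel
    have h1 : (↑v⁻¹ : E) = ↑u⁻¹ + ↑u⁻¹ * x * ↑v⁻¹ := by
      have h2 : x = u - v := by rw [huv]; abel
      rw [h2, mul_sub, Units.inv_mul, sub_mul, one_mul, mul_assoc, Units.mul_inv, mul_one]
      abel
    have h2 : ‖(↑v⁻¹ : E)‖ ≤ D + 1 / 2 * ‖(↑v⁻¹ : E)‖ := by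
      conv_lhs => rw [h1]
      refine (norm_add_le _ _).trans (add_le_add huD ?_)
      refine (norm_mul_le _ _).trans ?_
      gcongr
      calc ‖↑u⁻¹ * x‖ ≤ ‖(↑u⁻¹ : E)‖ * ‖x‖ := norm_mul_le _ _
        _ ≤ D * ‖x‖ := by gcongr
        _ ≤ 1 / 2 := hxD.le
    rw [hfw]
    linarith
  have hz : ‖f z‖ ≤ 2 * D := Complex.norm_le_of_forall_mem_frontier_norm_le Metric.isBounded_ball
    (hdiff.diffContOnCl_ball (le_refl _)) hbound (subset_closure (Metric.mem_ball_self hr))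
  obtain ⟨v, hv⟩ := hx z (Metric.mem_closedBall_self hr.le)
  have hfz : f z = ↑v⁻¹ := by rw [hf]; simp only [← hv, Ring.inverse_unit]
  rw [hfz] at hz
  have h1 : algebraMap ℂ E z - y = v * (1 - -(↑v⁻¹ * x)) := by
    rw [sub_neg_eq_add, mul_add, mul_one, Units.mul_inv_cancel_left, hv]; abel
  rw [h1]
  refine v.isUnit.mul (isUnit_one_sub_of_norm_lt_one ?_)
  rw [norm_neg]
  calc ‖↑v⁻¹ * x‖ ≤ ‖(↑v⁻¹ : E)‖ * ‖x‖ := norm_mul_le _ _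
    _ ≤ 2 * D * ‖x‖ := by gcongr
    _ < 1 := by linarith

/-- Lower semicontinuity of the spectrum at elements of finite spectrum. -/
theorem eventually_exists_mem_spectrum_of_finite {y : E} (hy : (spectrum ℂ y).Finite) {z : ℂ}
    (hz : z ∈ spectrum ℂ y) {x : ℕ → E} (hx : Tendsto x atTop (𝓝 0)) {δ : ℝ} (hδ : 0 < δ) :
    ∀ᶠ n in atTop, ∃ w ∈ spectrum ℂ (y + x n), ‖w - z‖ < δ := by
  obtain ⟨r', hr', hball⟩ := Metric.nhds_basis_ball.mem_iff.1
    ((hy.subset Set.sdiff_subset).isClosed.isOpen_compl.mem_nhds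
      (show z ∈ (spectrum ℂ y \ {z})ᶜ by simp))
  set r := min (r' / 2) (δ / 2)
  have hr : 0 < r := lt_min (by positivity) (by positivity)
  have hrr' : r < r' := (min_le_left _ _).trans_lt (half_lt_self hr')
  have hrδ : r < δ := (min_le_right _ _).trans_lt (half_lt_self hδ)
  have hunit : ∀ w ∈ Metric.sphere z r, IsUnit (algebraMap ℂ E w - y) := by
    intro w hw
    by_contra hc
    have hwz : w ≠ z := by
      rintro rfl
      simp only [Metric.mem_sphere, dist_self] at hw
      exact hr.ne hw
    refine hball (a := w) ?_ ⟨hc, hwz⟩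
    rw [Metric.mem_ball]
    exact (Metric.mem_sphere.1 hw).trans_lt hrr'
  have hcont : ContinuousOn (fun w : ℂ => ‖Ring.inverse (algebraMap ℂ E w - y)‖)
      (Metric.sphere z r) := by
    intro w hw
    have h1 : ContinuousAt Ring.inverse (algebraMap ℂ E w - y) := by
      obtain ⟨u, hu⟩ := hunit w hw
      exact hu ▸ NormedRing.inverse_continuousAt u
    have h2 : ContinuousAt (fun w : ℂ => algebraMap ℂ E w - y) w := by
      have := (algebraMapCLM ℂ E).continuous
      exact (this.sub continuous_const).continuousAt
    exact (ContinuousAt.comp (f := fun w : ℂ => algebraMap ℂ E w - y)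
      h1 h2).norm.continuousWithinAt
  obtain ⟨D, hD⟩ := (isCompact_sphere z r).bddAbove_image hcont
  have hlim : Tendsto (fun n => D * ‖x n‖) atTop (𝓝 0) := by
    simpa using (hx.norm).const_mul D
  filter_upwards [hlim.eventually (gt_mem_nhds (by norm_num : (0 : ℝ) < 1 / 2))] with n hn
  by_contra! hc
  refine hz (isUnit_algebraMap_sub_of_sphere hr
    (fun w hw => ⟨hunit w hw, hD (Set.mem_image_of_mem _ hw)⟩) (fun w hw => ?_) hn)
  by_contra hw'
  have := hc w hw'
  rw [Metric.mem_closedBall, dist_eq_norm] at hw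
  linarith

end Semicontinuity

section ClosedGraph

open Filter Topology

theorem spectrum_subset_of_tendsto {A B : Type*} [NormedRing A] [NormedAlgebra ℂ A]
    [CompleteSpace A] [NormedRing B] [NormedAlgebra ℂ B] [CompleteSpace B] {T : A → B}
    (hadd : ∀ x y, T (x + y) = T x + T y) (hspec : ∀ x, spectrum ℂ (T x) = spectrum ℂ x)
    {x : ℕ → A} {z : A} (hx : Tendsto x atTop (𝓝 0))
    (hTx : Tendsto (fun n => T (x n)) atTop (𝓝 (T z))) {y : A} (hy : (spectrum ℂ y).Finite) :
    spectrum ℂ y ⊆ spectrum ℂ (z + y) := by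
  intro w hw hc
  have hc : w ∉ spectrum ℂ (z + y) := not_not.2 hc
  rw [← hspec, hadd] at hc
  have hc : IsUnit (algebraMap ℂ B w - (T z + T y)) := not_not.1 hc
  have hcont : Continuous fun v : ℂ × B => algebraMap ℂ B v.1 - (v.2 + T y) := by
    have := (algebraMapCLM ℂ B).continuous
    exact (this.comp continuous_fst).sub (continuous_snd.add continuous_const)
  have h1 : ∀ᶠ v in 𝓝 (w, T z), IsUnit (algebraMap ℂ B v.1 - (v.2 + T y)) :=
    hcont.continuousAt.eventually (Units.isOpen.mem_nhds hc)
  rw [nhds_prod_eq] at h1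
  obtain ⟨p, hp, q, hq, hpq⟩ := eventually_prod_iff.1 h1
  obtain ⟨δ, hδ, hball⟩ := Metric.eventually_nhds_iff_ball.1 hp
  obtain ⟨n, ⟨v, hv, hvw⟩, hn⟩ := ((eventually_exists_mem_spectrum_of_finite hy hw hx hδ).and
    (hTx.eventually hq)).exists
  rw [← hspec, add_comm, hadd] at hv
  exact hv (hpq (hball v (by simpa [dist_eq_norm] using hvw)) hn)

variable {A : Type*} [CStarAlgebra A]

theorem IsSelfAdjoint.exists_inv_sub_I_smul {k : A} (hk : IsSelfAdjoint k) {t : ℝ} (ht : t ≠ 0) :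
    ∃ u : Aˣ, (u : A) = algebraMap ℂ A t - Complex.I • k ∧ ‖(↑u⁻¹ : A)‖ ≤ |t|⁻¹ := by
  have hne : ∀ s : ℝ, (t - Complex.I * s : ℂ) ≠ 0 := fun s h => ht (by
    simpa using congrArg Complex.re h)
  have hreal : ∀ w ∈ spectrum ℂ k, w = (w.re : ℂ) := fun w hw => hk.mem_spectrum_eq_re hw
  have hne' : ∀ w ∈ spectrum ℂ k, (t - Complex.I * w : ℂ) ≠ 0 := fun w hw => by
    rw [hreal w hw]; exact hne _
  have hcont : ContinuousOn (fun w : ℂ => (t - Complex.I * w)⁻¹) (spectrum ℂ k) :=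
    ContinuousOn.inv₀ (by fun_prop) hne'
  have hkn : IsStarNormal k := hk.isStarNormal
  have h1 : cfc (fun w : ℂ => t - Complex.I * w) k = algebraMap ℂ A t - Complex.I • k := by
    rw [cfc_sub (fun _ => (t : ℂ)) (fun w => Complex.I * w) k, cfc_const (t : ℂ) k,
      cfc_const_mul_id Complex.I k]
  have h2 : cfc (fun w : ℂ => t - Complex.I * w) k * cfc (fun w : ℂ => (t - Complex.I * w)⁻¹) k
      = 1 := by
    rw [← cfc_mul _ _ k (by fun_prop) hcont, ← cfc_one ℂ k]
    exact cfc_congr fun w hw => mul_inv_cancel₀ (hne' w hw)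
  have h3 : cfc (fun w : ℂ => (t - Complex.I * w)⁻¹) k * cfc (fun w : ℂ => t - Complex.I * w) k
      = 1 := by
    rw [← cfc_mul _ _ k hcont (by fun_prop), ← cfc_one ℂ k]
    exact cfc_congr fun w hw => inv_mul_cancel₀ (hne' w hw)
  refine ⟨⟨_, _, h2, h3⟩, h1, norm_cfc_le (by positivity) fun w hw => ?_⟩
  rw [norm_inv]
  have h4 := Complex.abs_re_le_norm (t - Complex.I * w)
  rw [hreal w hw] at h4 ⊢
  refine inv_anti₀ (by positivity) ?_
  simpa using h4

/-- The self-adjoint part of the separating elements of a spectrum preserving map vanishes. -/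
theorem realPart_eq_zero_of_spectrum_subset [Nontrivial A]
    (hrr0 : ∀ a : A, IsSelfAdjoint a → a ∈ closure {x : A | IsSelfAdjoint x ∧ IsUnit x})
    {z : A} (hz : ∀ y : A, (spectrum ℂ y).Finite → spectrum ℂ y ⊆ spectrum ℂ (z + y)) :
    (realPart z : A) = 0 := by
  set h : A := ↑(realPart z)
  set k : A := ↑(imaginaryPart z)
  have hh : IsSelfAdjoint h := (realPart z).2
  have hk : IsSelfAdjoint k := (imaginaryPart z).2
  have hzhk : z = h + Complex.I • k := (realPart_add_I_smul_imaginaryPart z).symm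
  have key : ∀ ε : ℝ, 0 < ε → ‖h‖ ≤ 0 + 2 * ε := by
    intro ε hε
    obtain ⟨s, t, p, hps, hpi, hpp, hlt⟩ := exists_norm_sub_sum_smul_projection_lt hrr0 hh.neg hε
    set y := ∑ k ∈ s, t k • p k with hy
    have hysa : IsSelfAdjoint y :=
      isSelfAdjoint_sum _ fun k _ => (IsSelfAdjoint.all (t k)).smul (hps k)
    have hyfin : (spectrum ℂ y).Finite := by
      simpa using spectrum_sum_smul_finite hpi hpp (fun k => (t k : ℂ)) s
    have hhy : ‖h + y‖ < ε := by
      rw [← norm_neg, neg_add']; exact hlt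
    have hsp : ∀ w ∈ spectrum ℂ y, ‖w‖ ≤ ε := by
      intro w hw
      by_contra! hεw
      have hwr : w = (w.re : ℂ) := hysa.mem_spectrum_eq_re hw
      have hw2 : ‖w‖ = |w.re| := by rw [hwr]; simp
      have hre : w.re ≠ 0 := fun h0 => by rw [hw2, h0, abs_zero] at hεw; linarith
      obtain ⟨u, hu, hun⟩ := hk.exists_inv_sub_I_smul hre
      refine hz y hyfin hw ?_
      change IsUnit _
      have h1 : algebraMap ℂ A w - (z + y) = u * (1 - ↑u⁻¹ * (h + y)) := by
        rw [mul_sub, mul_one, Units.mul_inv_cancel_left, hu, ← hwr, hzhk]; abel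
      rw [h1]
      refine u.isUnit.mul (isUnit_one_sub_of_norm_lt_one ?_)
      calc ‖↑u⁻¹ * (h + y)‖ ≤ ‖(↑u⁻¹ : A)‖ * ‖h + y‖ := norm_mul_le _ _
        _ ≤ |w.re|⁻¹ * ‖h + y‖ := by gcongr
        _ < 1 := by
          rw [inv_mul_lt_one₀ (abs_pos.2 hre), ← hw2]
          exact hhy.trans hεw
    have hyn : ‖y‖ ≤ ε := by
      lift ε to NNReal using hε.le
      have h1 : spectralRadius ℂ y ≤ ε :=
        iSup₂_le fun w hw => ENNReal.coe_le_coe.2 (hsp w hw)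
      rw [hysa.spectralRadius_eq_nnnorm] at h1
      exact ENNReal.coe_le_coe.1 h1
    calc ‖h‖ = ‖(h + y) - y‖ := by rw [add_sub_cancel_right]
      _ ≤ ‖h + y‖ + ‖y‖ := norm_sub_le _ _
      _ ≤ 0 + 2 * ε := by linarith
  refine norm_le_zero_iff.1 (le_of_forall_pos_le_add fun ε hε => ?_)
  have := key (ε / 2) (half_pos hε)
  linarith

end ClosedGraph

/-- Surjective additive maps between complex algebras which preserve the spectrum. -/
structure IsAdditiveSpectrumPreserving {A B : Type*} [Ring A] [Algebra ℂ A] [Ring B] [Algebra ℂ B]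
    (T : A → B) : Prop where
  surjective : Function.Surjective T
  map_add : ∀ x y, T (x + y) = T x + T y
  spectrum_eq : ∀ x, spectrum ℂ (T x) = spectrum ℂ x

namespace IsAdditiveSpectrumPreserving

open Filter Topology
open scoped Pointwise

section Algebra

variable {A B : Type*} [Ring A] [Algebra ℂ A] [Ring B] [Algebra ℂ B] {T : A → B}

theorem rotate (hT : IsAdditiveSpectrumPreserving T) {u : ℂ} (hu : u ≠ 0) :
    IsAdditiveSpectrumPreserving fun x => u⁻¹ • T (u • x) where
  surjective y := by
    obtain ⟨x, hx⟩ := hT.surjective (u • y)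
    exact ⟨u⁻¹ • x, by simp only [smul_inv_smul₀ hu, hx, inv_smul_smul₀ hu]⟩
  map_add x y := by rw [smul_add, hT.map_add, smul_add]
  spectrum_eq x := by
    have h1 := spectrum.unit_smul_eq_smul (T (u • x)) (Units.mk0 u hu)⁻¹
    have h2 := spectrum.unit_smul_eq_smul x (Units.mk0 u hu)
    rw [Units.smul_def, Units.val_inv_eq_inv_val, Units.val_mk0] at h1
    rw [Units.smul_def, Units.val_mk0] at h2
    rw [h1, hT.spectrum_eq, h2, inv_smul_smul]

theorem map_zero (hT : IsAdditiveSpectrumPreserving T) : T 0 = 0 := by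
  simpa using hT.map_add 0 0

theorem eq_zero_of_spectrum_add_eq (hT : IsAdditiveSpectrumPreserving T)
    (hA : ∀ x : A, (∀ y, spectrum ℂ (x + y) = spectrum ℂ y) → x = 0) {n : B}
    (hn : ∀ y, spectrum ℂ (n + y) = spectrum ℂ y) : n = 0 := by
  obtain ⟨x, rfl⟩ := hT.surjective n
  rw [hA x fun y => ?_, hT.map_zero]
  rw [← hT.spectrum_eq, hT.map_add, hn, hT.spectrum_eq]

theorem injective (hT : IsAdditiveSpectrumPreserving T)
    (hA : ∀ x : A, (∀ y, spectrum ℂ (x + y) = spectrum ℂ y) → x = 0) :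
    Function.Injective T := by
  refine (injective_iff_map_eq_zero (AddMonoidHom.mk' T hT.map_add)).2 fun x hx => hA x fun y => ?_
  have hx : T x = 0 := hx
  rw [← hT.spectrum_eq, hT.map_add, hx, zero_add, hT.spectrum_eq]

theorem map_one (hT : IsAdditiveSpectrumPreserving T)
    (hA : ∀ x : A, (∀ y, spectrum ℂ (x + y) = spectrum ℂ y) → x = 0) : T 1 = 1 := by
  refine sub_eq_zero.1 (hT.eq_zero_of_spectrum_add_eq hA fun y => ?_)
  obtain ⟨x, hx⟩ := hT.surjective (y - 1)
  have h1 : T 1 - 1 + y = T (1 + x) := by rw [hT.map_add, hx]; abel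
  have h2 : y = algebraMap ℂ B 1 + T x := by rw [hx, _root_.map_one]; abel
  rw [h1, hT.spectrum_eq, h2, ← spectrum.singleton_add_eq, hT.spectrum_eq,
    spectrum.singleton_add_eq, _root_.map_one]

end Algebra

theorem _root_.CStarAlgebra.eq_zero_of_spectrum_add_eq {A : Type*} [CStarAlgebra A] {x : A}
    (hx : ∀ y, spectrum ℂ (x + y) = spectrum ℂ y) : x = 0 := by
  nontriviality A
  have h0 : spectrum ℂ x = {0} := by simpa using hx 0
  have h1 : spectrum ℂ (star x) = {0} := by
    rw [spectrum.map_star, h0, Set.star_singleton, star_zero]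
  have h2 : x + star x = 0 := by
    have hsa : IsSelfAdjoint (x + star x) := IsSelfAdjoint.add_star_self x
    have : IsStarNormal (x + star x) := hsa.isStarNormal
    exact CFC.eq_zero_of_spectrum_subset_zero (R := ℂ) _ (by rw [hx, h1])
  have h3 : x + -star x = 0 := by
    have : IsStarNormal (x + -star x) := by
      refine ⟨?_⟩
      rw [star_add, star_neg, star_star, Commute, SemiconjBy]
      noncomm_ring
    refine CFC.eq_zero_of_spectrum_subset_zero (R := ℂ) _ ?_
    rw [hx, ← spectrum.neg_eq, h1]
    simp
  have h4 : (2 : ℂ) • x = 0 := by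
    rw [two_smul]
    calc x + x = (x + star x) + (x + -star x) := by abel
      _ = 0 := by rw [h2, h3, add_zero]
  simpa using h4

section CStar

variable {A B : Type*} [CStarAlgebra A] [Nontrivial A] [NormedRing B] [NormedAlgebra ℂ B]
  [CompleteSpace B] {T : A → B}

theorem eq_zero_of_tendsto
    (hrr0 : ∀ a : A, IsSelfAdjoint a → a ∈ closure {x : A | IsSelfAdjoint x ∧ IsUnit x})
    (hT : IsAdditiveSpectrumPreserving T) {x : ℕ → A} (hx : Tendsto x atTop (𝓝 0)) {d : B}
    (hd : Tendsto (fun n => T (x n)) atTop (𝓝 d)) : d = 0 := by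
  obtain ⟨z, rfl⟩ := hT.surjective d
  have h1 := realPart_eq_zero_of_spectrum_subset hrr0 fun y hy =>
    spectrum_subset_of_tendsto hT.map_add hT.spectrum_eq hx hd hy
  have hI : -Complex.I ≠ 0 := neg_ne_zero.2 Complex.I_ne_zero
  have hT' := hT.rotate hI
  have hII : ∀ a : A, -Complex.I • Complex.I • a = a := fun a => by
    rw [smul_smul]; simp
  have h2 := realPart_eq_zero_of_spectrum_subset hrr0 (z := Complex.I • z) fun y hy =>
    spectrum_subset_of_tendsto hT'.map_add hT'.spectrum_eq (x := fun n => Complex.I • x n)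
      (by simpa using hx.const_smul Complex.I)
      (by simpa only [hII] using hd.const_smul (-Complex.I)⁻¹) hy
  have hz : z = 0 := by
    rw [realPart_I_smul, NegMemClass.coe_neg, neg_eq_zero] at h2
    rw [← realPart_add_I_smul_imaginaryPart z, h1, h2, smul_zero, add_zero]
  rw [hz, hT.map_zero]

theorem map_real_smul
    (hrr0 : ∀ a : A, IsSelfAdjoint a → a ∈ closure {x : A | IsSelfAdjoint x ∧ IsUnit x})
    (hT : IsAdditiveSpectrumPreserving T) (t : ℝ) (x : A) : T (t • x) = t • T x := by
  obtain ⟨q, hq, hqt⟩ := mem_closure_iff_seq_limit.1 (Rat.denseRange_cast (𝕜 := ℝ) t)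
  choose r hr using hq
  obtain rfl : (fun n => (r n : ℝ)) = q := funext hr
  refine sub_eq_zero.1 (hT.eq_zero_of_tendsto hrr0 (x := fun n => (t - r n) • x) ?_ ?_)
  · simpa using (hqt.const_sub t).smul_const x
  · have h1 : ∀ n, T ((t - r n) • x) = T (t • x) - (r n : ℝ) • T x := fun n => by
      have h2 := (AddMonoidHom.mk' T hT.map_add).map_sub (t • x) ((r n : ℝ) • x)
      rw [map_ratCast_smul _ ℝ ℝ] at h2
      rw [sub_smul]
      exact h2
    simp only [h1]
    exact tendsto_const_nhds.sub (hqt.smul_const _)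

/-- A surjective additive spectrum preserving map on a C*-algebra of real rank zero is automatically
real-linear and continuous. -/
theorem exists_continuousLinearMap
    (hrr0 : ∀ a : A, IsSelfAdjoint a → a ∈ closure {x : A | IsSelfAdjoint x ∧ IsUnit x})
    (hT : IsAdditiveSpectrumPreserving T) : ∃ F : A →L[ℝ] B, ⇑F = T := by
  set f : A →ₗ[ℝ] B := ⟨⟨T, hT.map_add⟩, hT.map_real_smul hrr0⟩
  refine ⟨⟨f, f.continuous_of_seq_closed_graph fun u x y hu hy => ?_⟩, rfl⟩
  refine sub_eq_zero.1 (hT.eq_zero_of_tendsto hrr0 (x := fun n => u n - x) ?_ ?_)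
  · simpa using hu.sub_const x
  · have h1 : ∀ n, T (u n - x) = f (u n) - f x := fun n => f.map_sub (u n) x
    simp only [h1]
    exact hy.sub_const _

theorem isIdempotentElem_map_iff
    (hrr0 : ∀ a : A, IsSelfAdjoint a → a ∈ closure {x : A | IsSelfAdjoint x ∧ IsUnit x})
    (hT : IsAdditiveSpectrumPreserving T) {p : A} :
    IsIdempotentElem (T p) ↔ IsIdempotentElem p := by
  have hss : ∀ n : A, (∀ y, spectrum ℂ (n + y) = spectrum ℂ y) → n = 0 := fun _ =>
    CStarAlgebra.eq_zero_of_spectrum_add_eq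
  obtain ⟨F, rfl⟩ := hT.exists_continuousLinearMap hrr0
  have hinj := hT.injective hss
  constructor
  · intro hp
    have hl := Function.leftInverse_surjInv ⟨hinj, hT.surjective⟩
    have hr := Function.surjInv_eq hT.surjective
    have h1 := isIdempotentElem_map_of_spectrum_eq (S := Function.surjInv hT.surjective)
      (K := ‖F‖) (fun x y => hinj (by rw [hr, hT.map_add, hr, hr]))
      (fun x => by rw [← hT.spectrum_eq, hr]) (fun e => ⟨F e, hl e, F.le_opNorm e⟩) hss hp
    rwa [hl] at h1
  · intro hp
    obtain ⟨C, _, hC⟩ := F.exists_preimage_norm_le hT.surjective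
    exact isIdempotentElem_map_of_spectrum_eq hT.map_add hT.spectrum_eq hC
      (fun _ => hT.eq_zero_of_spectrum_add_eq hss) hp

end CStar

end IsAdditiveSpectrumPreserving

section Polarization

theorem sum_smul_mul_self_of_orthogonal {R ι : Type*} [Ring R] [Algebra ℝ R] {q : ι → R}
    (hq : ∀ i, IsIdempotentElem (q i)) (hqq : ∀ i j, i ≠ j → q i * q j = 0) (t : ι → ℝ)
    (s : Finset ι) :
    (∑ i ∈ s, t i • q i) * (∑ i ∈ s, t i • q i) = ∑ i ∈ s, (t i * t i) • q i := by
  rw [Finset.sum_mul]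
  refine Finset.sum_congr rfl fun i hi => ?_
  rw [Finset.mul_sum, Finset.sum_eq_single_of_mem i hi fun j _ hj => by
    rw [smul_mul_smul_comm, hqq i j hj.symm, smul_zero], smul_mul_smul_comm, (hq i).eq]

theorem polarization_of_isSelfAdjoint {A B : Type*} [Ring A] [StarRing A] [Algebra ℂ A]
    [StarModule ℂ A] [Ring B] [Algebra ℂ B] (F G H : A →ₗ[ℂ] B)
    (h : ∀ a, IsSelfAdjoint a → F (a * a) = G a * H a + H a * G a) (x y : A) :
    F (x * y + y * x) = G x * H y + H y * G x + (G y * H x + H x * G y) := by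
  have key : ∀ a b, IsSelfAdjoint a → IsSelfAdjoint b →
      F (a * b + b * a) = G a * H b + H b * G a + (G b * H a + H a * G b) := by
    intro a b ha hb
    have h1 := h (a + b) (ha.add hb)
    have h2 : (a + b) * (a + b) = a * a + (a * b + b * a) + b * b := by noncomm_ring
    rw [h2, map_add, map_add, h a ha, h b hb, map_add G, map_add H] at h1
    have h3 : F (a * b + b * a) = (G a + G b) * (H a + H b) + (H a + H b) * (G a + G b) -
        (G a * H a + H a * G a) - (G b * H b + H b * G b) := by rw [← h1]; abel
    rw [h3]; noncomm_ring
  rw [← realPart_add_I_smul_imaginaryPart x, ← realPart_add_I_smul_imaginaryPart y]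
  have h1 := key _ _ (realPart x).2 (realPart y).2
  have h2 := key _ _ (realPart x).2 (imaginaryPart y).2
  have h3 := key _ _ (imaginaryPart x).2 (realPart y).2
  have h4 := key _ _ (imaginaryPart x).2 (imaginaryPart y).2
  simp only [map_add, map_smul, mul_add, add_mul, smul_mul_assoc, mul_smul_comm] at h1 h2 h3 h4 ⊢
  linear_combination (norm := module) h1 + Complex.I • h2 + Complex.I • h3 +
    (Complex.I * Complex.I) • h4

end Polarization

namespace IsAdditiveSpectrumPreserving

open Filter Topology

variable {A B : Type*} [CStarAlgebra A] [Nontrivial A] [NormedRing B] [NormedAlgebra ℂ B]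
  [CompleteSpace B] {T : A → B}

theorem map_mul_self_of_isSelfAdjoint
    (hrr0 : ∀ a : A, IsSelfAdjoint a → a ∈ closure {x : A | IsSelfAdjoint x ∧ IsUnit x})
    (hT : IsAdditiveSpectrumPreserving T) {h : A} (hh : IsSelfAdjoint h) :
    T (h * h) = T h * T h := by
  obtain ⟨F, rfl⟩ := hT.exists_continuousLinearMap hrr0
  have hclosed : IsClosed {x : A | F (x * x) = F x * F x} := isClosed_eq (by fun_prop) (by fun_prop)
  refine hclosed.closure_subset (Metric.mem_closure_iff.2 fun ε hε => ?_)
  obtain ⟨s, t, p, -, hpi, hpp, hlt⟩ := exists_norm_sub_sum_smul_projection_lt hrr0 hh hε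
  refine ⟨_, ?_, by rwa [dist_eq_norm]⟩
  have hTi : ∀ k, IsIdempotentElem (F (p k)) := fun k =>
    (hT.isIdempotentElem_map_iff hrr0).2 (hpi k)
  have : IsAddTorsionFree B := .of_isTorsionFree ℂ B
  have hTp : ∀ j k, j ≠ k → F (p j) * F (p k) = 0 := fun j k hjk => by
    have h1 : IsIdempotentElem (p j + p k) :=
      (hpi j).add (hpi k) (by rw [hpp j k hjk, hpp k j hjk.symm, add_zero])
    rw [← hT.isIdempotentElem_map_iff hrr0, hT.map_add, (hTi j).add_iff (hTi k)] at h1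
    exact (hTi j).mul_eq_zero_of_anticommute h1
  rw [Set.mem_ofPred_eq, sum_smul_mul_self_of_orthogonal hpi hpp]
  simp only [map_sum, map_smul]
  rw [sum_smul_mul_self_of_orthogonal hTi hTp]

/-- The decomposition of a spectrum preserving map into a linear and a conjugate-linear part,
together with the Jordan relations between the two parts. -/
theorem exists_linear_add_linear_star
    (hrr0 : ∀ a : A, IsSelfAdjoint a → a ∈ closure {x : A | IsSelfAdjoint x ∧ IsUnit x})
    (hT : IsAdditiveSpectrumPreserving T) :
    ∃ L N : A →ₗ[ℂ] B, Continuous N ∧ (∀ x, T x = L x + N (star x)) ∧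
      ∀ h, IsSelfAdjoint h → L (h * h) = L h * L h ∧ N (h * h) = L h * N h + N h * L h ∧
        N h * N h = 0 := by
  obtain ⟨F, rfl⟩ := hT.exists_continuousLinearMap hrr0
  have hI := Complex.I_mul_I
  have hIx : ∀ x : A, Complex.I • Complex.I • x = -x := fun x => by
    rw [smul_smul, hI, neg_one_smul]
  have hc : ∀ (c : ℂ) (x : A), F (c • x) = (c.re : ℂ) • F x + (c.im : ℂ) • F (Complex.I • x) := by
    intro c x
    rw [Complex.coe_smul, Complex.coe_smul, ← map_smul, ← map_smul, ← F.map_add,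
      ← Complex.coe_smul, ← Complex.coe_smul, smul_smul, ← add_smul, Complex.re_add_im]
  let L : A →ₗ[ℂ] B :=
    { toFun := fun x => (1 / 2 : ℂ) • (F x - Complex.I • F (Complex.I • x))
      map_add' := fun x y => by simp only [smul_add, F.map_add]; module
      map_smul' := fun c x => by
        rw [smul_comm Complex.I c x, hc c, hc c, hIx, map_neg, RingHom.id_apply]
        conv_rhs => rw [← Complex.re_add_im c]
        linear_combination (norm := module) ((c.im / 2 : ℂ) * hI) • F (Complex.I • x) }
  let N : A →ₗ[ℂ] B :=
    { toFun := fun x => (1 / 2 : ℂ) • (F (star x) + Complex.I • F (Complex.I • star x))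
      map_add' := fun x y => by simp only [smul_add, star_add, F.map_add]; module
      map_smul' := fun c x => by
        rw [star_smul, smul_comm Complex.I (star c), hc, hc (star c), hIx, map_neg,
          RingHom.id_apply, Complex.star_def, Complex.conj_re, Complex.conj_im]
        conv_rhs => rw [← Complex.re_add_im c]
        push_cast
        linear_combination (norm := module) (-(c.im / 2 : ℂ) * hI) • F (Complex.I • star x) }
  have hL : ∀ x, L x = (1 / 2 : ℂ) • (F x - Complex.I • F (Complex.I • x)) := fun _ => rfl
  have hN : ∀ x, N x = (1 / 2 : ℂ) • (F (star x) + Complex.I • F (Complex.I • star x)) :=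
    fun _ => rfl
  refine ⟨L, N, ?_, fun x => ?_, fun h hh => ?_⟩
  · change Continuous fun x => (1 / 2 : ℂ) • (F (star x) + Complex.I • F (Complex.I • star x))
    fun_prop
  · rw [hL, hN, star_star]; module
  · have hI0 := Complex.I_ne_zero
    have h1I : (1 + Complex.I : ℂ) ≠ 0 := fun h0 => by simpa using congrArg Complex.im h0
    have hP := hT.map_mul_self_of_isSelfAdjoint hrr0 hh
    have hQ := (hT.rotate hI0).map_mul_self_of_isSelfAdjoint hrr0 hh
    have hR := (hT.rotate h1I).map_mul_self_of_isSelfAdjoint hrr0 hh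
    have hhh : star (h * h) = h * h := by rw [star_mul, hh.star_eq]
    simp only [hL, hN, hhh, hh.star_eq]
    simp only [smul_mul_smul_comm, add_smul, one_smul, F.map_add] at hP hQ hR
    rw [hP] at hR ⊢
    set P := F h
    set Q := F (Complex.I • h)
    have hQ' : F (Complex.I • (h * h)) = Complex.I⁻¹ • (Q * Q) := by
      rw [mul_smul, smul_right_inj (inv_ne_zero hI0)] at hQ
      exact hQ
    have hR' : F (Complex.I • (h * h)) = (1 + Complex.I)⁻¹ • ((P + Q) * (P + Q)) - P * P := by
      rw [mul_smul, smul_right_inj (inv_ne_zero h1I)] at hR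
      rw [← hR]; abel
    have hiI : Complex.I⁻¹ = -Complex.I := Complex.inv_I
    have hi1I : (1 + Complex.I)⁻¹ = (1 - Complex.I) / 2 := by
      field_simp
      linear_combination hI
    rw [hQ'] at hR' ⊢
    rw [hiI] at hR' ⊢
    rw [hi1I] at hR'
    have hPQ : P * Q + Q * P = Complex.I • (P * P) - Complex.I • (Q * Q) := by
      simp only [mul_add, add_mul] at hR'
      linear_combination (norm := module) (-(1 + Complex.I)) • hR' - hI • (Q * Q) +
        (1 / 2 * hI) • (P * P + P * Q + Q * P + Q * Q)
    simp only [mul_sub, sub_mul, mul_add, add_mul, smul_mul_assoc, mul_smul_comm]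
    refine ⟨?_, ?_, ?_⟩
    · linear_combination (norm := module) (1 / 4 * Complex.I) • hPQ + (1 / 4 * hI) • (P * P)
    · module
    · linear_combination (norm := module) (1 / 4 * Complex.I) • hPQ + (1 / 4 * hI) • (P * P)

/-- A surjective additive spectrum preserving map on a C*-algebra of real rank zero is
complex-linear and preserves squares. -/
theorem map_smul_and_map_mul_self
    (hrr0 : ∀ a : A, IsSelfAdjoint a → a ∈ closure {x : A | IsSelfAdjoint x ∧ IsUnit x})
    (hT : IsAdditiveSpectrumPreserving T) :
    (∀ (c : ℂ) (x : A), T (c • x) = c • T x) ∧ ∀ x, T (x * x) = T x * T x := by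
  obtain ⟨L, N, hNc, hLN, hsa⟩ := hT.exists_linear_add_linear_star hrr0
  have : IsAddTorsionFree A := .of_isTorsionFree ℂ A
  have : IsAddTorsionFree B := .of_isTorsionFree ℂ B
  have hL : ∀ x y, L (x * y + y * x) = L x * L y + L y * L x := fun x y => by
    have h := polarization_of_isSelfAdjoint L ((1 / 2 : ℂ) • L) L (fun a ha => by
      rw [(hsa a ha).1, LinearMap.smul_apply, smul_mul_assoc, mul_smul_comm]; module) x y
    rw [h]
    simp only [LinearMap.smul_apply, smul_mul_assoc, mul_smul_comm]
    module
  have hN : ∀ x y, N (x * y + y * x) = L x * N y + N y * L x + (L y * N x + N x * L y) :=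
    polarization_of_isSelfAdjoint N L N fun a ha => (hsa a ha).2.1
  have hinj := hT.injective fun _ => CStarAlgebra.eq_zero_of_spectrum_add_eq
  have hproj : ∀ p, IsSelfAdjoint p → IsIdempotentElem p → N p = 0 := by
    intro p hp hpi
    obtain ⟨hl, hw, hww⟩ := hsa p hp
    rw [hpi.eq] at hl hw
    obtain ⟨u, hu⟩ := hT.surjective (N p)
    have hTp : T p = L p + N p := by rw [hLN, hp.star_eq]
    have hadd : IsIdempotentElem (p + u) := by
      rw [← hT.isIdempotentElem_map_iff hrr0, hT.map_add, hTp, hu]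
      generalize L p = l at *
      generalize N p = w at *
      have : (l + w + w) * (l + w + w) = l * l + ((l * w + w * l) + (l * w + w * l)) +
        (w * w + w * w + (w * w + w * w)) := by noncomm_ring
      rw [IsIdempotentElem, this, ← hl, ← hw, hww]; abel
    have hsub : IsIdempotentElem (p - u) := by
      have h1 : T (p - u) + T u = T p := by rw [← hT.map_add, sub_add_cancel]
      rw [← hT.isIdempotentElem_map_iff hrr0, eq_sub_of_add_eq h1, hTp, hu, add_sub_cancel_right]
      exact hl.symm
    have huu : u * u = 0 := by
      have h1 : (p + u) * (p + u) + (p - u) * (p - u) = 2 • (p * p) + 2 • (u * u) := by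
        noncomm_ring
      rw [hadd.eq, hsub.eq, hpi.eq] at h1
      have h2 : 2 • (u * u) = 0 := by rw [← add_right_inj (2 • p), ← h1]; abel
      exact (smul_eq_zero_iff_right two_ne_zero).1 h2
    have hpu : p * u + u * p = u := by
      have h1 := hadd.eq
      rw [add_mul, mul_add, mul_add, hpi.eq, huu, add_zero, add_assoc] at h1
      exact add_left_cancel h1
    have hstar : p * star u + star u * p = star u := by
      have h1 := congrArg star hpu
      rw [star_add, star_mul, star_mul, hp.star_eq] at h1
      rw [add_comm, h1]
    have hsuu : star u * star u = 0 := by rw [← star_mul, huu, star_zero]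
    have hU := hL p u
    have hD := hN p (star u)
    have hYD := hN (star u) (star u)
    rw [hpu] at hU
    rw [hstar] at hD
    rw [hsuu, add_zero, _root_.map_zero, ← two_nsmul, eq_comm,
      smul_eq_zero_iff_right two_ne_zero] at hYD
    have hLg : L (u * star u + star u * u) = 0 := by
      have h1 : N p = L u + N (star u) := by rw [← hu, hLN]
      rw [hL]
      generalize L p = l at *
      generalize N p = w at *
      generalize L u = U at *
      generalize L (star u) = Y at *
      generalize N (star u) = D at *
      subst h1
      linear_combination (norm := noncomm_ring) hw - hU - hD - hYD
    have hg : IsSelfAdjoint (u * star u + star u * u) :=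
      (IsSelfAdjoint.mul_star_self u).add (IsSelfAdjoint.star_mul_self u)
    have hg0 : u * star u + star u * u = 0 := by
      obtain ⟨h1, h2, -⟩ := hsa _ hg
      rw [hLg] at h1 h2
      rw [← CStarRing.star_mul_self_eq_zero_iff, hg.star_eq]
      refine hinj ?_
      rw [hLN, star_mul, hg.star_eq, h1, h2, hT.map_zero]
      simp
    have hu0 : u = 0 := by
      rw [← CStarRing.star_mul_self_eq_zero_iff, ← CStarRing.star_mul_self_eq_zero_iff]
      calc star (star u * u) * (star u * u) = star u * (u * (u * star u + star u * u)) -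
            star u * (u * u) * star u := by rw [star_mul, star_star]; noncomm_ring
        _ = 0 := by rw [hg0, huu]; simp
    rw [← hu, hu0, hT.map_zero]
  have hNsa : ∀ a, IsSelfAdjoint a → N a = 0 := by
    intro a ha
    have hclosed : IsClosed {x : A | N x = 0} := isClosed_eq hNc continuous_const
    refine hclosed.closure_subset (Metric.mem_closure_iff.2 fun ε hε => ?_)
    obtain ⟨s, t, p, hps, hpi, -, hlt⟩ := exists_norm_sub_sum_smul_projection_lt hrr0 ha hε
    refine ⟨_, ?_, by rwa [dist_eq_norm]⟩
    rw [Set.mem_ofPred_eq, map_sum]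
    refine Finset.sum_eq_zero fun k _ => ?_
    rw [← Complex.coe_smul, map_smul, hproj _ (hps k) (hpi k), smul_zero]
  have hTL : ∀ x, T x = L x := fun x => by
    rw [hLN, ← realPart_add_I_smul_imaginaryPart (star x), _root_.map_add, map_smul,
      hNsa _ (realPart _).2, hNsa _ (imaginaryPart _).2, smul_zero, add_zero, add_zero]
  refine ⟨fun c x => by rw [hTL, hTL, map_smul], fun x => ?_⟩
  have h := hL x x
  rw [_root_.map_add, ← two_nsmul, ← two_nsmul] at h
  rw [hTL, hTL]
  exact (smul_right_inj two_ne_zero).1 h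

end IsAdditiveSpectrumPreserving

/-- Every surjective additive spectrum preserving mapping from a unital C*-algebra of
real rank zero onto a complex unital Banach algebra is a Jordan isomorphism. -/
theorem additive_spectrum_preserving_from_realRankZero_is_jordan_iso
    {A : Type*} [NormedRing A] [StarRing A] [CStarRing A] [NormedAlgebra ℂ A]
    [CompleteSpace A] [StarModule ℂ A]
    (hrr0 : ∀ a : A, IsSelfAdjoint a → a ∈ closure {x : A | IsSelfAdjoint x ∧ IsUnit x})
    {B : Type*} [NormedRing B] [NormedAlgebra ℂ B] [CompleteSpace B]
    (T : A → B)
    (hsurj : Function.Surjective T)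
    (hadd : ∀ x y : A, T (x + y) = T x + T y)
    (hspec : ∀ x : A, spectrum ℂ (T x) = spectrum ℂ x) :
    Function.Bijective T ∧
      (∀ (c : ℂ) (x : A), T (c • x) = c • T x) ∧
      T 1 = 1 ∧
      ∀ x : A, T (x * x) = T x * T x := by
  let : CStarAlgebra A := {}
  rcases subsingleton_or_nontrivial A with hA | hA
  · have : Subsingleton B := hsurj.subsingleton
    exact ⟨⟨Function.injective_of_subsingleton T, hsurj⟩, fun _ _ => Subsingleton.elim _ _,
      Subsingleton.elim _ _, fun _ => Subsingleton.elim _ _⟩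
  · have hT : IsAdditiveSpectrumPreserving T := ⟨hsurj, hadd, hspec⟩
    have hA0 := fun x : A => CStarAlgebra.eq_zero_of_spectrum_add_eq (x := x)
    obtain ⟨hsmul, hsq⟩ := hT.map_smul_and_map_mul_self hrr0
    exact ⟨⟨hT.injective hA0, hsurj⟩, hsmul, hT.map_one hA0, hsq⟩
end

section
/- Let A and B be complex unital Banach algebras with A semisimple, and let T : A → B be a surjective map such that r(x + y) = r(Tx + Ty) for all x, y ∈ A, where r denotes the spectral radius. Then B is semisimple and Z(B) = T(Z(A)), where Z denotes the centre. -/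
open Filter Topology
open scoped NNReal

theorem isUnit_one_sub_of_mem_jacobson_bot {R : Type*} [Ring R] {j : R}
    (hj : j ∈ Ideal.jacobson (⊥ : Ideal R)) : IsUnit (1 - j) := by
  have left_inv {i : R} (hi : i ∈ Ideal.jacobson (⊥ : Ideal R)) : ∃ z, z * (1 - i) = 1 := by
    obtain ⟨z, hz⟩ := Ideal.mem_jacobson_iff.1 hi (-1)
    rw [Ideal.mem_bot, sub_eq_zero] at hz
    exact ⟨z, by nth_rewrite 2 [← hz]; noncomm_ring⟩
  obtain ⟨z, hz⟩ := left_inv hj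
  obtain ⟨w, hw⟩ := left_inv (Ideal.mul_mem_left _ (-z) hj)
  have hz' : 1 - -z * j = z := by
    rw [mul_sub, mul_one, sub_eq_iff_eq_add] at hz
    rw [neg_mul, sub_neg_eq_add, hz.symm]
  rw [hz'] at hw
  have : w = 1 - j := left_inv_eq_right_inv hw hz
  exact ⟨⟨1 - j, z, this ▸ hw, hz⟩, rfl⟩

theorem Ideal.IsMaximal.isClosed_of_normedRing {A : Type*} [NormedRing A] [CompleteSpace A]
    {L : Ideal A} (hL : L.IsMaximal) :
    IsClosed (L : Set A) := by
  have hsub : closure (L : Set A) ⊆ nonunits A :=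
    closure_minimal (fun x hx hu => hL.ne_top (L.eq_top_of_isUnit_mem hx hu)) nonunits.isClosed
  have hne : L.closure ≠ ⊤ := fun h =>
    hsub (show (1 : A) ∈ L.closure from h ▸ Submodule.mem_top) isUnit_one
  have heq : L = L.closure := hL.eq_of_le hne subset_closure
  rw [heq]
  exact isClosed_closure

theorem Ideal.IsMaximal.comap_mul_right {R : Type*} [Ring R] {L : Ideal R} (hL : L.IsMaximal)
    {y : R} (hy : y ∉ L) :
    Ideal.IsMaximal (Submodule.comap (LinearMap.toSpanSingleton R R y) L : Ideal R) := by
  rw [Ideal.isMaximal_iff]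
  refine ⟨by simpa using hy, fun J x hJ hx hxJ => ?_⟩
  obtain ⟨z, i, hi, hz⟩ := hL.exists_inv (x := x * y) hx
  have hmem : 1 - y * z * x ∈ J := by
    refine hJ ?_
    have : (1 - y * z * x) * y = y * i := by
      rw [← sub_eq_iff_eq_add'.2 hz.symm]; noncomm_ring
    simpa [this] using L.mul_mem_left y hi
  simpa using J.add_mem hmem (J.mul_mem_left (y * z) hxJ)

section SpectralRadius

variable {A : Type*} [NormedRing A] [NormedAlgebra ℂ A]

theorem nnnorm_le_spectralRadius {a : A} {k : ℂ} (hk : k ∈ spectrum ℂ a) :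
    (‖k‖₊ : ENNReal) ≤ spectralRadius ℂ a :=
  le_iSup₂ (f := fun k (_ : k ∈ spectrum ℂ a) => (‖k‖₊ : ENNReal)) k hk

theorem spectralRadius_add_le_of_mem_jacobson_bot {b : A}
    (hb : b ∈ Ideal.jacobson (⊥ : Ideal A)) (y : A) :
    spectralRadius ℂ (b + y) ≤ spectralRadius ℂ y := by
  refine biSup_mono fun k hk => ?_
  contrapose! hk
  rw [spectrum.notMem_iff] at hk ⊢
  obtain ⟨v, hv⟩ := hk
  have : algebraMap ℂ A k - (b + y) = v * (1 - ↑v⁻¹ * b) := by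
    rw [mul_sub, mul_one, Units.mul_inv_cancel_left, hv]; abel
  rw [this]
  exact v.isUnit.mul (isUnit_one_sub_of_mem_jacobson_bot (Ideal.mul_mem_left _ _ hb))

theorem spectralRadius_add_of_mem_jacobson_bot {b : A}
    (hb : b ∈ Ideal.jacobson (⊥ : Ideal A)) (y : A) :
    spectralRadius ℂ (b + y) = spectralRadius ℂ y := by
  refine (spectralRadius_add_le_of_mem_jacobson_bot hb y).antisymm ?_
  simpa using spectralRadius_add_le_of_mem_jacobson_bot (neg_mem hb) (b + y)

theorem spectralRadius_units_conjugate (u : Aˣ) (x : A) :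
    spectralRadius ℂ (u * x * ↑u⁻¹) = spectralRadius ℂ x := by
  rw [spectralRadius, spectrum.units_conjugate, spectralRadius]

theorem Ideal.IsMaximal.mul_mem_of_spectralRadius_commutator_eq_zero {L : Ideal A}
    (hL : L.IsMaximal) {a : A} (h : ∀ u : A, spectralRadius ℂ (a * u - u * a) = 0) :
    ∀ x ∈ L, x * a ∈ L := by
  by_contra! hex
  obtain ⟨l, hl, hla⟩ := hex
  obtain ⟨z, i, hi, hz⟩ := hL.exists_inv hla
  have hmem : (-1 : ℂ) ∈ spectrum ℂ (a * (z * l) - z * l * a) := by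
    rw [spectrum.mem_iff]
    refine fun hu => hL.ne_top (L.eq_top_of_isUnit_mem ?_ hu)
    have : algebraMap ℂ A (-1) - (a * (z * l) - z * l * a) = -(i + a * z * l) := by
      rw [map_neg, map_one, ← hz]; noncomm_ring
    rw [this]
    exact neg_mem (L.add_mem hi (L.mul_mem_left _ hl))
  simpa [h] using nnnorm_le_spectralRadius hmem

theorem spectralRadius_smul {k : ℂ} (hk : k ≠ 0) (x : A) :
    spectralRadius ℂ (k • x) = ‖k‖₊ * spectralRadius ℂ x := by
  rw [spectralRadius, spectralRadius, ← Units.smul_mk0 hk, spectrum.unit_smul_eq_smul,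
    ← Set.image_smul, iSup_image]
  simp [Units.smul_def, ENNReal.mul_iSup]

theorem spectralRadius_neg (x : A) : spectralRadius ℂ (-x) = spectralRadius ℂ x := by
  simpa using spectralRadius_smul (neg_ne_zero.2 one_ne_zero) x

theorem spectralRadius_add_self (x : A) :
    spectralRadius ℂ (x + x) = 2 * spectralRadius ℂ x := by
  rw [← two_smul ℂ, spectralRadius_smul two_ne_zero]
  simp

variable [CompleteSpace A]

theorem spectralRadius_le_of_norm_pow_le {x : A} {C : ℝ} {p : ℝ≥0}
    (h : ∀ n : ℕ, ‖x ^ n‖ ≤ C * p ^ n) : spectralRadius ℂ x ≤ p := by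
  refine iSup₂_le fun k hk => ?_
  rw [ENNReal.coe_le_coe, ← NNReal.coe_le_coe, coe_nnnorm]
  by_contra! hlt
  have hk0 : 0 < ‖k‖ := p.coe_nonneg.trans_lt hlt
  have hbound (n : ℕ) : 1 ≤ C * ‖(1 : A)‖ * (p / ‖k‖) ^ n := by
    have h1 := spectrum.norm_le_norm_mul_of_mem (spectrum.pow_mem_pow x n hk)
    rw [norm_pow] at h1
    rw [div_pow, ← mul_div_assoc, le_div_iff₀ (pow_pos hk0 n), one_mul]
    calc ‖k‖ ^ n ≤ ‖x ^ n‖ * ‖(1 : A)‖ := h1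
      _ ≤ C * p ^ n * ‖(1 : A)‖ := by gcongr; exact h n
      _ = _ := by ring
  have hlim : Tendsto (fun n : ℕ => C * ‖(1 : A)‖ * (p / ‖k‖) ^ n) atTop (𝓝 0) := by
    simpa using (tendsto_pow_atTop_nhds_zero_of_lt_one (by positivity)
      ((div_lt_one hk0).2 hlt)).const_mul (C * ‖(1 : A)‖)
  exact absurd (ge_of_tendsto' hlim hbound) (by norm_num)

theorem eventually_norm_pow_lt_of_spectralRadius_lt {x : A} {p : ℝ≥0}
    (h : spectralRadius ℂ x < p) : ∀ᶠ n : ℕ in atTop, ‖x ^ n‖ < (p : ℝ) ^ n := by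
  have hlim := spectrum.pow_nnnorm_pow_one_div_tendsto_nhds_spectralRadius x
  filter_upwards [hlim.eventually_lt_const h, eventually_gt_atTop 0] with n hn hn0
  rw [one_div, ENNReal.rpow_inv_lt_iff (by exact_mod_cast hn0), ENNReal.rpow_natCast] at hn
  exact_mod_cast hn

theorem exists_norm_pow_le_of_spectralRadius_lt {x : A} {p : ℝ≥0}
    (h : spectralRadius ℂ x < p) : ∃ C : ℝ, ∀ n : ℕ, ‖x ^ n‖ ≤ C * p ^ n := by
  have hp : 0 < p := by
    rw [← ENNReal.coe_pos]; exact pos_of_gt h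
  have hb : IsBoundedUnder (· ≤ ·) atTop fun n : ℕ => ‖x ^ n‖ / (p : ℝ) ^ n := by
    refine isBoundedUnder_of_eventually_le (a := 1) ?_
    filter_upwards [eventually_norm_pow_lt_of_spectralRadius_lt h] with n hn
    exact (div_le_one (by positivity)).2 hn.le
  obtain ⟨C, hC⟩ := hb.bddAbove_range
  refine ⟨C, fun n => ?_⟩
  rw [← div_le_iff₀ (by positivity)]
  exact hC ⟨n, rfl⟩

theorem spectralRadius_lt_top (x : A) : spectralRadius ℂ x < ⊤ := by
  refine lt_of_le_of_lt (spectralRadius_le_of_norm_pow_le (C := ‖(1 : A)‖ + 1) (p := ‖x‖₊)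
    fun n => ?_) ENNReal.coe_lt_top
  rcases n.eq_zero_or_pos with rfl | hn
  · simp
  · calc ‖x ^ n‖ ≤ 1 * ‖x‖ ^ n := by simpa using norm_pow_le' x hn
      _ ≤ _ := by rw [coe_nnnorm]; gcongr; linarith [norm_nonneg (1 : A)]

theorem Commute.spectralRadius_add_le {x y : A} (hxy : Commute x y) :
    spectralRadius ℂ (x + y) ≤ spectralRadius ℂ x + spectralRadius ℂ y := by
  refine ENNReal.le_of_forall_pos_le_add fun ε hε _ => ?_
  have key {z : A} : ∃ p : ℝ≥0, (p : ENNReal) = spectralRadius ℂ z + (ε / 2 : ℝ≥0) ∧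
      ∃ C : ℝ, ∀ n : ℕ, ‖z ^ n‖ ≤ C * p ^ n := by
    have hz := spectralRadius_lt_top z
    refine ⟨(spectralRadius ℂ z).toNNReal + ε / 2, ?_, exists_norm_pow_le_of_spectralRadius_lt ?_⟩
    · rw [ENNReal.coe_add, ENNReal.coe_toNNReal hz.ne]
    · rw [ENNReal.coe_add, ENNReal.coe_toNNReal hz.ne]
      exact ENNReal.lt_add_right hz.ne (by simpa using hε.ne')
  obtain ⟨p, hp, C, hC⟩ := key (z := x)
  obtain ⟨q, hq, D, hD⟩ := key (z := y)
  have hsum : spectralRadius ℂ x + spectralRadius ℂ y + ε = ((p + q : ℝ≥0) : ENNReal) := by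
    have hε2 : (ε : ENNReal) = (ε / 2 : ℝ≥0) + (ε / 2 : ℝ≥0) := by
      rw [← ENNReal.coe_add, add_halves]
    rw [ENNReal.coe_add, hp, hq, hε2]
    ring
  rw [hsum]
  have hC0 : 0 ≤ C := by simpa using (norm_nonneg _).trans (hC 0)
  refine spectralRadius_le_of_norm_pow_le (C := C * D) fun n => ?_
  rw [NNReal.coe_add, hxy.add_pow, (Commute.all (p : ℝ) q).add_pow, Finset.mul_sum]
  refine (norm_sum_le _ _).trans (Finset.sum_le_sum fun i _ => ?_)
  calc ‖x ^ i * y ^ (n - i) * n.choose i‖ ≤ n.choose i * ‖x ^ i * y ^ (n - i)‖ := by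
        rw [← nsmul_eq_mul']; exact norm_nsmul_le
    _ ≤ n.choose i * ((C * p ^ i) * (D * q ^ (n - i))) := by
        gcongr
        exact (norm_mul_le _ _).trans
          (mul_le_mul (hC i) (hD _) (norm_nonneg _) (by positivity))
    _ = _ := by ring

/-- A maximum principle for the spectral radius of an entire function, after Vesentini. -/
theorem spectralRadius_le_of_forall_mem_sphere_lt {F : ℂ → A} (hF : Differentiable ℂ F)
    {R : ℝ} (hR : 0 < R) {p : ℝ≥0}
    (h : ∀ z ∈ Metric.sphere (0 : ℂ) R, spectralRadius ℂ (F z) < p) :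
    spectralRadius ℂ (F 0) ≤ p := by
  obtain ⟨k, hk⟩ := (isCompact_sphere (0 : ℂ) R).elim_directed_cover
    (fun k : ℕ => {z | ‖F z ^ 2 ^ k‖ < (p : ℝ) ^ 2 ^ k})
    (fun k => isOpen_lt (hF.continuous.pow _).norm continuous_const)
    (fun z hz => by
      have := (tendsto_pow_atTop_atTop_of_one_lt one_lt_two).eventually
        (eventually_norm_pow_lt_of_spectralRadius_lt (h z hz))
      simpa using this.exists)
    (directed_of_isDirected_le <| monotone_nat_of_le_succ fun k z hz => by
      have hz' : ‖F z ^ 2 ^ k‖ < (p : ℝ) ^ 2 ^ k := hz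
      change ‖F z ^ 2 ^ (k + 1)‖ < (p : ℝ) ^ 2 ^ (k + 1)
      rw [pow_succ 2 k, pow_mul, pow_mul]
      exact (norm_pow_le' _ two_pos).trans_lt (pow_lt_pow_left₀ hz' (norm_nonneg _) two_ne_zero))
  have h0 : ‖F 0 ^ 2 ^ k‖ ≤ (p : ℝ) ^ 2 ^ k := by
    refine Complex.norm_le_of_forall_mem_frontier_norm_le (f := fun z => F z ^ 2 ^ k)
      (U := Metric.ball 0 R) Metric.isBounded_ball
      (hF.pow _).diffContOnCl (fun z hz => ?_) (subset_closure (Metric.mem_ball_self hR))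
    rw [frontier_ball _ hR.ne'] at hz
    exact (hk hz).le
  have h1 : spectralRadius ℂ (F 0 ^ 2 ^ k) ≤ (p ^ 2 ^ k : ℝ≥0) := by
    refine spectralRadius_le_of_norm_pow_le (C := ‖(1 : A)‖ + 1) fun n => ?_
    rcases n.eq_zero_or_pos with rfl | hn
    · simp
    · calc _ ≤ 1 * ‖F 0 ^ 2 ^ k‖ ^ n := by simpa using norm_pow_le' _ hn
        _ ≤ _ := by
          push_cast
          gcongr
          linarith [norm_nonneg (1 : A)]
  have h2 := (spectrum.spectralRadius_pow_le (𝕜 := ℂ) (F 0) (2 ^ k) (by positivity)).trans h1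
  rw [ENNReal.coe_pow] at h2
  exact (ENNReal.pow_le_pow_left_iff (by positivity)).1 h2

theorem spectralRadius_commutator_eq_zero {a : A}
    (h : ∀ x : A, spectralRadius ℂ (a + x) ≤ spectralRadius ℂ a + spectralRadius ℂ x) (u : A) :
    spectralRadius ℂ (a * u - u * a) = 0 := by
  let _ : NormedAlgebra ℚ A := NormedAlgebra.restrictScalars ℚ ℂ A
  let f : ℂ → A := fun z => a - NormedSpace.exp (z • u) * a * NormedSpace.exp (-z • u)
  have hder (z : ℂ) : HasDerivAt (fun z : ℂ => NormedSpace.exp (-z • u))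
      (-(NormedSpace.exp (-z • u) * u)) z := by
    convert! (hasDerivAt_exp_smul_const (𝕂 := ℂ) u (-z)).scomp z (hasDerivAt_neg z) using 1
    simp
  have hf (z : ℂ) : HasDerivAt f (-(NormedSpace.exp (z • u) * u * a * NormedSpace.exp (-z • u) +
      NormedSpace.exp (z • u) * a * -(NormedSpace.exp (-z • u) * u))) z :=
    (((hasDerivAt_exp_smul_const (𝕂 := ℂ) u z).mul_const a).mul (hder z)).const_sub a
  have hf0 : f 0 = 0 := by simp [f]
  have hr (z : ℂ) : spectralRadius ℂ (f z) ≤ 2 * spectralRadius ℂ a := by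
    let v : Aˣ := ⟨NormedSpace.exp (z • u), NormedSpace.exp (-z • u), by
      rw [← NormedSpace.exp_add_of_commute (by simp)]; simp, by
      rw [← NormedSpace.exp_add_of_commute (by simp)]; simp⟩
    have hv : f z = a + -(v * a * ↑v⁻¹) := by
      rw [← sub_eq_add_neg]; rfl
    rw [hv, two_mul]
    refine (h _).trans_eq ?_
    rw [spectralRadius_neg, spectralRadius_units_conjugate]
  have hF : Differentiable ℂ (dslope f 0) := by
    rw [← differentiableOn_univ, Complex.differentiableOn_dslope univ_mem]
    exact fun z _ => (hf z).differentiableAt.differentiableWithinAt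
  have hF0 : dslope f 0 0 = a * u - u * a := by
    rw [dslope_same, (hf 0).deriv]
    simp
    abel
  rw [← hF0, ← nonpos_iff_eq_zero]
  refine ENNReal.le_of_forall_pos_le_add fun p hp _ => ?_
  rw [zero_add]
  have hM := spectralRadius_lt_top a
  lift spectralRadius ℂ a to ℝ≥0 using hM.ne with M
  refine spectralRadius_le_of_forall_mem_sphere_lt hF (R := (2 * M / p + 1 : ℝ≥0))
    (by positivity) fun z hz => ?_
  have hzR : ‖z‖₊ = 2 * M / p + 1 := NNReal.eq (by simpa using hz)
  have hz0 : z ≠ 0 := nnnorm_pos.1 (hzR ▸ by positivity)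
  have hslope : dslope f 0 z = z⁻¹ • f z := by
    rw [dslope_of_ne _ hz0, slope_def_module, hf0, sub_zero, sub_zero]
  rw [hslope, spectralRadius_smul (inv_ne_zero hz0), nnnorm_inv]
  calc _ ≤ ((‖z‖₊⁻¹ : ℝ≥0) : ENNReal) * (2 * M) := by gcongr; exact hr z
    _ = ((‖z‖₊⁻¹ * (2 * M) : ℝ≥0) : ENNReal) := by push_cast; rfl
    _ < p := by
      rw [ENNReal.coe_lt_coe, inv_mul_lt_iff₀ (nnnorm_pos.2 hz0), hzR, add_mul, one_mul,
        div_mul_cancel₀ _ hp.ne']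
      exact lt_add_of_pos_right _ hp

/-- Schur's lemma for the irreducible module `A ⧸ L`: right multiplication by an element that
normalizes the maximal left ideal `L` acts as a scalar modulo `L`. -/
theorem Ideal.IsMaximal.exists_mul_sub_smul_mem {L : Ideal A} (hL : L.IsMaximal) {a : A}
    (ha : ∀ x ∈ L, x * a ∈ L) : ∃ μ : ℂ, ∀ x, x * a - μ • x ∈ L := by
  have hclosed : IsClosed (L : Set A) := hL.isClosed_of_normedRing
  have hsimple : IsSimpleModule A (A ⧸ L) :=
    isSimpleModule_iff_isCoatom.2 (Ideal.isMaximal_def.1 hL)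
  have : Nontrivial (A ⧸ L) := IsSimpleModule.nontrivial A _
  let R : A ⧸ L →ₗ[A] A ⧸ L := L.mapQ L (LinearMap.toSpanSingleton A A a) ha
  have hRcont : Continuous (R.restrictScalars ℂ) := by
    refine continuous_quot_lift _ ?_
    exact continuous_quotient_mk'.comp (continuous_id.mul continuous_const)
  let S : A ⧸ L →L[ℂ] A ⧸ L := ⟨R.restrictScalars ℂ, hRcont⟩
  obtain ⟨μ, hμ⟩ := spectrum.nonempty S
  refine ⟨μ, fun x => ?_⟩
  let Q : A ⧸ L →ₗ[A] A ⧸ L := R - μ • LinearMap.id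
  rcases Q.bijective_or_eq_zero with hQ | hQ
  · refine absurd (IsUnit.sub_iff.1 ?_) (spectrum.mem_iff.1 hμ)
    exact ContinuousLinearMap.isUnit_iff_bijective.2 hQ
  · have := LinearMap.congr_fun hQ (Submodule.Quotient.mk x)
    rw [← Submodule.Quotient.mk_eq_zero L]
    exact this

theorem commutator_mem_jacobson_bot {a : A}
    (h : ∀ u : A, spectralRadius ℂ (a * u - u * a) = 0) (y : A) :
    a * y - y * a ∈ Ideal.jacobson (⊥ : Ideal A) := by
  rw [Ideal.jacobson, Ideal.mem_sInf]
  rintro L ⟨-, hL⟩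
  have hinv := hL.mul_mem_of_spectralRadius_commutator_eq_zero h
  have eigen {w : A} (hw : w ∉ L) : ∃ μ : ℂ, a * w - μ • w ∈ L := by
    have hLw := hL.comap_mul_right hw
    obtain ⟨μ, hμ⟩ := hLw.exists_mul_sub_smul_mem
      (hLw.mul_mem_of_spectralRadius_commutator_eq_zero h)
    exact ⟨μ, by simpa [sub_mul] using hμ 1⟩
  have of_scalar {κ : ℂ} (hκ : y - κ • 1 ∈ L) : a * y - y * a ∈ L := by
    have := L.sub_mem (L.mul_mem_left a hκ) (hinv _ hκ)
    simpa [mul_sub, sub_mul] using this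
  by_cases hy : ∃ κ : ℂ, y - κ • 1 ∈ L
  · exact hy.elim fun _ => of_scalar
  push Not at hy
  obtain ⟨c, hc⟩ := hL.exists_mul_sub_smul_mem hinv
  obtain ⟨μ, hμ⟩ := eigen (w := y) (by simpa using hy 0)
  obtain ⟨ν, hν⟩ := eigen (w := 1 + y) (by simpa [add_comm] using hy (-1))
  have hcomb : (c - ν) • (1 : A) + (μ - ν) • y ∈ L := by
    convert L.sub_mem hν (L.add_mem (hc 1) hμ) using 1
    simp only [mul_add, smul_add, sub_smul, mul_one, one_mul]
    abel
  have hμν : μ = ν := by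
    by_contra hne
    have h0 : μ - ν ≠ 0 := sub_ne_zero.2 hne
    refine hy (-((μ - ν)⁻¹ * (c - ν))) ?_
    convert! (L.restrictScalars ℂ).smul_mem (μ - ν)⁻¹ hcomb using 1
    rw [smul_add, smul_smul, smul_smul, inv_mul_cancel₀ h0, one_smul, neg_smul, sub_neg_eq_add,
      add_comm]
  have hcν : c = ν := by
    by_contra hne
    have h0 : c - ν ≠ 0 := sub_ne_zero.2 hne
    rw [hμν, sub_self, zero_smul, add_zero] at hcomb
    have := (L.restrictScalars ℂ).smul_mem (c - ν)⁻¹ hcomb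
    rw [smul_smul, inv_mul_cancel₀ h0, one_smul] at this
    exact hL.ne_top ((Ideal.eq_top_iff_one L).2 this)
  rw [hμν, ← hcν] at hμ
  simpa using L.sub_mem hμ (hc y)

theorem mem_jacobson_bot_of_mem_center {a : A} (ha : a ∈ Set.center A)
    (hr : spectralRadius ℂ a = 0) : a ∈ Ideal.jacobson (⊥ : Ideal A) := by
  rw [Ideal.jacobson, Ideal.mem_sInf]
  rintro L ⟨-, hL⟩
  obtain ⟨μ, hμ⟩ := hL.exists_mul_sub_smul_mem (a := a) fun x hx => by
    rw [Semigroup.mem_center_iff.1 ha x]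
    exact L.mul_mem_left a hx
  have hmem : μ ∈ spectrum ℂ a := by
    rw [spectrum.mem_iff, IsUnit.sub_iff]
    refine fun hu => hL.ne_top (L.eq_top_of_isUnit_mem ?_ hu)
    simpa [Algebra.algebraMap_eq_smul_one] using hμ 1
  have hμ0 : μ = 0 := by simpa [hr] using nnnorm_le_spectralRadius hmem
  simpa [hμ0] using hμ 1

theorem mem_center_of_forall_spectralRadius_add_le
    (hA : Ideal.jacobson (⊥ : Ideal A) = ⊥) {a : A}
    (h : ∀ x : A, spectralRadius ℂ (a + x) ≤ spectralRadius ℂ a + spectralRadius ℂ x) :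
    a ∈ Set.center A := by
  refine Semigroup.mem_center_iff.2 fun y => ?_
  have := commutator_mem_jacobson_bot (spectralRadius_commutator_eq_zero h) y
  rw [hA, Ideal.mem_bot, sub_eq_zero] at this
  exact this.symm

/-- In a semisimple complex Banach algebra, the centre consists of the elements along which the
spectral radius is subadditive. -/
theorem mem_center_iff_forall_spectralRadius_add_le
    (hA : Ideal.jacobson (⊥ : Ideal A) = ⊥) {a : A} :
    a ∈ Set.center A ↔
      ∀ x : A, spectralRadius ℂ (a + x) ≤ spectralRadius ℂ a + spectralRadius ℂ x :=
  ⟨fun ha x => Commute.spectralRadius_add_le (Semigroup.mem_center_iff.1 ha x).symm,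
    mem_center_of_forall_spectralRadius_add_le hA⟩

/-- Zemánek's characterization of the radical. -/
theorem eq_zero_of_forall_spectralRadius_add_eq
    (hA : Ideal.jacobson (⊥ : Ideal A) = ⊥) {a : A}
    (h : ∀ x : A, spectralRadius ℂ (a + x) = spectralRadius ℂ x) : a = 0 := by
  have ha : spectralRadius ℂ a = 0 := by simpa using h 0
  have hc : a ∈ Set.center A :=
    mem_center_of_forall_spectralRadius_add_le hA fun x => by rw [h, ha, zero_add]
  simpa [hA] using mem_jacobson_bot_of_mem_center hc ha

end SpectralRadius

/-- If `A` is a semisimple complex unital Banach algebra, `B` a complex unital Banach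
algebra, and `T : A → B` is surjective with `r(x+y) = r(Tx+Ty)` for all `x, y`, then
`B` is semisimple and `Z(B) = T(Z(A))`. -/
theorem semisimple_and_center_of_spectralRadius_additive_preserver
    {A B : Type*} [NormedRing A] [NormedAlgebra ℂ A] [CompleteSpace A]
    [NormedRing B] [NormedAlgebra ℂ B] [CompleteSpace B]
    (hA : Ideal.jacobson (⊥ : Ideal A) = ⊥)
    (T : A → B)
    (hsurj : Function.Surjective T)
    (hr : ∀ x y : A, spectralRadius ℂ (x + y) = spectralRadius ℂ (T x + T y)) :
    Ideal.jacobson (⊥ : Ideal B) = ⊥ ∧ Set.center B = T '' Set.center A := by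
  have hT (x : A) : spectralRadius ℂ (T x) = spectralRadius ℂ x := by
    have := hr x x
    rw [spectralRadius_add_self, spectralRadius_add_self] at this
    exact ((ENNReal.mul_right_inj two_ne_zero ENNReal.ofNat_ne_top).1 this).symm
  have hzero {b : B} (hb : b ∈ Ideal.jacobson (⊥ : Ideal B)) : b = T 0 := by
    obtain ⟨a, rfl⟩ := hsurj b
    rw [eq_zero_of_forall_spectralRadius_add_eq hA (a := a) fun x => by
      rw [hr, spectralRadius_add_of_mem_jacobson_bot hb, hT]]
  have hB : Ideal.jacobson (⊥ : Ideal B) = ⊥ :=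
    (Submodule.eq_bot_iff _).2 fun b hb => (hzero hb).trans (hzero (zero_mem _)).symm
  refine ⟨hB, ?_⟩
  have hcenter (a : A) : T a ∈ Set.center B ↔ a ∈ Set.center A := by
    rw [mem_center_iff_forall_spectralRadius_add_le hA,
      mem_center_iff_forall_spectralRadius_add_le hB, hsurj.forall]
    simp only [hr, hT]
  ext b
  obtain ⟨a, rfl⟩ := hsurj b
  refine ⟨fun h => ⟨a, (hcenter a).1 h, rfl⟩, ?_⟩
  rintro ⟨a', ha', h⟩
  exact h ▸ (hcenter a').2 ha'
end
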